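/- Let g ≥ 2 and n = 2g+2. Consider the set X_n := (𝔽_q*/(𝔽_q*)²) × {rational n-sets of P¹}, on which GL₂(𝔽_q) acts by γ·(λ̄, S) := (λ̄·J(γ,S)·(𝔽_q*)², γ(S)) (this is a well-defined action since n is even, and scalar matrices act trivially). Then the number of GL₂(𝔽_q)-orbits on X_n — which equals the number hyp(g) of k-isomorphism classes of hyperelliptic curves of genus g over 𝔽_q — is hyp(g) = 2q^{2g−1} + Σ_{m | 2g+2, m > 1} ( φ(m)·[A₀((2g+2)/m)]_{m | q+1 and (2g+2)/m even} + φ(m)·[A₂((2g+2)/m)]_{m | q−1} + 2·[A₁((2g+2)/m)]_{m = p} ) + Σ_{m | 2g+1, m > 1} ( 2φ(m)·[A₂((2g+1)/m)]_{m | q−1} + 2·[A₁((2g+1)/m)]_{m = p} ) + Σ_{m | 2g, m > 1} φ(m)·( [A₀(2g/m)]_{m | q+1 and 2g/m ≡ (q+1)/m (mod 2)} + [A₂(2g/m)]_{m | q−1 and (q−1)/m even} ). -/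

import Mathlib

noncomputable section

open Polynomial

namespace Hyp

attribute [local instance] Classical.propDecidable Classical.decEq

variable (F : Type) [Field F] [Fintype F]

/-- The embedding of `F` into its algebraic closure. -/
def em : F →+* AlgebraicClosure F := algebraMap F (AlgebraicClosure F)

/-- The Frobenius `t ↦ t^q` acting on `P¹(k̄) = k̄ ∪ {∞}`, where `∞ = none`. -/
def frobP1 : Option (AlgebraicClosure F) → Option (AlgebraicClosure F) :=
  Option.map fun x => x ^ Fintype.card F

variable {F}

/-- The Möbius action of a `2×2` matrix `(a b; c d)` over `F` on `P¹(k̄) = k̄ ∪ {∞}`: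
`t ↦ (at+b)/(ct+d)`, with the usual conventions at `∞` and at poles. -/
def moebius (γ : Matrix (Fin 2) (Fin 2) F) :
    Option (AlgebraicClosure F) → Option (AlgebraicClosure F)
  | none =>
      if γ 1 0 = 0 then none else some (em F (γ 0 0) / em F (γ 1 0))
  | some x =>
      if em F (γ 1 0) * x + em F (γ 1 1) = 0 then none
      else some ((em F (γ 0 0) * x + em F (γ 0 1)) / (em F (γ 1 0) * x + em F (γ 1 1)))

/-- The local multiplier `j(γ,t)`. -/
def locMult (γ : Matrix (Fin 2) (Fin 2) F) :
    Option (AlgebraicClosure F) → AlgebraicClosure F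
  | none => if γ 1 0 = 0 then em F (γ 1 1) else em F (-γ.det / γ 1 0)
  | some x =>
      if em F (γ 1 0) * x + em F (γ 1 1) = 0 then em F (γ 1 0)
      else em F γ.det / (em F (γ 1 0) * x + em F (γ 1 1))

/-- The global multiplier `J(γ,S) = ∏_{t ∈ S} j(γ,t)`. -/
def Jmult (γ : Matrix (Fin 2) (Fin 2) F) (S : Finset (Option (AlgebraicClosure F))) :
    AlgebraicClosure F :=
  ∏ t ∈ S, locMult γ t

/-- `S` is a rational `n`-set of `P¹`: it has `n` elements and is Frobenius-stable. -/
def IsRatSet (n : ℕ) (S : Finset (Option (AlgebraicClosure F))) : Prop :=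
  S.card = n ∧ S.image (frobP1 F) = S

/-- `m` is the order of `γ` in `PGL₂(F)`: the least positive integer such that `γ^m`
is a scalar matrix. -/
def IsPGLOrder (γ : Matrix (Fin 2) (Fin 2) F) (m : ℕ) : Prop :=
  IsLeast {n : ℕ | 0 < n ∧ ∃ lam : F, γ ^ n = lam • (1 : Matrix (Fin 2) (Fin 2) F)} m

/-- `J(γ,S)` is a square in `F*`. -/
def IsSquareJ (γ : Matrix (Fin 2) (Fin 2) F) (S : Finset (Option (AlgebraicClosure F))) : Prop :=
  ∃ v : F, v ≠ 0 ∧ Jmult γ S = em F (v * v)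

/-- The monic polynomial `f_S(x) = ∏_{t ∈ S, t ≠ ∞} (x - t)` attached to a finite subset
of `P¹(k̄)`. -/
def fpoly (S : Finset (Option (AlgebraicClosure F))) : Polynomial (AlgebraicClosure F) :=
  ∏ t ∈ S, t.elim 1 fun a => X - C a

/-- `t` belongs to `P¹(F) = F ∪ {∞}` inside `P¹(k̄)`. -/
def inP1k (t : Option (AlgebraicClosure F)) : Prop :=
  t = none ∨ ∃ x : F, t = some (em F x)

/-- `t` belongs to `P¹(𝔽_{q²})` inside `P¹(k̄)`. -/
def inP1k2 [Fintype F] (t : Option (AlgebraicClosure F)) : Prop :=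
  t = none ∨ ∃ x : AlgebraicClosure F, x ^ Fintype.card F ^ 2 = x ∧ t = some x

/-- `A₁(n)`: the normalized number of rational `n`-sets of `𝔸¹`; `A₁(x) = 0` when `x`
is not a positive integer. -/
def A1 (q : ℕ) : ℕ → ℚ
  | 0 => 0
  | 1 => 1
  | (n + 2) => (q : ℚ) ^ (n + 1) - (q : ℚ) ^ n

/-- `A₂(n) = (qⁿ - (-1)ⁿ)/(q+1)`: the normalized number of rational `n`-sets of `𝔾_m`. -/
def A2 (q n : ℕ) : ℚ := ((q : ℚ) ^ n - (-1) ^ n) / ((q : ℚ) + 1)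

/-- `A₀(n) = (q^{n+1} - qⁿ - (-1)^{⌈n/2⌉} q + (-1)^{⌈(n-1)/2⌉})/(q²+1)`: the normalized
number of rational `n`-sets of `P¹ ∖ {t, tᵠ}`. -/
def A0 (q n : ℕ) : ℚ :=
  ((q : ℚ) ^ (n + 1) - (q : ℚ) ^ n - (-1) ^ ((n + 1) / 2) * (q : ℚ) + (-1) ^ (n / 2)) /
    ((q : ℚ) ^ 2 + 1)

/-- The `GL₂(F)`-orbit of the pair `(λ, S) ∈ (F*/(F*)²) × {rational n-sets}` under the
action `γ·(λ,S) = (λ·J(γ,S), γ(S))`, with the square-class of the first coordinate. -/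
def orbitPair {F : Type} [Field F] [Fintype F] (lam : F)
    (S : Finset (Option (AlgebraicClosure F))) :
    Set (F × Finset (Option (AlgebraicClosure F))) :=
  {p | ∃ γ : GL (Fin 2) F, ∃ u : F, u ≠ 0 ∧
      p.2 = S.image (moebius γ.val) ∧
      em F p.1 * em F (u * u) = em F lam * Jmult γ.val S}

section Blocks

variable {α : Type*} [DecidableEq α]

/-- The number of subsets of `V` of size `m * N` that are unions of blocks `O y`. -/
def unionCount (V : Finset α) (O : α → Finset α) (m N : ℕ) : ℕ :=
  (V.powerset.filter fun S => (∀ y ∈ S, O y ⊆ S) ∧ S.card = m * N).card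

/-- The number of subsets of `V` of size `m * N` containing `y` that are unions of blocks. -/
def unionCountAt (V : Finset α) (O : α → Finset α) (m : ℕ) (y : α) (N : ℕ) : ℕ :=
  ((V.powerset.filter fun S => (∀ y ∈ S, O y ⊆ S) ∧ S.card = m * N).filter (y ∈ ·)).card

variable {V : Finset α} {O : α → Finset α} {m : ℕ} {d : α → ℕ}

lemma unionCountAt_eq_zero (hm : 0 < m) {y : α} (hcard : (O y).card = m * d y) {N : ℕ}
    (hN : N < d y) : unionCountAt V O m y N = 0 := by
  rw [unionCountAt, Finset.card_eq_zero, Finset.filter_eq_empty_iff]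
  intro S hS hyS
  simp only [Finset.mem_filter, Finset.mem_powerset] at hS
  have h1 := Finset.card_le_card (hS.2.1 y hyS)
  rw [hcard, hS.2.2] at h1
  exact absurd (Nat.le_of_mul_le_mul_left h1 hm) (by omega)

lemma unionCountAt_add (hself : ∀ y ∈ V, y ∈ O y) (hsub : ∀ y ∈ V, O y ⊆ V)
    (heq : ∀ y ∈ V, ∀ z ∈ O y, O z = O y) (hcard : ∀ y ∈ V, (O y).card = m * d y)
    {y : α} (hy : y ∈ V) (N : ℕ) :
    unionCountAt V O m y (N + d y) + unionCountAt V O m y N = unionCount V O m N := by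
  rw [unionCount, ← Finset.card_filter_add_card_filter_not (p := fun S : Finset α => y ∈ S),
    add_comm, ← unionCountAt]
  congr 1
  have hdisj : ∀ S ⊆ V, (∀ z ∈ S, O z ⊆ S) → y ∉ S → Disjoint S (O y) := by
    intro S hSV hS hyS
    rw [Finset.disjoint_left]
    intro w hw hwy
    exact hyS (hS w hw (by rw [heq y hy w hwy]; exact hself y hy))
  refine Finset.card_bij' (fun S _ => S \ O y) (fun S _ => S ∪ O y) ?_ ?_ ?_ ?_
  · intro S hS
    simp only [Finset.mem_filter, Finset.mem_powerset] at hS ⊢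
    obtain ⟨⟨hSV, hS, hc⟩, hyS⟩ := hS
    refine ⟨⟨Finset.sdiff_subset.trans hSV, ?_, ?_⟩, ?_⟩
    · intro z hz w hw
      rw [Finset.mem_sdiff] at hz ⊢
      refine ⟨hS z hz.1 hw, fun hwy => hz.2 ?_⟩
      rw [← heq y hy w hwy, heq z (hSV hz.1) w hw]
      exact hself z (hSV hz.1)
    · rw [Finset.card_sdiff_of_subset (hS y hyS), hc, hcard y hy, mul_add]
      omega
    · simp [hself y hy]
  · intro S hS
    simp only [Finset.mem_filter, Finset.mem_powerset] at hS ⊢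
    obtain ⟨⟨hSV, hS, hc⟩, hyS⟩ := hS
    refine ⟨⟨Finset.union_subset hSV (hsub y hy), ?_, ?_⟩, ?_⟩
    · intro z hz
      rw [Finset.mem_union] at hz
      rcases hz with hz | hz
      · exact (hS z hz).trans Finset.subset_union_left
      · rw [heq y hy z hz]; exact Finset.subset_union_right
    · rw [Finset.card_union_of_disjoint (hdisj S hSV hS hyS), hc, hcard y hy, mul_add]
    · exact Finset.mem_union_right _ (hself y hy)
  · intro S hS
    simp only [Finset.mem_filter, Finset.mem_powerset] at hS
    exact Finset.sdiff_union_of_subset (hS.1.2.1 y hS.2)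
  · intro S hS
    simp only [Finset.mem_filter, Finset.mem_powerset] at hS
    exact Finset.union_sdiff_cancel_right (hdisj S hS.1.1 hS.1.2.1 hS.2)

lemma sum_unionCountAt (N : ℕ) :
    ∑ y ∈ V, unionCountAt V O m y N = m * N * unionCount V O m N := by
  set P := V.powerset.filter fun S => (∀ y ∈ S, O y ⊆ S) ∧ S.card = m * N with hP
  have h1 : ∀ y ∈ V, unionCountAt V O m y N = ∑ S ∈ P, if y ∈ S then 1 else 0 := by
    intro y _
    rw [unionCountAt, Finset.card_filter]
  have h2 : ∀ S ∈ P, (∑ y ∈ V, if y ∈ S then 1 else 0) = m * N := by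
    intro S hS
    simp only [hP, Finset.mem_filter, Finset.mem_powerset] at hS
    rw [← hS.2.2, ← Finset.card_filter, Finset.filter_mem_eq_inter,
      Finset.inter_eq_right.mpr hS.1]
  rw [Finset.sum_congr rfl h1, Finset.sum_comm, Finset.sum_congr rfl h2, Finset.sum_const,
    smul_eq_mul, mul_comm, unionCount]

/-- The power series `u ^ d / (1 + u ^ d)`. -/
def altSeries (d : ℕ) : PowerSeries ℚ :=
  PowerSeries.mk fun j => if d ∣ j ∧ 0 < j then (-1) ^ (j / d - 1) else 0

lemma altSeries_mul {d : ℕ} (hd : 0 < d) :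
    altSeries d * (1 + PowerSeries.X ^ d) = PowerSeries.X ^ d := by
  ext j
  rw [mul_add, mul_one, map_add, PowerSeries.coeff_mul_X_pow', PowerSeries.coeff_X_pow]
  simp only [altSeries, PowerSeries.coeff_mk]
  by_cases hdj : d ∣ j
  · obtain ⟨k, rfl⟩ := hdj
    rcases k with _ | _ | k
    · simp [hd.ne]
    · simp [hd]
    · have h1 : d * (k + 1 + 1) - d = d * (k + 1) := by rw [mul_add d (k + 1) 1]; omega
      have h2 : d * (k + 1 + 1) ≠ d := by
        intro h
        have := Nat.eq_of_mul_eq_mul_left hd (h.trans (mul_one d).symm)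
        omega
      have h3 : d ≤ d * (k + 1 + 1) := Nat.le_mul_of_pos_right d (by omega)
      rw [if_pos ⟨Dvd.intro _ rfl, by positivity⟩, if_pos h3, h1,
        if_pos ⟨Dvd.intro _ rfl, by positivity⟩, if_neg h2, Nat.mul_div_cancel_left _ hd,
        Nat.mul_div_cancel_left _ hd]
      simp [pow_succ]
  · have h1 : j ≠ d := by rintro rfl; exact hdj dvd_rfl
    rw [if_neg (fun h => hdj h.1), if_neg h1]
    split_ifs with h2 h3
    · exact absurd ((Nat.dvd_sub_iff_left h2 dvd_rfl).mp h3.1) hdj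
    · simp
    · simp

lemma coeff_altSeries {d j : ℕ} (hd : 0 < d) (hj : 0 < j) :
    PowerSeries.coeff j (altSeries d) =
      (if d ∣ j then 1 else 0) - 2 * (if Even j ∧ d ∣ j / 2 then 1 else 0) := by
  simp only [altSeries, PowerSeries.coeff_mk]
  by_cases hdj : d ∣ j
  · obtain ⟨k, rfl⟩ := hdj
    have hk : 0 < k := Nat.pos_of_mul_pos_left hj
    rw [if_pos ⟨Dvd.intro _ rfl, hj⟩, if_pos (Dvd.intro _ rfl), Nat.mul_div_cancel_left _ hd]
    rcases Nat.even_or_odd' k with ⟨l, rfl | rfl⟩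
    · have h1 : d * (2 * l) / 2 = d * l := by
        rw [mul_left_comm]; exact Nat.mul_div_cancel_left _ two_pos
      rw [if_pos ⟨(even_two_mul l).mul_left d, by rw [h1]; exact Dvd.intro _ rfl⟩,
        Odd.neg_one_pow ⟨l - 1, by omega⟩]
      norm_num
    · rw [if_neg]
      · simp
      · rintro ⟨⟨r, hr⟩, s, hs⟩
        have h1 : d * (2 * l + 1) = d * (2 * s) := by
          rw [mul_left_comm, ← hs]; omega
        have := Nat.eq_of_mul_eq_mul_left hd h1
        omega
  · rw [if_neg (fun h => hdj h.1), if_neg hdj, if_neg]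
    · simp
    · rintro ⟨⟨r, hr⟩, h⟩
      exact hdj (h.trans ⟨2, by omega⟩)

/-- The Newton-type recursion for the number of unions of blocks. -/
lemma unionCount_recursion (hm : 0 < m) (hself : ∀ y ∈ V, y ∈ O y) (hsub : ∀ y ∈ V, O y ⊆ V)
    (heq : ∀ y ∈ V, ∀ z ∈ O y, O z = O y) (hcard : ∀ y ∈ V, (O y).card = m * d y)
    (hd : ∀ y ∈ V, 0 < d y) (N : ℕ) :
    (m : ℚ) * N * unionCount V O m N = ∑ ij ∈ Finset.HasAntidiagonal.antidiagonal N,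
      (unionCount V O m ij.1 : ℚ) * ∑ y ∈ V, PowerSeries.coeff ij.2 (altSeries (d y)) := by
  have key : ∀ y ∈ V, (PowerSeries.mk fun N => (unionCountAt V O m y N : ℚ)) =
      (PowerSeries.mk fun N => (unionCount V O m N : ℚ)) * altSeries (d y) := by
    intro y hy
    have h1 : (1 + PowerSeries.X ^ d y : PowerSeries ℚ) ≠ 0 := by
      intro h
      have := congrArg (PowerSeries.coeff 0) h
      simp [zero_pow (hd y hy).ne'] at this
    apply mul_right_cancel₀ h1
    rw [mul_assoc, altSeries_mul (hd y hy)]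
    ext j
    rw [mul_add, mul_one, map_add, PowerSeries.coeff_mul_X_pow', PowerSeries.coeff_mul_X_pow']
    simp only [PowerSeries.coeff_mk]
    split_ifs with h
    · rw [← unionCountAt_add hself hsub heq hcard hy (j - d y), Nat.sub_add_cancel h]
      push_cast; ring
    · rw [unionCountAt_eq_zero hm (hcard y hy) (by omega)]; simp
  have h2 := congrArg (Nat.cast (R := ℚ)) (sum_unionCountAt (V := V) (O := O) (m := m) N)
  push_cast at h2
  rw [← h2]
  have h3 : ∀ y ∈ V, (unionCountAt V O m y N : ℚ) = ∑ ij ∈ Finset.HasAntidiagonal.antidiagonal N,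
      (unionCount V O m ij.1 : ℚ) * PowerSeries.coeff ij.2 (altSeries (d y)) := by
    intro y hy
    have := congrArg (PowerSeries.coeff N) (key y hy)
    simpa [PowerSeries.coeff_mul] using this
  rw [Finset.sum_congr rfl h3, Finset.sum_comm]
  simp only [Finset.mul_sum]

end Blocks

section CommutingMaps

variable {α : Type*}

/-- `σ` and `γ` are commuting injective self-maps preserving `U`, every point of `U` is
periodic under `σ`, and `γ` acts on `U` through a free action of the cyclic group of order `m`. -/
structure FreePair (σ γ : α → α) (U : Set α) (m : ℕ) : Prop where
  pos : 0 < m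
  comm : Function.Commute σ γ
  inj_left : Function.Injective σ
  inj_right : Function.Injective γ
  maps_left : ∀ y ∈ U, σ y ∈ U
  maps_right : ∀ y ∈ U, γ y ∈ U
  periodic : ∀ y ∈ U, ∃ j, 0 < j ∧ σ^[j] y = y
  iterate_eq : ∀ y ∈ U, γ^[m] y = y
  free : ∀ y ∈ U, ∀ i, 0 < i → i < m → γ^[i] y ≠ y

namespace FreePair

variable {σ γ : α → α} {U : Set α} {m : ℕ}

lemma maps_left_iterate (h : FreePair σ γ U m) {y : α} (hy : y ∈ U) (j : ℕ) : σ^[j] y ∈ U := by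
  induction j with
  | zero => exact hy
  | succ j ih => rw [Function.iterate_succ_apply']; exact h.maps_left _ ih

lemma maps_right_iterate (h : FreePair σ γ U m) {y : α} (hy : y ∈ U) (j : ℕ) : γ^[j] y ∈ U := by
  induction j with
  | zero => exact hy
  | succ j ih => rw [Function.iterate_succ_apply']; exact h.maps_right _ ih

lemma comm_iterate (h : FreePair σ γ U m) (a i : ℕ) (y : α) :
    σ^[a] (γ^[i] y) = γ^[i] (σ^[a] y) :=
  (h.comm.iterate_iterate a i).eq y

lemma iterate_mod (h : FreePair σ γ U m) {y : α} (hy : y ∈ U) (i : ℕ) :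
    γ^[i % m] y = γ^[i] y :=
  Function.IsPeriodicPt.iterate_mod_apply (h.iterate_eq y hy) i

lemma iterate_injOn (h : FreePair σ γ U m) {y : α} (hy : y ∈ U) :
    Set.InjOn (fun i => γ^[i] y) (Finset.range m : Set ℕ) := by
  have key : ∀ i j, i < j → j < m → γ^[i] y ≠ γ^[j] y := by
    intro i j hij hj heq
    rw [← Nat.add_sub_cancel' hij.le, Function.iterate_add_apply] at heq
    exact h.free y hy (j - i) (by omega) (by omega) ((h.inj_right.iterate i heq).symm)
  intro i hi j hj heq
  simp only [Finset.coe_range, Set.mem_Iio] at hi hj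
  rcases lt_trichotomy i j with hlt | heq' | hlt
  · exact absurd heq (key i j hlt hj)
  · exact heq'
  · exact absurd heq.symm (key j i hlt hi)

end FreePair

variable [DecidableEq α]

/-- The first `m` points of the forward orbit of `y` under `γ`. -/
def orbitFinset (γ : α → α) (m : ℕ) (y : α) : Finset α :=
  (Finset.range m).image fun i => γ^[i] y

/-- The least `d > 0` such that `σ^d` maps the `γ`-orbit of `y` to itself. -/
def orbitDegree (σ γ : α → α) (m : ℕ) (y : α) : ℕ :=
  Function.minimalPeriod (Finset.image σ) (orbitFinset γ m y)

/-- The joint orbit of `y` under `σ` and `γ`. -/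
def jointOrbit (σ γ : α → α) (m : ℕ) (y : α) : Finset α :=
  (Finset.range (orbitDegree σ γ m y)).biUnion fun a => orbitFinset γ m (σ^[a] y)

namespace FreePair

variable {σ γ : α → α} {U : Set α} {m : ℕ}

lemma mem_orbitFinset (h : FreePair σ γ U m) {y z : α} (hy : y ∈ U) :
    z ∈ orbitFinset γ m y ↔ ∃ i, γ^[i] y = z := by
  simp only [orbitFinset, Finset.mem_image, Finset.mem_range]
  constructor
  · rintro ⟨i, -, hi⟩; exact ⟨i, hi⟩
  · rintro ⟨i, hi⟩
    exact ⟨i % m, Nat.mod_lt _ h.pos, by rw [h.iterate_mod hy, hi]⟩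

lemma card_orbitFinset (h : FreePair σ γ U m) {y : α} (hy : y ∈ U) :
    (orbitFinset γ m y).card = m := by
  rw [orbitFinset, Finset.card_image_of_injOn (h.iterate_injOn hy), Finset.card_range]

lemma orbitFinset_eq (h : FreePair σ γ U m) {y z : α} (hy : y ∈ U)
    (hz : z ∈ orbitFinset γ m y) : orbitFinset γ m z = orbitFinset γ m y := by
  obtain ⟨i, rfl⟩ := (h.mem_orbitFinset hy).mp hz
  have hz' := h.maps_right_iterate hy i
  apply Finset.eq_of_subset_of_card_le
  · intro w hw
    obtain ⟨j, rfl⟩ := (h.mem_orbitFinset hz').mp hw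
    exact (h.mem_orbitFinset hy).mpr ⟨j + i, Function.iterate_add_apply _ _ _ _⟩
  · rw [h.card_orbitFinset hy, h.card_orbitFinset hz']

lemma self_mem_orbitFinset (h : FreePair σ γ U m) {y : α} (hy : y ∈ U) :
    y ∈ orbitFinset γ m y :=
  (h.mem_orbitFinset hy).mpr ⟨0, rfl⟩

lemma image_iterate_orbitFinset (h : FreePair σ γ U m) (y : α) (j : ℕ) :
    (Finset.image σ)^[j] (orbitFinset γ m y) = orbitFinset γ m (σ^[j] y) := by
  induction j generalizing y with
  | zero => rfl
  | succ j ih =>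
    rw [Function.iterate_succ_apply, Function.iterate_succ_apply, ← ih]
    congr 1
    simp only [orbitFinset, Finset.image_image]
    refine Finset.image_congr fun i _ => ?_
    exact h.comm_iterate 1 i y

lemma orbitDegree_dvd (h : FreePair σ γ U m) {y : α} (hy : y ∈ U) (j : ℕ) :
    orbitDegree σ γ m y ∣ j ↔ ∃ i < m, σ^[j] y = γ^[i] y := by
  rw [orbitDegree, ← Function.isPeriodicPt_iff_minimalPeriod_dvd, Function.IsPeriodicPt,
    Function.IsFixedPt, h.image_iterate_orbitFinset]
  constructor
  · intro heq
    have h1 := h.self_mem_orbitFinset (h.maps_left_iterate hy j)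
    rw [heq] at h1
    simp only [orbitFinset, Finset.mem_image, Finset.mem_range] at h1
    obtain ⟨i, hi, hi'⟩ := h1
    exact ⟨i, hi, hi'.symm⟩
  · rintro ⟨i, -, hi⟩
    exact h.orbitFinset_eq hy ((h.mem_orbitFinset hy).mpr ⟨i, hi.symm⟩)

lemma orbitDegree_pos (h : FreePair σ γ U m) {y : α} (hy : y ∈ U) :
    0 < orbitDegree σ γ m y := by
  obtain ⟨j, hj, hj'⟩ := h.periodic y hy
  exact Nat.pos_of_dvd_of_pos ((h.orbitDegree_dvd hy j).mpr ⟨0, h.pos, hj'⟩) hj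

lemma mem_jointOrbit (h : FreePair σ γ U m) {y z : α} (hy : y ∈ U) :
    z ∈ jointOrbit σ γ m y ↔ ∃ a i, σ^[a] (γ^[i] y) = z := by
  simp only [jointOrbit, Finset.mem_biUnion, Finset.mem_range]
  constructor
  · rintro ⟨a, -, ha⟩
    obtain ⟨i, hi⟩ := (h.mem_orbitFinset (h.maps_left_iterate hy a)).mp ha
    exact ⟨a, i, by rw [h.comm_iterate, hi]⟩
  · rintro ⟨a, i, hz⟩
    refine ⟨a % orbitDegree σ γ m y, Nat.mod_lt _ (h.orbitDegree_pos hy), ?_⟩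
    rw [← h.image_iterate_orbitFinset, orbitDegree, Function.iterate_mod_minimalPeriod_eq,
      h.image_iterate_orbitFinset, h.mem_orbitFinset (h.maps_left_iterate hy a)]
    exact ⟨i, by rw [← h.comm_iterate, hz]⟩

lemma self_mem_jointOrbit (h : FreePair σ γ U m) {y : α} (hy : y ∈ U) :
    y ∈ jointOrbit σ γ m y :=
  (h.mem_jointOrbit hy).mpr ⟨0, 0, rfl⟩

lemma mem_of_mem_jointOrbit (h : FreePair σ γ U m) {y z : α} (hy : y ∈ U)
    (hz : z ∈ jointOrbit σ γ m y) : z ∈ U := by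
  obtain ⟨a, i, rfl⟩ := (h.mem_jointOrbit hy).mp hz
  exact h.maps_left_iterate (h.maps_right_iterate hy i) a

lemma jointOrbit_subset_of_mem (h : FreePair σ γ U m) {y z : α} (hy : y ∈ U)
    (hz : z ∈ jointOrbit σ γ m y) : jointOrbit σ γ m z ⊆ jointOrbit σ γ m y := by
  intro w hw
  obtain ⟨b, j, rfl⟩ := (h.mem_jointOrbit (h.mem_of_mem_jointOrbit hy hz)).mp hw
  obtain ⟨a, i, rfl⟩ := (h.mem_jointOrbit hy).mp hz
  refine (h.mem_jointOrbit hy).mpr ⟨b + a, j + i, ?_⟩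
  rw [Function.iterate_add_apply, Function.iterate_add_apply, h.comm_iterate a j]

lemma jointOrbit_eq (h : FreePair σ γ U m) {y z : α} (hy : y ∈ U)
    (hz : z ∈ jointOrbit σ γ m y) : jointOrbit σ γ m z = jointOrbit σ γ m y := by
  refine (h.jointOrbit_subset_of_mem hy hz).antisymm ?_
  have hzU := h.mem_of_mem_jointOrbit hy hz
  refine h.jointOrbit_subset_of_mem hzU ?_
  obtain ⟨a, i, rfl⟩ := (h.mem_jointOrbit hy).mp hz
  obtain ⟨j, hj, hj'⟩ := h.periodic y hy
  refine (h.mem_jointOrbit hzU).mpr ⟨a * j - a, i * m - i, ?_⟩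
  rw [← h.comm_iterate, ← Function.iterate_add_apply, ← Function.iterate_add_apply,
    Nat.sub_add_cancel (Nat.le_mul_of_pos_right a hj),
    Nat.sub_add_cancel (Nat.le_mul_of_pos_right i h.pos)]
  have h1 : γ^[i * m] y = y := Function.IsPeriodicPt.const_mul (h.iterate_eq y hy) i
  have h2 : σ^[a * j] y = y := Function.IsPeriodicPt.const_mul hj' a
  rw [h1, h2]

lemma card_jointOrbit (h : FreePair σ γ U m) {y : α} (hy : y ∈ U) :
    (jointOrbit σ γ m y).card = m * orbitDegree σ γ m y := by
  rw [jointOrbit, Finset.card_biUnion,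
    Finset.sum_congr rfl fun a _ => h.card_orbitFinset (h.maps_left_iterate hy a),
    Finset.sum_const, Finset.card_range, smul_eq_mul, mul_comm]
  intro a ha b hb hab
  rw [Finset.coe_range] at ha hb
  rw [Function.onFun, Finset.disjoint_left]
  intro w hwa hwb
  apply hab
  have h1 := (h.orbitFinset_eq (h.maps_left_iterate hy a) hwa).symm.trans
    (h.orbitFinset_eq (h.maps_left_iterate hy b) hwb)
  rw [← h.image_iterate_orbitFinset, ← h.image_iterate_orbitFinset] at h1
  exact Function.iterate_injOn_Iio_minimalPeriod ha hb h1

lemma jointOrbit_subset_iff (h : FreePair σ γ U m) {S : Finset α} (hS : ∀ y ∈ S, y ∈ U) :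
    (∀ y ∈ S, jointOrbit σ γ m y ⊆ S) ↔ S.image σ = S ∧ S.image γ = S := by
  constructor
  · intro hO
    constructor
    · apply Finset.eq_of_subset_of_card_le
      · intro z hz
        obtain ⟨y, hy, rfl⟩ := Finset.mem_image.mp hz
        exact hO y hy ((h.mem_jointOrbit (hS y hy)).mpr ⟨1, 0, rfl⟩)
      · rw [Finset.card_image_of_injective _ h.inj_left]
    · apply Finset.eq_of_subset_of_card_le
      · intro z hz
        obtain ⟨y, hy, rfl⟩ := Finset.mem_image.mp hz
        exact hO y hy ((h.mem_jointOrbit (hS y hy)).mpr ⟨0, 1, rfl⟩)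
      · rw [Finset.card_image_of_injective _ h.inj_right]
  · rintro ⟨h1, h2⟩ y hy z hz
    obtain ⟨a, i, rfl⟩ := (h.mem_jointOrbit (hS y hy)).mp hz
    have h3 : ∀ i, γ^[i] y ∈ S := by
      intro i
      induction i with
      | zero => exact hy
      | succ i ih =>
        rw [Function.iterate_succ_apply', ← h2]
        exact Finset.mem_image_of_mem γ ih
    induction a with
    | zero => exact h3 i
    | succ a ih =>
      rw [Function.iterate_succ_apply', ← h1]
      exact Finset.mem_image_of_mem σ (ih ((h.mem_jointOrbit (hS y hy)).mpr ⟨a, i, rfl⟩))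

end FreePair

/-- The finite subsets of `U` of size `n` that are stable under `σ` and `γ`. -/
def stableSets (σ γ : α → α) (U : Set α) (n : ℕ) : Set (Finset α) :=
  {S | (∀ y ∈ S, y ∈ U) ∧ S.image σ = S ∧ S.image γ = S ∧ S.card = n}

namespace FreePair

variable {σ γ : α → α} {U : Set α} {m : ℕ}

/-- The set of points of `U` whose orbit degree divides `j`. -/
lemma setOf_orbitDegree_dvd (h : FreePair σ γ U m) (j : ℕ) :
    {y ∈ U | orbitDegree σ γ m y ∣ j} =
      ⋃ i ∈ Finset.range m, {y ∈ U | σ^[j] y = γ^[i] y} := by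
  ext y
  simp only [Set.mem_ofPred_eq, Set.mem_iUnion, Finset.mem_range]
  constructor
  · rintro ⟨hy, hd⟩
    obtain ⟨i, hi, hi'⟩ := (h.orbitDegree_dvd hy j).mp hd
    exact ⟨i, hi, hy, hi'⟩
  · rintro ⟨i, hi, hy, hi'⟩
    exact ⟨hy, (h.orbitDegree_dvd hy j).mpr ⟨i, hi, hi'⟩⟩

lemma ncard_orbitDegree_dvd (h : FreePair σ γ U m) {c j : ℕ}
    (hfin : ∀ i < m, {y ∈ U | σ^[j] y = γ^[i] y}.Finite)
    (hc : ∀ i < m, {y ∈ U | σ^[j] y = γ^[i] y}.ncard = c) :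
    {y ∈ U | orbitDegree σ γ m y ∣ j}.Finite ∧
      {y ∈ U | orbitDegree σ γ m y ∣ j}.ncard = m * c := by
  rw [h.setOf_orbitDegree_dvd]
  have hF : (⋃ i ∈ Finset.range m, {y ∈ U | σ^[j] y = γ^[i] y}).Finite :=
    Set.Finite.biUnion (Finset.finite_toSet _) fun i hi => hfin i (Finset.mem_range.mp hi)
  refine ⟨hF, ?_⟩
  rw [Set.ncard_eq_toFinset_card _ hF]
  have h1 : hF.toFinset = (Finset.range m).attach.biUnion
      fun i => (hfin i.1 (Finset.mem_range.mp i.2)).toFinset := by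
    ext y; simp
  rw [h1, Finset.card_biUnion]
  · rw [Finset.sum_congr rfl (g := fun _ => c), Finset.sum_const, Finset.card_attach,
      Finset.card_range, smul_eq_mul]
    intro i _
    rw [← Set.ncard_eq_toFinset_card _ (hfin i.1 (Finset.mem_range.mp i.2)),
      hc i.1 (Finset.mem_range.mp i.2)]
  · intro i _ i' _ hii
    rw [Function.onFun, Finset.disjoint_left]
    intro y hy hy'
    simp only [Set.Finite.mem_toFinset, Set.mem_ofPred_eq] at hy hy'
    exact hii (Subtype.ext (h.iterate_injOn hy.1 i.2 i'.2 (hy.2.symm.trans hy'.2)))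

lemma orbitDegree_le (h : FreePair σ γ U m) {S : Finset α} {N : ℕ}
    (hS : S ∈ stableSets σ γ U (m * N)) {y : α} (hy : y ∈ S) : orbitDegree σ γ m y ≤ N := by
  obtain ⟨hU, h1, h2, h3⟩ := hS
  have h4 := Finset.card_le_card ((h.jointOrbit_subset_iff hU).mpr ⟨h1, h2⟩ y hy)
  rw [h.card_jointOrbit (hU y hy), h3] at h4
  exact Nat.le_of_mul_le_mul_left h4 h.pos

lemma dvd_card (h : FreePair σ γ U m) {S : Finset α} {n : ℕ} (hS : S ∈ stableSets σ γ U n) :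
    m ∣ n := by
  obtain ⟨hU, h1, h2, rfl⟩ := hS
  have hsub := (h.jointOrbit_subset_iff hU).mpr ⟨h1, h2⟩
  have h3 : ∀ y ∈ S, orbitFinset γ m y ⊆ S := fun y hy z hz => by
    obtain ⟨i, rfl⟩ := (h.mem_orbitFinset (hU y hy)).mp hz
    exact hsub y hy ((h.mem_jointOrbit (hU y hy)).mpr ⟨0, i, rfl⟩)
  rw [Finset.card_eq_sum_card_image (orbitFinset γ m) S]
  refine Finset.dvd_sum fun B hB => ?_
  obtain ⟨y, hy, rfl⟩ := Finset.mem_image.mp hB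
  have h4 : S.filter (fun z => orbitFinset γ m z = orbitFinset γ m y) = orbitFinset γ m y := by
    ext z
    rw [Finset.mem_filter]
    constructor
    · rintro ⟨hz, heq⟩
      rw [← heq]; exact h.self_mem_orbitFinset (hU z hz)
    · intro hz
      exact ⟨h3 y hy hz, h.orbitFinset_eq (hU y hy) hz⟩
  rw [h4, h.card_orbitFinset (hU y hy)]

lemma finite_orbitDegree_le (h : FreePair σ γ U m)
    (hfin : ∀ j, 0 < j → ∀ i < m, {y ∈ U | σ^[j] y = γ^[i] y}.Finite) (N : ℕ) :
    {y ∈ U | orbitDegree σ γ m y ≤ N}.Finite := by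
  refine Set.Finite.subset (Set.Finite.biUnion (Finset.finite_toSet (Finset.Icc 1 N))
    (t := fun j => {y ∈ U | orbitDegree σ γ m y ∣ j}) fun j hj => ?_) ?_
  · rw [h.setOf_orbitDegree_dvd]
    exact Set.Finite.biUnion (Finset.finite_toSet _) fun i hi =>
      hfin j (Finset.mem_Icc.mp hj).1 i (Finset.mem_range.mp hi)
  · rintro y ⟨hy, hd⟩
    simp only [Set.mem_iUnion]
    exact ⟨_, Finset.mem_Icc.mpr ⟨h.orbitDegree_pos hy, hd⟩, hy, dvd_rfl⟩

lemma stableSets_eq (h : FreePair σ γ U m) {N B : ℕ} (hNB : N ≤ B) (V : Finset α)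
    (hV : (V : Set α) = {y ∈ U | orbitDegree σ γ m y ≤ B}) :
    stableSets σ γ U (m * N) = (V.powerset.filter fun S =>
      (∀ y ∈ S, jointOrbit σ γ m y ⊆ S) ∧ S.card = m * N : Finset (Finset α)) := by
  have hV' : ∀ y, y ∈ V ↔ y ∈ U ∧ orbitDegree σ γ m y ≤ B := fun y => by
    rw [← Finset.mem_coe, hV]; rfl
  ext S
  simp only [Finset.coe_filter, Finset.mem_powerset, Set.mem_ofPred_eq]
  constructor
  · intro hS
    refine ⟨fun y hy => (hV' y).mpr ⟨hS.1 y hy, (h.orbitDegree_le hS hy).trans hNB⟩,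
      (h.jointOrbit_subset_iff hS.1).mpr ⟨hS.2.1, hS.2.2.1⟩, hS.2.2.2⟩
  · rintro ⟨hSV, hO, hc⟩
    have hU : ∀ y ∈ S, y ∈ U := fun y hy => ((hV' y).mp (hSV hy)).1
    exact ⟨hU, ((h.jointOrbit_subset_iff hU).mp hO).1, ((h.jointOrbit_subset_iff hU).mp hO).2, hc⟩

lemma finite_stableSets (h : FreePair σ γ U m)
    (hfin : ∀ j, 0 < j → ∀ i < m, {y ∈ U | σ^[j] y = γ^[i] y}.Finite) (n : ℕ) :
    (stableSets σ γ U n).Finite := by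
  by_cases hmn : m ∣ n
  · obtain ⟨N, rfl⟩ := hmn
    rw [h.stableSets_eq le_rfl (h.finite_orbitDegree_le hfin N).toFinset (by simp)]
    exact Finset.finite_toSet _
  · convert Set.finite_empty
    ext S
    simpa using fun hS => hmn (h.dvd_card hS)

/-- Newton's recursion for the numbers of stable sets in terms of twisted fixed-point counts. -/
theorem stableSets_recursion (h : FreePair σ γ U m) (c : ℕ → ℕ)
    (hfin : ∀ j, 0 < j → ∀ i < m, {y ∈ U | σ^[j] y = γ^[i] y}.Finite)
    (hc : ∀ j, 0 < j → ∀ i < m, {y ∈ U | σ^[j] y = γ^[i] y}.ncard = c j) (N : ℕ) :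
    (N : ℚ) * (stableSets σ γ U (m * N)).ncard =
      ∑ ij ∈ Finset.HasAntidiagonal.antidiagonal N, ((stableSets σ γ U (m * ij.1)).ncard : ℚ) *
        if ij.2 = 0 then 0 else (c ij.2 - 2 * if Even ij.2 then c (ij.2 / 2) else 0 : ℚ) := by
  set V := (h.finite_orbitDegree_le hfin N).toFinset with hVdef
  have hV : ∀ y, y ∈ V ↔ y ∈ U ∧ orbitDegree σ γ m y ≤ N := fun y => by simp [hVdef]
  have hcount : ∀ M ≤ N, (stableSets σ γ U (m * M)).ncard =
      unionCount V (jointOrbit σ γ m) m M := by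
    intro M hM
    rw [h.stableSets_eq hM V (by simp [hVdef]), Set.ncard_coe_finset, unionCount]
  have hdvd : ∀ j, 0 < j → j ≤ N →
      (V.filter fun y => orbitDegree σ γ m y ∣ j).card = m * c j := by
    intro j hj hjN
    rw [← (h.ncard_orbitDegree_dvd (hfin j hj) (hc j hj)).2, ← Set.ncard_coe_finset]
    congr 1
    ext y
    simp only [Finset.coe_filter, hV, Set.mem_ofPred_eq]
    exact ⟨fun hy => ⟨hy.1.1, hy.2⟩, fun hy => ⟨⟨hy.1, (Nat.le_of_dvd hj hy.2).trans hjN⟩, hy.2⟩⟩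
  have hrec := unionCount_recursion (V := V) (O := jointOrbit σ γ m) (d := orbitDegree σ γ m)
    h.pos (fun y hy => h.self_mem_jointOrbit ((hV y).mp hy).1)
    (fun y hy z hz => by
      have hyU := ((hV y).mp hy).1
      refine (hV z).mpr ⟨h.mem_of_mem_jointOrbit hyU hz, ?_⟩
      have h1 := h.card_jointOrbit (h.mem_of_mem_jointOrbit hyU hz)
      rw [h.jointOrbit_eq hyU hz, h.card_jointOrbit hyU] at h1
      rw [← Nat.eq_of_mul_eq_mul_left h.pos h1]
      exact ((hV y).mp hy).2)
    (fun y hy z hz => h.jointOrbit_eq ((hV y).mp hy).1 hz)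
    (fun y hy => h.card_jointOrbit ((hV y).mp hy).1)
    (fun y hy => h.orbitDegree_pos ((hV y).mp hy).1) N
  have hm0 : (m : ℚ) ≠ 0 := by exact_mod_cast h.pos.ne'
  apply mul_left_cancel₀ hm0
  rw [← mul_assoc, hcount N le_rfl, hrec, Finset.mul_sum]
  refine Finset.sum_congr rfl fun ij hij => ?_
  rw [Finset.HasAntidiagonal.mem_antidiagonal] at hij
  rw [hcount ij.1 (by omega), mul_left_comm]
  congr 1
  rcases Nat.eq_zero_or_pos ij.2 with h0 | hpos
  · rw [if_pos h0, mul_zero]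
    exact Finset.sum_eq_zero fun y _ => by simp [altSeries, h0]
  · rw [if_neg hpos.ne', Finset.sum_congr rfl fun y hy =>
      coeff_altSeries (h.orbitDegree_pos ((hV y).mp hy).1) hpos, Finset.sum_sub_distrib,
      ← Finset.mul_sum, Finset.sum_boole, hdvd _ hpos (by omega)]
    split_ifs with hev
    · have h2 : ∀ y ∈ V, (if Even ij.2 ∧ orbitDegree σ γ m y ∣ ij.2 / 2 then (1 : ℚ) else 0) =
          if orbitDegree σ γ m y ∣ ij.2 / 2 then 1 else 0 := fun y _ => by simp [hev]
      obtain ⟨r, hr⟩ := hev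
      rw [Finset.sum_congr rfl h2, Finset.sum_boole, hdvd _ (by omega) (by omega)]
      push_cast; ring
    · simp [hev]

end FreePair

end CommutingMaps

section GeneratingFunctions

/-- `a` is the logarithmic derivative `X A' / A` of the power series `A`. -/
def HasLogDeriv (A a : PowerSeries ℚ) : Prop :=
  PowerSeries.X * PowerSeries.derivative ℚ A = A * a

lemma HasLogDeriv.mul {A B a b : PowerSeries ℚ} (hA : HasLogDeriv A a) (hB : HasLogDeriv B b) :
    HasLogDeriv (A * B) (a + b) := by
  unfold HasLogDeriv at *
  rw [Derivation.leibniz, smul_eq_mul, smul_eq_mul]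
  linear_combination A * hB + B * hA

lemma HasLogDeriv.ext {A B a : PowerSeries ℚ} (hA : HasLogDeriv A a) (hB : HasLogDeriv B a)
    (ha : PowerSeries.coeff 0 a = 0) (h0 : PowerSeries.coeff 0 A = PowerSeries.coeff 0 B) :
    A = B := by
  have key : ∀ A : PowerSeries ℚ, HasLogDeriv A a → ∀ N : ℕ,
      (N + 1 : ℚ) * PowerSeries.coeff (N + 1) A =
        ∑ ij ∈ Finset.HasAntidiagonal.antidiagonal N,
          PowerSeries.coeff ij.1 A * PowerSeries.coeff (ij.2 + 1) a := by
    intro A hA N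
    have h := congrArg (PowerSeries.coeff (N + 1)) hA
    rw [PowerSeries.coeff_succ_X_mul, PowerSeries.coeff_mul,
      Finset.Nat.antidiagonal_succ', Finset.sum_cons, ha, mul_zero, zero_add,
      Finset.sum_map, PowerSeries.coeff_derivative] at h
    rw [mul_comm]
    exact h
  ext N
  induction N using Nat.strong_induction_on with
  | _ N ih =>
    rcases N with _ | N
    · exact h0
    · have hN : (N + 1 : ℚ) ≠ 0 := by positivity
      apply mul_left_cancel₀ hN
      rw [key A hA, key B hB]
      refine Finset.sum_congr rfl fun ij hij => ?_
      rw [Finset.HasAntidiagonal.mem_antidiagonal] at hij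
      rw [ih ij.1 (by omega)]

/-- The power series `k t u ^ k / (1 - t u ^ k)`. -/
def geomLogSeries (k : ℕ) (t : ℚ) : PowerSeries ℚ :=
  PowerSeries.mk fun j => if k ∣ j ∧ 0 < j then k * t ^ (j / k) else 0

lemma geomLogSeries_mul {k : ℕ} (hk : 0 < k) (t : ℚ) :
    (1 - PowerSeries.C t * PowerSeries.X ^ k) * geomLogSeries k t =
      PowerSeries.C (k * t) * PowerSeries.X ^ k := by
  ext j
  rw [sub_mul, one_mul, mul_assoc, map_sub, PowerSeries.coeff_C_mul, PowerSeries.coeff_C_mul,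
    PowerSeries.coeff_X_pow_mul', PowerSeries.coeff_X_pow]
  simp only [geomLogSeries, PowerSeries.coeff_mk]
  by_cases hkj : k ∣ j
  · obtain ⟨r, rfl⟩ := hkj
    rcases r with _ | _ | r
    · simp [hk.ne]
    · simp [hk]
    · have h1 : k * (r + 1 + 1) - k = k * (r + 1) := by rw [mul_add k (r + 1) 1]; omega
      have h2 : k * (r + 1 + 1) ≠ k := by
        intro h
        have := Nat.eq_of_mul_eq_mul_left hk (h.trans (mul_one k).symm)
        omega
      have h3 : k ≤ k * (r + 1 + 1) := Nat.le_mul_of_pos_right k (by omega)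
      rw [if_pos ⟨Dvd.intro _ rfl, by positivity⟩, if_pos h3, h1,
        if_pos ⟨Dvd.intro _ rfl, by positivity⟩, if_neg h2, Nat.mul_div_cancel_left _ hk,
        Nat.mul_div_cancel_left _ hk]
      ring
  · have h1 : j ≠ k := by rintro rfl; exact hkj dvd_rfl
    rw [if_neg (fun h => hkj h.1), if_neg h1]
    split_ifs with h2 h3
    · exact absurd ((Nat.dvd_sub_iff_left h2 dvd_rfl).mp h3.1) hkj
    · simp
    · simp

lemma hasLogDeriv_one_sub {k : ℕ} (hk : 0 < k) (t : ℚ) :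
    HasLogDeriv (1 - PowerSeries.C t * PowerSeries.X ^ k) (-geomLogSeries k t) := by
  rw [HasLogDeriv, mul_neg, geomLogSeries_mul hk]
  obtain ⟨k, rfl⟩ := Nat.exists_eq_succ_of_ne_zero hk.ne'
  rw [map_sub, Derivation.leibniz, Derivation.leibniz_pow]
  simp only [Derivation.map_one_eq_zero, PowerSeries.derivative_C, PowerSeries.derivative_X,
    smul_eq_mul, map_mul, nsmul_eq_mul]
  have : (PowerSeries.C ((k.succ : ℕ) : ℚ) : PowerSeries ℚ) = (k.succ : PowerSeries ℚ) := by simp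
  rw [this]
  simp only [Nat.succ_eq_add_one, Nat.add_sub_cancel]
  ring

lemma constantCoeff_geomLogSeries (k : ℕ) (t : ℚ) :
    PowerSeries.constantCoeff (geomLogSeries k t) = 0 := by
  rw [← PowerSeries.coeff_zero_eq_constantCoeff_apply, geomLogSeries, PowerSeries.coeff_mk]
  simp

/-- `e` satisfies Newton's recursion with fixed-point counts `c`. -/
def IsNewton (e c : ℕ → ℚ) : Prop :=
  e 0 = 1 ∧ ∀ N : ℕ, (N : ℚ) * e N = ∑ ij ∈ Finset.HasAntidiagonal.antidiagonal N, e ij.1 *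
    if ij.2 = 0 then 0 else (c ij.2 - 2 * if Even ij.2 then c (ij.2 / 2) else 0)

lemma IsNewton.hasLogDeriv {e c : ℕ → ℚ} (h : IsNewton e c) :
    HasLogDeriv (PowerSeries.mk e) (PowerSeries.mk fun j =>
      if j = 0 then 0 else (c j - 2 * if Even j then c (j / 2) else 0)) := by
  ext N
  conv_rhs =>
    rw [PowerSeries.coeff_mul]
    simp only [PowerSeries.coeff_mk]
  rw [← h.2 N]
  rcases N with _ | N
  · simp
  · rw [PowerSeries.coeff_succ_X_mul, PowerSeries.coeff_derivative]
    simp [mul_comm]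

lemma mk_geom_eq {c : ℕ → ℚ} {x y z : ℚ} {t : ℚ}
    (hc : ∀ j, 0 < j → c j = x * t ^ j + y - z * if Even j then 2 else 0) :
    (PowerSeries.mk fun j => if j = 0 then 0 else (c j - 2 * if Even j then c (j / 2) else 0)) =
      PowerSeries.C x * (geomLogSeries 1 t - geomLogSeries 2 t) +
      PowerSeries.C y * (geomLogSeries 1 1 - geomLogSeries 2 1) -
      PowerSeries.C z * (geomLogSeries 2 1 - geomLogSeries 4 1) := by
  ext j
  simp only [map_add, map_sub, PowerSeries.coeff_C_mul, geomLogSeries, PowerSeries.coeff_mk]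
  rcases Nat.eq_zero_or_pos j with rfl | hj
  · simp
  · have h4 : 4 ∣ j ↔ Even j ∧ Even (j / 2) := by
      constructor
      · rintro ⟨r, rfl⟩
        exact ⟨⟨2 * r, by ring⟩, ⟨r, by omega⟩⟩
      · rintro ⟨⟨r, hr⟩, ⟨s, hs⟩⟩
        exact ⟨s, by omega⟩
    rw [if_neg hj.ne', hc j hj]
    by_cases hev : Even j
    · have h2 : 0 < j / 2 := by obtain ⟨r, hr⟩ := hev; omega
      by_cases hev2 : Even (j / 2)
      · simp [hc (j / 2) h2, hev, hev2, hj, h4, even_iff_two_dvd.mp hev]; ring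
      · simp [hc (j / 2) h2, hev, hev2, hj, h4, even_iff_two_dvd.mp hev]; ring
    · have h2 : ¬ 2 ∣ j := fun h => hev (even_iff_two_dvd.mpr h)
      simp [hev, hj, h4, h2]

/-- The recurrence extracted from `E (1 + a X + b X² + c X³) = 1 + a' X + b' X² + c' X³`. -/
lemma recurrence_of_mul_eq {e : ℕ → ℚ} {a b c a' b' c' : ℚ}
    (h : PowerSeries.mk e * (1 + PowerSeries.C a * PowerSeries.X ^ 1 +
        PowerSeries.C b * PowerSeries.X ^ 2 + PowerSeries.C c * PowerSeries.X ^ 3) =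
      1 + PowerSeries.C a' * PowerSeries.X ^ 1 + PowerSeries.C b' * PowerSeries.X ^ 2 +
        PowerSeries.C c' * PowerSeries.X ^ 3) :
    e 1 + a * e 0 = a' ∧ e 2 + a * e 1 + b * e 0 = b' ∧
      e 3 + a * e 2 + b * e 1 + c * e 0 = c' ∧
      ∀ N, e (N + 4) + a * e (N + 3) + b * e (N + 2) + c * e (N + 1) = 0 := by
  have key : ∀ N, e N + a * (if 1 ≤ N then e (N - 1) else 0) +
      b * (if 2 ≤ N then e (N - 2) else 0) + c * (if 3 ≤ N then e (N - 3) else 0) =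
      (if N = 0 then 1 else 0) + a' * (if N = 1 then 1 else 0) +
      b' * (if N = 2 then 1 else 0) + c' * (if N = 3 then 1 else 0) := by
    intro N
    have h1 := congrArg (PowerSeries.coeff N) h
    rw [show PowerSeries.mk e * (1 + PowerSeries.C a * PowerSeries.X ^ 1 +
        PowerSeries.C b * PowerSeries.X ^ 2 + PowerSeries.C c * PowerSeries.X ^ 3) =
        PowerSeries.mk e + PowerSeries.C a * (PowerSeries.mk e * PowerSeries.X ^ 1) +
        PowerSeries.C b * (PowerSeries.mk e * PowerSeries.X ^ 2) +
        PowerSeries.C c * (PowerSeries.mk e * PowerSeries.X ^ 3) by ring] at h1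
    simp only [map_add, PowerSeries.coeff_C_mul, PowerSeries.coeff_X_pow, PowerSeries.coeff_one]
      at h1
    simpa only [PowerSeries.coeff_mul_X_pow', PowerSeries.coeff_mk] using h1
  refine ⟨?_, ?_, ?_, fun N => ?_⟩
  · simpa using key 1
  · simpa using key 2
  · simpa using key 3
  · simpa using key (N + 4)

lemma IsNewton.affineLine {e c : ℕ → ℚ} {q : ℕ} (h : IsNewton e c)
    (hc : ∀ j, 0 < j → c j = (q : ℚ) ^ j) {N : ℕ} (hN : 0 < N) : e N = q * A1 q N := by
  have h1 := h.hasLogDeriv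
  rw [mk_geom_eq (x := 1) (y := 0) (z := 0) (t := q) (by simpa using hc)] at h1
  have h2 := h1.mul (hasLogDeriv_one_sub one_pos (q : ℚ))
  have h3 := hasLogDeriv_one_sub two_pos (q : ℚ)
  simp only [map_one, map_zero, one_mul, zero_mul, add_zero, sub_zero] at h2
  rw [show geomLogSeries 1 (q : ℚ) - geomLogSeries 2 q + -geomLogSeries 1 q =
    -geomLogSeries 2 q by ring] at h2
  have h4 := h2.ext h3 (by simp [constantCoeff_geomLogSeries]) (by simp [h.1])
  obtain ⟨r1, r2, r3, r4⟩ := recurrence_of_mul_eq (e := e) (a := -q) (b := 0) (c := 0) (a' := 0)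
    (b' := -q) (c' := 0) (by simpa [sub_eq_add_neg] using h4)
  rw [h.1] at r1 r2 r3
  obtain ⟨N, rfl⟩ := Nat.exists_eq_add_of_le' hN
  rcases N with _ | N
  · simp [A1]; linarith
  · induction N with
    | zero => simp [A1]; rw [show e 1 = q by linarith] at r2; linarith
    | succ N ih =>
      have ih := ih (by omega)
      simp only [A1] at ih ⊢
      rcases N with _ | N
      · simp only [zero_add, Nat.reduceAdd] at ih ⊢; rw [show e 3 = q * e 2 by linarith, ih]; ring
      · have := r4 N
        rw [show N + 1 + 1 + 1 + 1 = N + 4 by ring, show e (N + 4) = q * e (N + 3) by linarith,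
          show N + 3 = N + 1 + 1 + 1 by ring, ih]
        ring

lemma IsNewton.punctured {e c : ℕ → ℚ} {q : ℕ} (h : IsNewton e c)
    (hc : ∀ j, 0 < j → c j = (q : ℚ) ^ j - 1) {N : ℕ} (hN : 0 < N) :
    e N = (q - 1) * A2 q N := by
  have h1 := h.hasLogDeriv
  rw [mk_geom_eq (x := 1) (y := -1) (z := 0) (t := q)
    (by intro j hj; rw [hc j hj]; ring)] at h1
  have h2 := (h1.mul (hasLogDeriv_one_sub one_pos (q : ℚ))).mul (hasLogDeriv_one_sub two_pos 1)
  have h3 := (hasLogDeriv_one_sub two_pos (q : ℚ)).mul (hasLogDeriv_one_sub one_pos 1)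
  simp only [map_one, map_zero, one_mul, zero_mul, sub_zero, map_neg] at h2 h3
  rw [show geomLogSeries 1 (q : ℚ) - geomLogSeries 2 q +
    -1 * (geomLogSeries 1 1 - geomLogSeries 2 1) + -geomLogSeries 1 q + -geomLogSeries 2 1 =
    -geomLogSeries 2 q + -geomLogSeries 1 1 by ring] at h2
  have h4 := h2.ext h3 (by simp [constantCoeff_geomLogSeries]) (by simp [h.1])
  have hX : (1 - PowerSeries.X ^ 1 : PowerSeries ℚ) ≠ 0 := by
    intro h
    have := congrArg PowerSeries.constantCoeff h
    simp at this
  have h5 : PowerSeries.mk e * ((1 - PowerSeries.C (q : ℚ) * PowerSeries.X ^ 1) *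
      (1 + PowerSeries.X)) = 1 - PowerSeries.C (q : ℚ) * PowerSeries.X ^ 2 := by
    apply mul_right_cancel₀ hX
    rw [← h4]; ring
  obtain ⟨r1, r2, r3, r4⟩ := recurrence_of_mul_eq (e := e) (a := 1 - q) (b := -q) (c := 0)
    (a' := 0) (b' := -q) (c' := 0) (by
      simp only [map_sub, map_neg, map_one, map_zero, zero_mul, add_zero]
      linear_combination h5)
  rw [h.1] at r1 r2 r3
  have hq : (q : ℚ) + 1 ≠ 0 := by positivity
  have key : ∀ N, e (N + 1) = (q - 1) * A2 q (N + 1) ∧ e (N + 2) = (q - 1) * A2 q (N + 2) := by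
    intro N
    induction N with
    | zero =>
      have e1 : e 1 = q - 1 := by linarith
      have e2 : e 2 = (q - 1) * (q - 1) := by rw [e1] at r2; linarith
      simp only [zero_add, e1, e2, A2]
      constructor <;> field_simp <;> ring
    | succ N ih =>
      refine ⟨ih.2, ?_⟩
      have h6 : e (N + 3) = (q - 1) * e (N + 2) + q * e (N + 1) := by
        rcases N with _ | N
        · simp only [zero_add]; linarith
        · have := r4 N
          rw [show N + 1 + 3 = N + 4 by ring, show N + 1 + 2 = N + 3 by ring,
            show N + 1 + 1 = N + 2 by ring]
          linarith
      rw [show N + 1 + 2 = N + 3 by ring, h6, ih.1, ih.2]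
      simp only [A2]
      field_simp
      ring
  obtain ⟨N, rfl⟩ := Nat.exists_eq_add_of_le' hN
  exact (key N).1

lemma IsNewton.projectiveLine {e c : ℕ → ℚ} {q : ℕ} (h : IsNewton e c)
    (hc : ∀ j, 0 < j → c j = (q : ℚ) ^ j + 1) (N : ℕ) :
    e (N + 3) = q ^ N * (q ^ 3 - q) := by
  have h1 := h.hasLogDeriv
  rw [mk_geom_eq (x := 1) (y := 1) (z := 0) (t := q)
    (by intro j hj; rw [hc j hj]; ring)] at h1
  have h2 := (h1.mul (hasLogDeriv_one_sub one_pos (q : ℚ))).mul (hasLogDeriv_one_sub one_pos 1)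
  have h3 := (hasLogDeriv_one_sub two_pos (q : ℚ)).mul (hasLogDeriv_one_sub two_pos 1)
  simp only [map_one, map_zero, one_mul, zero_mul, sub_zero] at h2 h3
  rw [show geomLogSeries 1 (q : ℚ) - geomLogSeries 2 q +
    (geomLogSeries 1 1 - geomLogSeries 2 1) + -geomLogSeries 1 q + -geomLogSeries 1 1 =
    -geomLogSeries 2 q + -geomLogSeries 2 1 by ring] at h2
  have h4 := h2.ext h3 (by simp [constantCoeff_geomLogSeries]) (by simp [h.1])
  have hX : (1 - PowerSeries.X ^ 1 : PowerSeries ℚ) ≠ 0 := by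
    intro h
    have := congrArg PowerSeries.constantCoeff h
    simp at this
  have h5 : PowerSeries.mk e * (1 - PowerSeries.C (q : ℚ) * PowerSeries.X ^ 1) =
      (1 - PowerSeries.C (q : ℚ) * PowerSeries.X ^ 2) * (1 + PowerSeries.X) := by
    apply mul_right_cancel₀ hX
    rw [h4]; ring
  obtain ⟨r1, r2, r3, r4⟩ := recurrence_of_mul_eq (e := e) (a := -q) (b := 0) (c := 0)
    (a' := 1) (b' := -q) (c' := -q) (by
      simp only [map_neg, map_one, map_zero, zero_mul, add_zero]
      linear_combination h5)
  rw [h.1] at r1 r2 r3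
  induction N with
  | zero =>
    have e1 : e 1 = q + 1 := by linarith
    have e2 : e 2 = q ^ 2 := by rw [e1] at r2; linarith
    rw [e2] at r3; simp only [zero_add]; linarith
  | succ N ih =>
    have := r4 N
    rw [show N + 1 + 3 = N + 4 by ring, show e (N + 4) = q * e (N + 3) by linarith, ih]
    ring

lemma IsNewton.anisotropic {e c : ℕ → ℚ} {q : ℕ} (h : IsNewton e c)
    (hc : ∀ j, 0 < j → c j = (q : ℚ) ^ j + 1 - if Even j then 2 else 0) {N : ℕ} (hN : 0 < N) :
    e N = (q + 1) * A0 q N := by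
  have h1 := h.hasLogDeriv
  rw [mk_geom_eq (x := 1) (y := 1) (z := 1) (t := q)
    (by intro j hj; rw [hc j hj]; ring)] at h1
  have h2 := ((h1.mul (hasLogDeriv_one_sub one_pos (q : ℚ))).mul
    (hasLogDeriv_one_sub one_pos 1)).mul (hasLogDeriv_one_sub four_pos 1)
  have h3 := ((hasLogDeriv_one_sub two_pos (q : ℚ)).mul (hasLogDeriv_one_sub two_pos 1)).mul
    (hasLogDeriv_one_sub two_pos 1)
  simp only [map_one, one_mul] at h2 h3
  rw [show geomLogSeries 1 (q : ℚ) - geomLogSeries 2 q +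
    (geomLogSeries 1 1 - geomLogSeries 2 1) - (geomLogSeries 2 1 - geomLogSeries 4 1) +
    -geomLogSeries 1 q + -geomLogSeries 1 1 + -geomLogSeries 4 1 =
    -geomLogSeries 2 q + -geomLogSeries 2 1 + -geomLogSeries 2 1 by ring] at h2
  have h4 := h2.ext h3 (by simp [constantCoeff_geomLogSeries]) (by simp [h.1])
  have hX : ((1 - PowerSeries.X) * (1 - PowerSeries.X ^ 2) : PowerSeries ℚ) ≠ 0 := by
    intro h
    have := congrArg PowerSeries.constantCoeff h
    simp at this
  have h5 : PowerSeries.mk e * ((1 - PowerSeries.C (q : ℚ) * PowerSeries.X ^ 1) *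
      (1 + PowerSeries.X ^ 2)) =
      (1 - PowerSeries.C (q : ℚ) * PowerSeries.X ^ 2) * (1 + PowerSeries.X) := by
    apply mul_right_cancel₀ hX
    linear_combination h4
  obtain ⟨r1, r2, r3, r4⟩ := recurrence_of_mul_eq (e := e) (a := -q) (b := 1) (c := -q)
    (a' := 1) (b' := -q) (c' := -q) (by
      simp only [map_neg, map_one]
      linear_combination h5)
  rw [h.1] at r1 r2 r3
  have hq : (q : ℚ) ^ 2 + 1 ≠ 0 := by positivity
  have key : ∀ N, e (N + 1) = (q + 1) * A0 q (N + 1) ∧ e (N + 2) = (q + 1) * A0 q (N + 2) ∧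
      e (N + 3) = (q + 1) * A0 q (N + 3) := by
    intro N
    induction N with
    | zero =>
      have e1 : e 1 = q + 1 := by linarith
      have e2 : e 2 = q ^ 2 - 1 := by rw [e1] at r2; linarith
      have e3 : e 3 = q ^ 3 - 2 * q - 1 := by rw [e1, e2] at r3; linarith
      simp only [zero_add, e1, e2, e3, A0]
      norm_num
      refine ⟨?_, ?_, ?_⟩ <;> field_simp <;> ring
    | succ N ih =>
      refine ⟨ih.2.1, ih.2.2, ?_⟩
      have := r4 N
      rw [show N + 1 + 3 = N + 4 by ring,
        show e (N + 4) = q * e (N + 3) - e (N + 2) + q * e (N + 1) by linarith,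
        ih.1, ih.2.1, ih.2.2]
      simp only [A0]
      rw [show (N + 3 + 1) / 2 = N / 2 + 2 by omega, show (N + 3) / 2 = (N + 1) / 2 + 1 by omega,
        show (N + 2) / 2 = N / 2 + 1 by omega,
        show (N + 4 + 1) / 2 = (N + 1) / 2 + 2 by omega]
      field_simp
      ring
  obtain ⟨N, rfl⟩ := Nat.exists_eq_add_of_le' hN
  exact (key N).1

end GeneratingFunctions

section Moebius

variable {F : Type} [Field F]

/-- First coordinate of the normalized representative of a point of `P¹(k̄)`. -/
def coordX : Option (AlgebraicClosure F) → AlgebraicClosure F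
  | none => -1
  | some x => x

/-- Second coordinate of the normalized representative of a point of `P¹(k̄)`. -/
def coordY : Option (AlgebraicClosure F) → AlgebraicClosure F
  | none => 0
  | some _ => 1

lemma coord_unique {t t' : Option (AlgebraicClosure F)} {e e' : AlgebraicClosure F} (he : e ≠ 0)
    (hX : e * coordX t = e' * coordX t') (hY : e * coordY t = e' * coordY t') :
    t = t' ∧ e = e' := by
  rcases t with _ | x <;> rcases t' with _ | x' <;> simp only [coordX, coordY] at hX hY
  · exact ⟨rfl, by linear_combination -hX⟩
  · exfalso
    have : e' = 0 := by linear_combination -hY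
    rw [this] at hX
    exact he (by linear_combination -hX)
  · exact absurd (by linear_combination hY) he
  · have h1 : e = e' := by linear_combination hY
    rw [← h1] at hX
    exact ⟨congrArg some (mul_left_cancel₀ he hX), h1⟩

/-- `γ` maps the representative of `t` to `e` times the representative of `t'`. -/
def MapsCoord (γ : Matrix (Fin 2) (Fin 2) F) (e : AlgebraicClosure F)
    (t t' : Option (AlgebraicClosure F)) : Prop :=
  em F (γ 0 0) * coordX t + em F (γ 0 1) * coordY t = e * coordX t' ∧
    em F (γ 1 0) * coordX t + em F (γ 1 1) * coordY t = e * coordY t'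

lemma em_det (γ : Matrix (Fin 2) (Fin 2) F) :
    em F γ.det = em F (γ 0 0) * em F (γ 1 1) - em F (γ 0 1) * em F (γ 1 0) := by
  rw [Matrix.det_fin_two, map_sub, map_mul, map_mul]

lemma exists_mapsCoord {γ : Matrix (Fin 2) (Fin 2) F} (hγ : γ.det ≠ 0)
    (t : Option (AlgebraicClosure F)) :
    ∃ e, e ≠ 0 ∧ MapsCoord γ e t (moebius γ t) ∧ locMult γ t * e = em F γ.det := by
  have hD : em F γ.det ≠ 0 := by rwa [_root_.map_ne_zero]
  rcases t with _ | x
  · by_cases hc : γ 1 0 = 0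
    · refine ⟨em F (γ 0 0), ?_, ⟨?_, ?_⟩, ?_⟩
      · intro h; rw [em_det, h, hc] at hD; simp at hD
      · simp [moebius, hc, coordX, coordY]
      · simp [moebius, hc, coordX, coordY]
      · simp only [locMult, hc, if_true, em_det]; simp; ring
    · have hc' : em F (γ 1 0) ≠ 0 := by rwa [_root_.map_ne_zero]
      refine ⟨-em F (γ 1 0), neg_ne_zero.mpr hc', ⟨?_, ?_⟩, ?_⟩
      · simp only [moebius, hc, if_false, coordX, coordY]; field_simp; ring
      · simp only [moebius, hc, if_false, coordX, coordY]; ring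
      · simp only [locMult, hc, if_false, map_div₀, map_neg]; field_simp
  · by_cases hc : em F (γ 1 0) * x + em F (γ 1 1) = 0
    · have hc' : em F (γ 1 0) ≠ 0 := by
        intro h
        rw [h, zero_mul, zero_add] at hc
        rw [em_det, h, hc] at hD
        simp at hD
      refine ⟨em F γ.det / em F (γ 1 0), div_ne_zero hD hc', ⟨?_, ?_⟩, ?_⟩
      · simp only [moebius, hc, if_true, coordX, coordY, em_det]
        field_simp
        linear_combination em F (γ 0 0) * hc
      · simp only [moebius, hc, if_true, coordX, coordY]; linear_combination hc
      · simp only [locMult, hc, if_true]; field_simp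
    · refine ⟨em F (γ 1 0) * x + em F (γ 1 1), hc, ⟨?_, ?_⟩, ?_⟩
      · simp only [moebius, hc, if_false, coordX, coordY, mul_one, mul_div_cancel₀ _ hc]
      · simp only [moebius, hc, if_false, coordX, coordY]; ring
      · simp only [locMult, hc, if_false]; field_simp

lemma MapsCoord.eq {γ : Matrix (Fin 2) (Fin 2) F} (hγ : γ.det ≠ 0)
    {t t' : Option (AlgebraicClosure F)} {e : AlgebraicClosure F} (h : MapsCoord γ e t t') :
    moebius γ t = t' ∧ locMult γ t * e = em F γ.det := by
  obtain ⟨e₀, he₀, h1, h2⟩ := exists_mapsCoord hγ t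
  obtain ⟨h3, rfl⟩ := coord_unique he₀ (h1.1.symm.trans h.1) (h1.2.symm.trans h.2)
  exact ⟨h3, h2⟩

lemma locMult_ne_zero {γ : Matrix (Fin 2) (Fin 2) F} (hγ : γ.det ≠ 0)
    (t : Option (AlgebraicClosure F)) : locMult γ t ≠ 0 := by
  obtain ⟨e, -, -, h⟩ := exists_mapsCoord hγ t
  intro h0
  rw [h0, zero_mul] at h
  exact hγ ((map_eq_zero _).mp h.symm)

lemma MapsCoord.mul {γ δ : Matrix (Fin 2) (Fin 2) F} {t t' t'' : Option (AlgebraicClosure F)}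
    {e e' : AlgebraicClosure F} (hδ : MapsCoord δ e t t') (hγ : MapsCoord γ e' t' t'') :
    MapsCoord (γ * δ) (e * e') t t'' := by
  obtain ⟨h1, h2⟩ := hδ
  obtain ⟨h3, h4⟩ := hγ
  simp only [MapsCoord, Matrix.mul_apply, Fin.sum_univ_two, map_add, map_mul]
  constructor
  · linear_combination em F (γ 0 0) * h1 + em F (γ 0 1) * h2 + e * h3
  · linear_combination em F (γ 1 0) * h1 + em F (γ 1 1) * h2 + e * h4

lemma moebius_mul {γ δ : Matrix (Fin 2) (Fin 2) F} (hγ : γ.det ≠ 0) (hδ : δ.det ≠ 0)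
    (t : Option (AlgebraicClosure F)) :
    moebius (γ * δ) t = moebius γ (moebius δ t) ∧
      locMult (γ * δ) t = locMult γ (moebius δ t) * locMult δ t := by
  obtain ⟨e, he, h1, h2⟩ := exists_mapsCoord hδ t
  obtain ⟨e', he', h3, h4⟩ := exists_mapsCoord hγ (moebius δ t)
  obtain ⟨h5, h6⟩ := (h1.mul h3).eq (by rw [Matrix.det_mul]; exact mul_ne_zero hγ hδ)
  refine ⟨h5, mul_right_cancel₀ (mul_ne_zero he he') ?_⟩
  rw [h6, Matrix.det_mul, map_mul, ← h2, ← h4]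
  ring

lemma moebius_smul_one {a : F} (ha : a ≠ 0) (t : Option (AlgebraicClosure F)) :
    moebius (a • (1 : Matrix (Fin 2) (Fin 2) F)) t = t ∧
      locMult (a • (1 : Matrix (Fin 2) (Fin 2) F)) t = em F a := by
  have hdet : (a • (1 : Matrix (Fin 2) (Fin 2) F)).det = a * a := by
    simp [sq]
  have h : MapsCoord (a • (1 : Matrix (Fin 2) (Fin 2) F)) (em F a) t t := by
    simp [MapsCoord]
  obtain ⟨h1, h2⟩ := h.eq (by rw [hdet]; exact mul_ne_zero ha ha)
  rw [hdet, map_mul] at h2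
  exact ⟨h1, mul_right_cancel₀ ((_root_.map_ne_zero _).mpr ha) h2⟩

lemma moebius_one (t : Option (AlgebraicClosure F)) :
    moebius (1 : Matrix (Fin 2) (Fin 2) F) t = t ∧
      locMult (1 : Matrix (Fin 2) (Fin 2) F) t = 1 := by
  simpa using moebius_smul_one (one_ne_zero (α := F)) t

lemma iterate_moebius {γ : Matrix (Fin 2) (Fin 2) F} (hγ : γ.det ≠ 0) (i : ℕ)
    (t : Option (AlgebraicClosure F)) : (moebius γ)^[i] t = moebius (γ ^ i) t := by
  induction i with
  | zero => rw [pow_zero, (moebius_one t).1]; rfl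
  | succ i ih =>
    rw [Function.iterate_succ_apply', ih, pow_succ',
      (moebius_mul hγ (by rw [Matrix.det_pow]; exact pow_ne_zero i hγ) t).1]

lemma prod_locMult_iterate {γ : Matrix (Fin 2) (Fin 2) F} (hγ : γ.det ≠ 0) (i : ℕ)
    (t : Option (AlgebraicClosure F)) :
    ∏ a ∈ Finset.range i, locMult γ ((moebius γ)^[a] t) = locMult (γ ^ i) t := by
  induction i with
  | zero => rw [pow_zero, (moebius_one t).2]; rfl
  | succ i ih =>
    rw [Finset.prod_range_succ, ih, iterate_moebius hγ, pow_succ',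
      (moebius_mul hγ (by rw [Matrix.det_pow]; exact pow_ne_zero i hγ) t).2, mul_comm]

lemma moebius_injective {γ : Matrix (Fin 2) (Fin 2) F} (hγ : γ.det ≠ 0) :
    Function.Injective (moebius γ) := by
  intro t t' h
  have hinv : IsUnit γ.det := isUnit_iff_ne_zero.mpr hγ
  have key : ∀ t, moebius γ⁻¹ (moebius γ t) = t := fun t => by
    rw [← (moebius_mul (by simpa [Matrix.det_nonsing_inv] using hγ) hγ t).1,
      Matrix.nonsing_inv_mul _ hinv, (moebius_one t).1]
  rw [← key t, h, key t']

variable [Fintype F]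

lemma pow_card_add (x y : AlgebraicClosure F) :
    (x + y) ^ Fintype.card F = x ^ Fintype.card F + y ^ Fintype.card F :=
  map_add (FiniteField.frobeniusAlgHom F (AlgebraicClosure F)) x y

lemma em_pow_card (x : F) : em F x ^ Fintype.card F = em F x := by
  rw [← map_pow, FiniteField.pow_card]

lemma pow_card_injective :
    Function.Injective fun x : AlgebraicClosure F => x ^ Fintype.card F :=
  (FiniteField.frobeniusAlgHom F (AlgebraicClosure F)).toRingHom.injective

lemma frobP1_injective : Function.Injective (frobP1 F) :=
  Option.map_injective pow_card_injective

lemma mem_range_em {x : AlgebraicClosure F} (hx : x ^ Fintype.card F = x) : ∃ a : F, em F a = x := by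
  have h0 := FiniteField.roots_X_pow_card_sub_X F
  have h1 : (∏ a : F, (X - C a)) = (X ^ Fintype.card F - X : F[X]) := by
    have hm : (X ^ Fintype.card F - X : F[X]).Monic :=
      monic_X_pow_sub (by rw [degree_X]; exact_mod_cast Fintype.one_lt_card)
    rw [← prod_multiset_X_sub_C_of_monic_of_roots_card_eq hm, h0]
    · rfl
    · rw [h0, FiniteField.X_pow_card_sub_X_natDegree_eq F Fintype.one_lt_card]
      rfl
  have h2 := congrArg (Polynomial.aeval x) h1
  rw [map_sub, map_pow, aeval_X, hx, sub_self, map_prod, Finset.prod_eq_zero_iff] at h2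
  obtain ⟨a, -, ha⟩ := h2
  refine ⟨a, ?_⟩
  rw [map_sub, aeval_X, aeval_C, sub_eq_zero] at ha
  exact ha.symm

lemma coord_frobP1 (t : Option (AlgebraicClosure F)) :
    coordX (frobP1 F t) = coordX t ^ Fintype.card F ∧
      coordY (frobP1 F t) = coordY t ^ Fintype.card F := by
  rcases t with _ | x
  · refine ⟨?_, ?_⟩
    · have := map_neg (FiniteField.frobeniusAlgHom F (AlgebraicClosure F)) 1
      rw [map_one] at this
      exact this.symm
    · exact (zero_pow Fintype.card_ne_zero).symm
  · exact ⟨rfl, (one_pow _).symm⟩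

lemma MapsCoord.frob {γ : Matrix (Fin 2) (Fin 2) F} {t t' : Option (AlgebraicClosure F)}
    {e : AlgebraicClosure F} (h : MapsCoord γ e t t') :
    MapsCoord γ (e ^ Fintype.card F) (frobP1 F t) (frobP1 F t') := by
  obtain ⟨h1, h2⟩ := h
  have h3 := congrArg (· ^ Fintype.card F) h1
  have h4 := congrArg (· ^ Fintype.card F) h2
  simp only [pow_card_add, mul_pow, em_pow_card, ← (coord_frobP1 _).1, ← (coord_frobP1 _).2]
    at h3 h4
  exact ⟨h3, h4⟩

lemma moebius_frobP1 {γ : Matrix (Fin 2) (Fin 2) F} (hγ : γ.det ≠ 0)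
    (t : Option (AlgebraicClosure F)) :
    moebius γ (frobP1 F t) = frobP1 F (moebius γ t) ∧
      locMult γ (frobP1 F t) = locMult γ t ^ Fintype.card F := by
  obtain ⟨e, he, h1, h2⟩ := exists_mapsCoord hγ t
  obtain ⟨h3, h4⟩ := h1.frob.eq hγ
  refine ⟨h3, mul_right_cancel₀ (pow_ne_zero (Fintype.card F) he) ?_⟩
  rw [h4, ← mul_pow, h2, em_pow_card]

lemma iterate_frobP1 (j : ℕ) :
    (frobP1 F)^[j] = Option.map fun x => x ^ Fintype.card F ^ j := by
  induction j with
  | zero => ext t; simp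
  | succ j ih =>
    rw [Function.iterate_succ', ih]
    ext1 t
    rcases t with _ | x
    · rfl
    · simp [frobP1, pow_succ, pow_mul]

lemma exists_iterate_frobP1 (t : Option (AlgebraicClosure F)) :
    ∃ j, 0 < j ∧ (frobP1 F)^[j] t = t := by
  rcases t with _ | x
  · exact ⟨1, one_pos, rfl⟩
  · have hx : IsIntegral F x := Algebra.IsIntegral.isIntegral x
    have := IntermediateField.adjoin.finiteDimensional hx
    have : Finite (IntermediateField.adjoin F {x}) := Module.finite_of_finite F
    have := Fintype.ofFinite (IntermediateField.adjoin F {x})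
    refine ⟨Module.finrank F (IntermediateField.adjoin F {x}), Module.finrank_pos, ?_⟩
    have h := FiniteField.pow_card (IntermediateField.AdjoinSimple.gen F x)
    rw [Module.card_eq_pow_finrank (K := F)] at h
    rw [iterate_frobP1]
    exact congrArg some (congrArg Subtype.val h)

lemma card_roots_toFinset_of_derivative {K : Type*} [Field K] [IsAlgClosed K] (P : K[X])
    (h : ∀ x, P.eval x = 0 → (derivative P).eval x ≠ 0) :
    P.roots.toFinset.card = P.natDegree := by
  have hsep : P.Separable := by
    rw [separable_def, isCoprime_iff_aeval_ne_zero_of_isAlgClosed K K]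
    intro x
    by_cases hx : P.eval x = 0
    · right; simpa using h x hx
    · left; simpa using hx
  rw [Multiset.toFinset_card_of_nodup (nodup_roots hsep)]
  exact splits_iff_card_roots.mp (IsAlgClosed.splits P)

/-- A twisted form of the count of `𝔽_{q^j}`-points of the projective line. -/
lemma ncard_frobP1_eq_moebius {γ : Matrix (Fin 2) (Fin 2) F} (hγ : γ.det ≠ 0) {j : ℕ}
    (hj : 0 < j) :
    {t | (frobP1 F)^[j] t = moebius γ t}.Finite ∧
      {t | (frobP1 F)^[j] t = moebius γ t}.ncard = Fintype.card F ^ j + 1 := by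
  have hD : em F γ.det ≠ 0 := by rwa [_root_.map_ne_zero]
  rw [em_det] at hD
  rw [iterate_frobP1]
  have hQ : ((Fintype.card F ^ j : ℕ) : AlgebraicClosure F) = 0 := by
    have : ((Fintype.card F : ℕ) : AlgebraicClosure F) = 0 := by
      rw [← map_natCast (em F), FiniteField.cast_card_eq_zero, map_zero]
    rw [Nat.cast_pow, this, zero_pow hj.ne']
  have hQ1 : 1 < Fintype.card F ^ j := Nat.one_lt_pow hj.ne' Fintype.one_lt_card
  set Q := Fintype.card F ^ j
  set a := em F (γ 0 0) with ha
  set b := em F (γ 0 1) with hb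
  set c := em F (γ 1 0) with hc
  set d := em F (γ 1 1) with hd
  by_cases hc0 : c = 0
  · have hc0' : γ 1 0 = 0 := (map_eq_zero (em F)).mp hc0
    rw [hc0, mul_zero, sub_zero] at hD
    have had := mul_ne_zero_iff.mp hD
    set P : (AlgebraicClosure F)[X] := C d * X ^ Q - (C a * X + C b) with hP
    have hdeg : P.natDegree = Q := by
      rw [hP, natDegree_sub_eq_left_of_natDegree_lt, natDegree_C_mul_X_pow _ _ had.2]
      rw [natDegree_C_mul_X_pow _ _ had.2, natDegree_linear had.1]
      exact hQ1
    have hset : {t | Option.map (fun x => x ^ Q) t = moebius γ t} =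
        insert none (some '' (P.roots.toFinset : Set (AlgebraicClosure F))) := by
      have hP0 : P ≠ 0 := by
        intro h; rw [h, natDegree_zero] at hdeg; omega
      have hmem (x) : x ∈ P.roots ↔ d * x ^ Q - (a * x + b) = 0 := by
        rw [mem_roots hP0]; simp [hP]
      ext t
      rcases t with _ | x
      · simp [moebius, hc0']
      · simp only [Set.mem_ofPred_eq, Set.mem_insert_iff, Set.mem_image, Finset.mem_coe,
          Multiset.mem_toFinset, hmem, Option.some.injEq, reduceCtorEq,
          false_or, exists_eq_right, Option.map_some, moebius, ← ha, ← hb, ← hc, ← hd, hc0,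
          zero_mul, zero_add, had.2, if_false, eq_div_iff had.2, sub_eq_zero]
        rw [mul_comm]
    rw [hset]
    refine ⟨((Finset.finite_toSet _).image _).insert _, ?_⟩
    rw [Set.ncard_insert_of_notMem (by simp) ((Finset.finite_toSet _).image _),
      Set.ncard_image_of_injective _ (Option.some_injective _), Set.ncard_coe_finset,
      card_roots_toFinset_of_derivative, hdeg]
    intro x _
    simp [hP, derivative_X_pow, hQ, had.1]
  · have hc0' : γ 1 0 ≠ 0 := fun h => hc0 (by rw [hc, h, map_zero])
    set P : (AlgebraicClosure F)[X] := C c * X ^ (Q + 1) + (C d * X ^ Q - (C a * X + C b)) with hP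
    have hlow : (C d * X ^ Q - (C a * X + C b)).natDegree ≤ Q := by
      refine (natDegree_sub_le _ _).trans (max_le (natDegree_C_mul_X_pow_le _ _) ?_)
      exact natDegree_linear_le.trans hQ1.le
    have hdeg : P.natDegree = Q + 1 := by
      rw [hP, natDegree_add_eq_left_of_natDegree_lt, natDegree_C_mul_X_pow _ _ hc0]
      rw [natDegree_C_mul_X_pow _ _ hc0]
      omega
    have hset : {t | Option.map (fun x => x ^ Q) t = moebius γ t} =
        some '' (P.roots.toFinset : Set (AlgebraicClosure F)) := by
      have hP0 : P ≠ 0 := by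
        intro h; rw [h, natDegree_zero] at hdeg; omega
      have hmem (x) : x ∈ P.roots ↔ c * x ^ (Q + 1) + (d * x ^ Q - (a * x + b)) = 0 := by
        rw [mem_roots hP0]; simp [hP]
      ext t
      rcases t with _ | x
      · simp [moebius, hc0']
      · simp only [Set.mem_ofPred_eq, Set.mem_image, Finset.mem_coe,
          Multiset.mem_toFinset, hmem, Option.some.injEq,
          exists_eq_right, Option.map_some, moebius, ← ha, ← hb, ← hc, ← hd]
        by_cases hx : c * x + d = 0
        · simp only [hx, if_true, reduceCtorEq, false_iff]
          intro h
          refine hD ?_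
          have : a * x + b = 0 := by linear_combination x ^ Q * hx - h
          linear_combination a * hx - c * this
        · simp only [hx, if_false, Option.some.injEq, eq_div_iff hx]
          constructor
          · intro h; linear_combination h
          · intro h; linear_combination h
    rw [hset]
    refine ⟨(Finset.finite_toSet _).image _, ?_⟩
    rw [Set.ncard_image_of_injective _ (Option.some_injective _), Set.ncard_coe_finset,
      card_roots_toFinset_of_derivative, hdeg]
    intro x hx hx'
    simp only [hP, derivative_add, derivative_sub, derivative_C_mul, derivative_X_pow,
      derivative_X, derivative_C, eval_add, eval_sub, eval_mul, eval_C, eval_pow, eval_X, eval_one,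
      eval_zero, Nat.cast_add, hQ, Nat.cast_one, Nat.add_sub_cancel] at hx hx'
    refine hD ?_
    have h1 : c * x ^ Q = a := by linear_combination hx'
    have h2 : d * x ^ Q = b := by linear_combination hx - x * h1
    linear_combination -d * h1 + c * h2

end Moebius

section FixedPoints

variable {F : Type} [Field F]

lemma coord_independent {t t' : Option (AlgebraicClosure F)} (h : t ≠ t') :
    coordX t * coordY t' - coordX t' * coordY t ≠ 0 := by
  rcases t with _ | x <;> rcases t' with _ | x' <;> simp only [coordX, coordY]
  · exact absurd rfl h
  · simp
  · simp
  · rw [mul_one, mul_one, sub_ne_zero]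
    exact fun hx => h (congrArg some hx)

lemma mapsCoord_self {γ : Matrix (Fin 2) (Fin 2) F} (hγ : γ.det ≠ 0)
    {t : Option (AlgebraicClosure F)} (ht : moebius γ t = t) :
    MapsCoord γ (em F γ.trace - locMult γ t) t t ∧
      locMult γ t * (em F γ.trace - locMult γ t) = em F γ.det := by
  obtain ⟨e, he, h1, h2⟩ := exists_mapsCoord hγ t
  rw [ht] at h1
  have htr : em F γ.trace = em F (γ 0 0) + em F (γ 1 1) := by
    rw [Matrix.trace_fin_two, map_add]
  obtain ⟨hX, hY⟩ := id h1
  have hroot : e * e - em F γ.trace * e + em F γ.det = 0 := by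
    have h3 : (e * e - em F γ.trace * e + em F γ.det) * coordX t = 0 := by
      rw [htr, em_det]
      linear_combination (em F (γ 1 1) - e) * hX - em F (γ 0 1) * hY
    have h4 : (e * e - em F γ.trace * e + em F γ.det) * coordY t = 0 := by
      rw [htr, em_det]
      linear_combination (em F (γ 0 0) - e) * hY - em F (γ 1 0) * hX
    rcases t with _ | x
    · rw [coordX] at h3; linear_combination -h3
    · simpa [coordY] using h4
  have he' : em F γ.trace - locMult γ t = e :=
    mul_right_cancel₀ he (by linear_combination -hroot - h2)
  rw [he']
  exact ⟨h1, h2⟩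

lemma scalar_of_locMult_eq {γ : Matrix (Fin 2) (Fin 2) F} (hγ : γ.det ≠ 0)
    {t t' : Option (AlgebraicClosure F)} (ht : moebius γ t = t) (ht' : moebius γ t' = t')
    (hne : t ≠ t') (h : locMult γ t = locMult γ t') :
    ∃ a : F, γ = a • (1 : Matrix (Fin 2) (Fin 2) F) := by
  have hW := coord_independent hne
  have h1 := (mapsCoord_self hγ ht).1
  have h2 := (mapsCoord_self hγ ht').1
  rw [← h] at h2
  generalize em F γ.trace - locMult γ t = e at h1 h2
  obtain ⟨h1, h3⟩ := h1
  obtain ⟨h2, h4⟩ := h2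
  have ha : em F (γ 0 0) = e := mul_right_cancel₀ hW (by
    linear_combination coordY t' * h1 - coordY t * h2)
  have hb : em F (γ 0 1) = 0 := (mul_eq_zero_iff_right hW).mp (by
    linear_combination coordX t * h2 - coordX t' * h1)
  have hc : em F (γ 1 0) = 0 := (mul_eq_zero_iff_right hW).mp (by
    linear_combination coordY t' * h3 - coordY t * h4)
  have hd : em F (γ 1 1) = e := mul_right_cancel₀ hW (by
    linear_combination coordX t * h4 - coordX t' * h3)
  have had : γ 0 0 = γ 1 1 := (em F).injective (ha.trans hd.symm)
  rw [map_eq_zero] at hb hc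
  refine ⟨γ 0 0, ?_⟩
  ext i j
  fin_cases i <;> fin_cases j <;> simp [hb, hc, had]

lemma exists_fixed {γ : Matrix (Fin 2) (Fin 2) F} (hγ : γ.det ≠ 0) {α e : AlgebraicClosure F}
    (hsum : α + e = em F γ.trace) (hprod : α * e = em F γ.det) :
    ∃ t, moebius γ t = t ∧ locMult γ t = α := by
  have he : e ≠ 0 := by
    rintro rfl
    rw [mul_zero, eq_comm, map_eq_zero] at hprod
    exact hγ hprod
  suffices h : ∃ t, MapsCoord γ e t t by
    obtain ⟨t, ht⟩ := h
    obtain ⟨h1, h2⟩ := ht.eq hγ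
    exact ⟨t, h1, mul_right_cancel₀ he (h2.trans hprod.symm)⟩
  have htr : em F γ.trace = em F (γ 0 0) + em F (γ 1 1) := by
    rw [Matrix.trace_fin_two, map_add]
  rw [em_det] at hprod
  have hroot : (em F (γ 0 0) - e) * (em F (γ 1 1) - e) = em F (γ 0 1) * em F (γ 1 0) := by
    linear_combination e * hsum - hprod + e * htr
  by_cases hc : em F (γ 1 0) = 0
  · by_cases ha : em F (γ 0 0) = e
    · exact ⟨none, by simp only [coordX, coordY, ha]; ring, by simp only [coordX, coordY, hc]; ring⟩
    · rw [hc, mul_zero, mul_eq_zero, or_iff_right (sub_ne_zero.mpr ha), sub_eq_zero] at hroot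
      have ha' : e - em F (γ 0 0) ≠ 0 := sub_ne_zero.mpr (Ne.symm ha)
      refine ⟨some (em F (γ 0 1) / (e - em F (γ 0 0))), ?_, ?_⟩
      · simp only [coordX, coordY]; field_simp; ring
      · simp only [coordX, coordY, hc, hroot]; ring
  · refine ⟨some ((e - em F (γ 1 1)) / em F (γ 1 0)), ?_, ?_⟩
    · simp only [coordX, coordY]; field_simp; linear_combination -hroot
    · simp only [coordX, coordY]; field_simp; ring

lemma exists_eigenvalues (γ : Matrix (Fin 2) (Fin 2) F) :
    ∃ α β : AlgebraicClosure F, α + β = em F γ.trace ∧ α * β = em F γ.det := by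
  obtain ⟨α, hα⟩ := IsAlgClosed.exists_root
    (X ^ 2 - C (em F γ.trace) * X + C (em F γ.det) : (AlgebraicClosure F)[X])
    (by
      have : (X ^ 2 - C (em F γ.trace) * X + C (em F γ.det) : (AlgebraicClosure F)[X]).degree = 2 := by
        compute_degree!
      rw [this]; decide)
  simp only [IsRoot.def, eval_add, eval_sub, eval_pow, eval_X, eval_mul, eval_C] at hα
  exact ⟨α, em F γ.trace - α, by ring, by linear_combination -hα⟩

lemma exists_fixedPoints {γ : Matrix (Fin 2) (Fin 2) F} (hγ : γ.det ≠ 0)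
    (hns : ¬ ∃ a : F, γ = a • (1 : Matrix (Fin 2) (Fin 2) F)) {α β : AlgebraicClosure F}
    (hsum : α + β = em F γ.trace) (hprod : α * β = em F γ.det) :
    ∃ s t, (∀ y, moebius γ y = y ↔ y = s ∨ y = t) ∧ locMult γ s = α ∧ locMult γ t = β := by
  obtain ⟨s, hs, hsα⟩ := exists_fixed hγ hsum hprod
  obtain ⟨t, ht, htβ⟩ := exists_fixed hγ (by rw [add_comm, hsum]) (by rw [mul_comm, hprod])
  refine ⟨s, t, fun y => ⟨fun hy => ?_, ?_⟩, hsα, htβ⟩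
  · by_contra! hne
    have h := (mapsCoord_self hγ hy).2
    have h' : (locMult γ y - α) * (locMult γ y - β) = 0 := by
      linear_combination hprod - h - locMult γ y * hsum
    rcases mul_eq_zero.mp h' with h0 | h0
    · exact hns (scalar_of_locMult_eq hγ hy hs hne.1 (by rw [hsα, sub_eq_zero.mp h0]))
    · exact hns (scalar_of_locMult_eq hγ hy ht hne.2 (by rw [htβ, sub_eq_zero.mp h0]))
  · rintro (rfl | rfl) <;> assumption

lemma det_pow_ne_zero {γ : Matrix (Fin 2) (Fin 2) F} (hγ : γ.det ≠ 0) (i : ℕ) :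
    (γ ^ i).det ≠ 0 := by
  rw [Matrix.det_pow]; exact pow_ne_zero i hγ

lemma locMult_pow_of_fixed {γ : Matrix (Fin 2) (Fin 2) F} (hγ : γ.det ≠ 0)
    {t : Option (AlgebraicClosure F)} (ht : moebius γ t = t) (i : ℕ) :
    moebius (γ ^ i) t = t ∧ locMult (γ ^ i) t = locMult γ t ^ i := by
  have h := fun a => Function.iterate_fixed ht a
  refine ⟨by rw [← iterate_moebius hγ, h], ?_⟩
  rw [← prod_locMult_iterate hγ, Finset.prod_congr rfl fun a _ => by rw [h a],
    Finset.prod_const, Finset.card_range]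

lemma smul_one_det_ne_zero {a : F} (h : (a • (1 : Matrix (Fin 2) (Fin 2) F)).det ≠ 0) :
    a ≠ 0 := by
  rintro rfl
  simp at h

/-- Three distinct fixed points force a scalar matrix. -/
lemma scalar_of_three_fixed {γ : Matrix (Fin 2) (Fin 2) F} (hγ : γ.det ≠ 0)
    {s t y : Option (AlgebraicClosure F)} (hs : moebius γ s = s) (ht : moebius γ t = t)
    (hy : moebius γ y = y) (hst : s ≠ t) (hys : y ≠ s) (hyt : y ≠ t) :
    ∃ a : F, γ = a • (1 : Matrix (Fin 2) (Fin 2) F) := by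
  by_contra hns
  obtain ⟨α, β, hsum, hprod⟩ := exists_eigenvalues γ
  obtain ⟨s', t', h, -, -⟩ := exists_fixedPoints hγ hns hsum hprod
  rw [h] at hs ht hy
  grind

/-- If `γ` has two fixed points with distinct multipliers `α`, `β`, then `γ ^ i` is scalar
exactly when `α ^ i = β ^ i`. -/
lemma pow_scalar_iff {γ : Matrix (Fin 2) (Fin 2) F} (hγ : γ.det ≠ 0)
    {s t : Option (AlgebraicClosure F)} (hs : moebius γ s = s) (ht : moebius γ t = t)
    (hst : s ≠ t) (i : ℕ) :
    (∃ a : F, γ ^ i = a • (1 : Matrix (Fin 2) (Fin 2) F)) ↔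
      locMult γ s ^ i = locMult γ t ^ i := by
  obtain ⟨h1, h2⟩ := locMult_pow_of_fixed hγ hs i
  obtain ⟨h3, h4⟩ := locMult_pow_of_fixed hγ ht i
  rw [← h2, ← h4]
  constructor
  · rintro ⟨a, ha⟩
    have ha0 : a ≠ 0 := smul_one_det_ne_zero (by rw [← ha]; exact det_pow_ne_zero hγ i)
    rw [ha, (moebius_smul_one ha0 s).2, (moebius_smul_one ha0 t).2]
  · exact scalar_of_locMult_eq (det_pow_ne_zero hγ i) h1 h3 hst

lemma pow_eq_scalar_of_nilpotent {γ : Matrix (Fin 2) (Fin 2) F} {a : F} {p : ℕ}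
    [Fact p.Prime] [CharP F p] (htr : γ.trace = a + a) (hdet : γ.det = a * a) :
    γ ^ p = (a ^ p) • (1 : Matrix (Fin 2) (Fin 2) F) := by
  set N := γ - a • (1 : Matrix (Fin 2) (Fin 2) F) with hN
  have hN2 : N ^ 2 = 0 := by
    rw [Matrix.trace_fin_two] at htr
    rw [Matrix.det_fin_two] at hdet
    rw [hN, sq]
    ext i j
    fin_cases i <;> fin_cases j <;> simp [Matrix.mul_apply, Fin.sum_univ_two]
    · linear_combination γ 0 0 * htr - hdet
    · linear_combination γ 0 1 * htr
    · linear_combination γ 1 0 * htr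
    · linear_combination γ 1 1 * htr - hdet
  have hNp : N ^ p = 0 := by
    rw [← Nat.add_sub_cancel' (Fact.out : p.Prime).two_le, pow_add, hN2, zero_mul]
  have hγ : γ = N + a • 1 := by rw [hN]; abel
  have hcomm : Commute N (a • (1 : Matrix (Fin 2) (Fin 2) F)) :=
    (Commute.one_right N).smul_right a
  conv_lhs => rw [hγ]
  rw [add_pow_char_of_commute p hcomm, hNp, zero_add, _root_.smul_pow, one_pow]

variable [Fintype F]

lemma freePair_of {γ : Matrix (Fin 2) (Fin 2) F} (hγ : γ.det ≠ 0)
    {K : Finset (Option (AlgebraicClosure F))} (hK : ∀ y ∈ K, moebius γ y = y)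
    (hσ : ∀ y, frobP1 F y ∈ K → y ∈ K) {m : ℕ} (hm : 0 < m)
    (hscal : ∃ a : F, γ ^ m = a • (1 : Matrix (Fin 2) (Fin 2) F))
    (hfree : ∀ y, y ∉ K → ∀ i, 0 < i → i < m → moebius (γ ^ i) y ≠ y) :
    FreePair (frobP1 F) (moebius γ) {y | y ∉ K} m where
  pos := hm
  comm := fun y => ((moebius_frobP1 hγ y).1).symm
  inj_left := frobP1_injective
  inj_right := moebius_injective hγ
  maps_left := fun y hy h => hy (hσ y h)
  maps_right := fun y hy h => hy (by
    have := moebius_injective hγ (hK _ h)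
    rwa [this] at h)
  periodic := fun y _ => exists_iterate_frobP1 y
  iterate_eq := fun y _ => by
    obtain ⟨a, ha⟩ := hscal
    have ha0 : a ≠ 0 := smul_one_det_ne_zero (by rw [← ha]; exact det_pow_ne_zero hγ m)
    rw [iterate_moebius hγ, ha, (moebius_smul_one ha0 y).1]
  free := fun y hy i hi him => by
    rw [iterate_moebius hγ]
    exact hfree y hy i hi him

lemma freePair_scalar {a : F} (ha : a ≠ 0) :
    FreePair (frobP1 F) (moebius (a • (1 : Matrix (Fin 2) (Fin 2) F)))
      {y | y ∉ (∅ : Finset (Option (AlgebraicClosure F)))} 1 :=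
  freePair_of (by simpa using ha) (by simp) (by simp) one_pos ⟨a, pow_one _⟩
    (fun _ _ i hi hi' => by omega)

lemma freePair_semisimple {γ : Matrix (Fin 2) (Fin 2) F} (hγ : γ.det ≠ 0)
    {s t : Option (AlgebraicClosure F)} (hfix : ∀ y, moebius γ y = y ↔ y = s ∨ y = t)
    (hst : s ≠ t) {m : ℕ} (hm0 : 0 < m)
    (hm : ∀ i, m ∣ i ↔ locMult γ s ^ i = locMult γ t ^ i) :
    FreePair (frobP1 F) (moebius γ) {y | y ∉ ({s, t} : Finset (Option (AlgebraicClosure F)))} m := by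
  have hs := (hfix s).mpr (Or.inl rfl)
  have ht := (hfix t).mpr (Or.inr rfl)
  refine freePair_of hγ (fun y hy => ?_) (fun y hy => ?_) hm0
    ((pow_scalar_iff hγ hs ht hst m).mpr ((hm m).mp dvd_rfl)) (fun y hy i hi him hfixed => ?_)
  · rw [hfix]; simpa using hy
  · have h1 : moebius γ (frobP1 F y) = frobP1 F y := by rw [hfix]; simpa using hy
    rw [(moebius_frobP1 hγ y).1] at h1
    simpa using (hfix y).mp (frobP1_injective h1)
  · have h1 := scalar_of_three_fixed (det_pow_ne_zero hγ i) (locMult_pow_of_fixed hγ hs i).1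
      (locMult_pow_of_fixed hγ ht i).1 hfixed hst (by rintro rfl; simp at hy)
      (by rintro rfl; simp at hy)
    exact absurd (Nat.le_of_dvd hi ((hm i).mpr ((pow_scalar_iff hγ hs ht hst i).mp h1))) (by omega)

lemma freePair_unipotent {γ : Matrix (Fin 2) (Fin 2) F} (hγ : γ.det ≠ 0)
    {s : Option (AlgebraicClosure F)} (hfix : ∀ y, moebius γ y = y ↔ y = s) {a : F} {p : ℕ}
    [Fact p.Prime] [CharP F p] (htr : γ.trace = a + a) (hdet : γ.det = a * a) :
    FreePair (frobP1 F) (moebius γ) {y | y ∉ ({s} : Finset (Option (AlgebraicClosure F)))} p := by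
  have hscal := pow_eq_scalar_of_nilpotent (p := p) htr hdet
  have ha0 : a ^ p ≠ 0 := smul_one_det_ne_zero (by rw [← hscal]; exact det_pow_ne_zero hγ p)
  refine freePair_of hγ (fun y hy => ?_) (fun y hy => ?_) (Fact.out : p.Prime).pos
    ⟨_, hscal⟩ (fun y hy i hi hip hfixed => ?_)
  · rw [hfix]; simpa using hy
  · have h1 : moebius γ (frobP1 F y) = frobP1 F y := by rw [hfix]; simpa using hy
    rw [(moebius_frobP1 hγ y).1] at h1
    simpa using (hfix y).mp (frobP1_injective h1)
  · have h1 : Function.IsPeriodicPt (moebius γ) i y := by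
      rw [← iterate_moebius hγ] at hfixed; exact hfixed
    have h2 : Function.IsPeriodicPt (moebius γ) p y := by
      rw [Function.IsPeriodicPt, Function.IsFixedPt, iterate_moebius hγ, hscal,
        (moebius_smul_one ha0 y).1]
    have h3 := h1.minimalPeriod_dvd
    have h4 := h2.minimalPeriod_dvd
    rcases (Nat.dvd_prime Fact.out).mp h4 with h5 | h5
    · rw [Function.minimalPeriod_eq_one_iff_isFixedPt] at h5
      simp [(hfix y).mp h5] at hy
    · rw [h5] at h3
      exact absurd (Nat.le_of_dvd hi h3) (by omega)

end FixedPoints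

section StableSets

variable {α : Type*} [DecidableEq α] {σ γ : α → α}

lemma FreePair.exists_prod_eq_pow {U : Set α} {m : ℕ} (h : FreePair σ γ U m) {S : Finset α}
    {n : ℕ} (hS : S ∈ stableSets σ γ U n) :
    ∃ k, n = m * k ∧ ∀ {M : Type _} [CommMonoid M] (f : α → M) (L : M),
      (∀ y ∈ U, ∏ i ∈ Finset.range m, f (γ^[i] y) = L) → ∏ y ∈ S, f y = L ^ k := by
  obtain ⟨hU, h1, h2, rfl⟩ := hS
  have hsub := (h.jointOrbit_subset_iff hU).mpr ⟨h1, h2⟩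
  have h3 : ∀ y ∈ S, orbitFinset γ m y ⊆ S := fun y hy z hz => by
    obtain ⟨i, rfl⟩ := (h.mem_orbitFinset (hU y hy)).mp hz
    exact hsub y hy ((h.mem_jointOrbit (hU y hy)).mpr ⟨0, i, rfl⟩)
  have h4 : ∀ y ∈ S,
      S.filter (fun z => orbitFinset γ m z = orbitFinset γ m y) = orbitFinset γ m y := by
    intro y hy
    ext z
    rw [Finset.mem_filter]
    constructor
    · rintro ⟨hz, heq⟩
      rw [← heq]; exact h.self_mem_orbitFinset (hU z hz)
    · intro hz
      exact ⟨h3 y hy hz, h.orbitFinset_eq (hU y hy) hz⟩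
  refine ⟨(S.image (orbitFinset γ m)).card, ?_, fun f L hL => ?_⟩
  · rw [Finset.card_eq_sum_card_image (orbitFinset γ m) S, mul_comm, ← smul_eq_mul]
    refine Finset.sum_eq_card_nsmul fun B hB => ?_
    obtain ⟨y, hy, rfl⟩ := Finset.mem_image.mp hB
    rw [h4 y hy, h.card_orbitFinset (hU y hy)]
  · rw [← Finset.prod_fiberwise_of_maps_to (g := orbitFinset γ m)
      (t := S.image (orbitFinset γ m)) (fun y hy => Finset.mem_image_of_mem _ hy)]
    refine Finset.prod_eq_pow_card fun B hB => ?_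
    obtain ⟨y, hy, rfl⟩ := Finset.mem_image.mp hB
    rw [h4 y hy, orbitFinset, Finset.prod_image (h.iterate_injOn (hU y hy)), hL y (hU y hy)]

lemma ncard_stableSets_zero (U : Set α) : (stableSets σ γ U 0).ncard = 1 := by
  rw [Set.ncard_eq_one]
  refine ⟨∅, ?_⟩
  ext S
  simp only [stableSets, Set.mem_ofPred_eq, Set.mem_singleton_iff, Finset.card_eq_zero]
  constructor
  · exact fun h => h.2.2.2
  · rintro rfl; simp

/-- Splitting off the part of a stable set contained in a stable finite set `K`. -/
lemma ncard_stable_inter_eq (hσ : Function.Injective σ) {K T : Finset α}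
    (hK : ∀ y ∈ K, γ y = y) (hγ : Function.Injective γ)
    (hσK : ∀ y, σ y ∈ K ↔ y ∈ K) (hT : T ⊆ K) (n : ℕ) (P : Finset α → Prop) (Q : Prop)
    (hPQ : ∀ S' ∈ stableSets σ γ {y | y ∉ K} (n - T.card), P (S' ∪ T) ↔ Q) :
    {S : Finset α | (S.card = n ∧ S.image σ = S ∧ S.image γ = S ∧ P S) ∧ S ∩ K = T}.ncard =
      if T.card ≤ n ∧ T.image σ = T ∧ Q then
        (stableSets σ γ {y | y ∉ K} (n - T.card)).ncard else 0 := by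
  have hγK : ∀ y, γ y ∈ K ↔ y ∈ K := fun y =>
    ⟨fun h => by have := hγ (hK _ h); rwa [this] at h, fun h => by rwa [hK y h]⟩
  have hint : ∀ (f : α → α), Function.Injective f → (∀ y, f y ∈ K ↔ y ∈ K) → ∀ S : Finset α,
      S.image f = S → (S ∩ K).image f = S ∩ K ∧ (S \ K).image f = S \ K := by
    intro f hf hfK S hS
    constructor
    · apply Finset.eq_of_subset_of_card_le
      · intro z hz
        obtain ⟨y, hy, rfl⟩ := Finset.mem_image.mp hz
        rw [Finset.mem_inter] at hy ⊢
        exact ⟨by rw [← hS]; exact Finset.mem_image_of_mem _ hy.1, (hfK y).mpr hy.2⟩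
      · rw [Finset.card_image_of_injective _ hf]
    · apply Finset.eq_of_subset_of_card_le
      · intro z hz
        obtain ⟨y, hy, rfl⟩ := Finset.mem_image.mp hz
        rw [Finset.mem_sdiff] at hy ⊢
        exact ⟨by rw [← hS]; exact Finset.mem_image_of_mem _ hy.1, fun h => hy.2 ((hfK y).mp h)⟩
      · rw [Finset.card_image_of_injective _ hf]
  have hsplit : ∀ S : Finset α, (S.card = n ∧ S.image σ = S ∧ S.image γ = S) → S ∩ K = T →
      T.card ≤ n ∧ T.image σ = T ∧ S \ K ∈ stableSets σ γ {y | y ∉ K} (n - T.card) ∧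
        S \ K ∪ T = S := by
    rintro S ⟨h1, h2, h3⟩ rfl
    refine ⟨?_, (hint σ hσ hσK S h2).1, ⟨?_, (hint σ hσ hσK S h2).2, (hint γ hγ hγK S h3).2, ?_⟩,
      Finset.sdiff_union_inter S K⟩
    · rw [← h1]; exact Finset.card_le_card Finset.inter_subset_left
    · intro y hy; exact (Finset.mem_sdiff.mp hy).2
    · have := Finset.card_sdiff_add_card_inter S K
      omega
  split_ifs with hcond
  · obtain ⟨hle, hTσ, hQ⟩ := hcond
    have hdisj : ∀ S' ∈ stableSets σ γ {y | y ∉ K} (n - T.card), Disjoint S' T ∧ S' ∩ K = ∅ := by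
      intro S' hS'
      refine ⟨Finset.disjoint_left.mpr fun y hy hyT => hS'.1 y hy (hT hyT), ?_⟩
      ext y
      simp only [Finset.mem_inter, Finset.notMem_empty, iff_false, not_and]
      exact fun hy => hS'.1 y hy
    have hTγ : T.image γ = T := by
      rw [Finset.image_congr (g := id) fun y hy => hK y (hT hy), Finset.image_id]
    symm
    refine Set.ncard_congr (fun S' _ => S' ∪ T) ?_ ?_ ?_
    · intro S' hS'
      have hd := hdisj S' hS'
      refine ⟨⟨?_, ?_, ?_, (hPQ S' hS').mpr hQ⟩, ?_⟩
      · rw [Finset.card_union_of_disjoint hd.1, hS'.2.2.2]; omega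
      · rw [Finset.image_union, hS'.2.1, hTσ]
      · rw [Finset.image_union, hS'.2.2.1, hTγ]
      · rw [Finset.union_inter_distrib_right, hd.2, Finset.empty_union,
          Finset.inter_eq_left.mpr hT]
    · intro S₁ S₂ h₁ h₂ heq
      have h1 := (hdisj S₁ h₁).1
      have h2 := (hdisj S₂ h₂).1
      rw [← Finset.union_sdiff_cancel_right h1, heq, Finset.union_sdiff_cancel_right h2]
    · rintro S ⟨⟨h1, h2, h3, -⟩, h5⟩
      obtain ⟨-, -, h6, h7⟩ := hsplit S ⟨h1, h2, h3⟩ h5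
      exact ⟨S \ K, h6, h7⟩
  · rw [← Set.ncard_empty (Finset α)]
    congr 1
    rw [Set.eq_empty_iff_forall_notMem]
    rintro S ⟨⟨h1, h2, h3, h4⟩, h5⟩
    obtain ⟨h6, h7, h8, h9⟩ := hsplit S ⟨h1, h2, h3⟩ h5
    exact hcond ⟨h6, h7, (hPQ _ h8).mp (by rwa [h9])⟩

end StableSets

section Counts

variable {F : Type} [Field F] [Fintype F]

local notation "P1" => Option (AlgebraicClosure F)

lemma card_twisted {γ : Matrix (Fin 2) (Fin 2) F} (hγ : γ.det ≠ 0) {K : Finset P1}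
    (hK : ∀ y ∈ K, moebius γ y = y) {j : ℕ} (hj : 0 < j) (i : ℕ) :
    {y ∈ {y | y ∉ K} | (frobP1 F)^[j] y = (moebius γ)^[i] y}.Finite ∧
      {y ∈ {y | y ∉ K} | (frobP1 F)^[j] y = (moebius γ)^[i] y}.ncard =
        Fintype.card F ^ j + 1 - (K.filter fun y => (frobP1 F)^[j] y = y).card := by
  have hKi : ∀ y ∈ K, (moebius γ)^[i] y = y := fun y hy => Function.iterate_fixed (hK y hy) i
  obtain ⟨h1, h2⟩ := ncard_frobP1_eq_moebius (det_pow_ne_zero hγ i) hj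
  simp only [← iterate_moebius hγ] at h1 h2
  have hset : {y ∈ {y | y ∉ K} | (frobP1 F)^[j] y = (moebius γ)^[i] y} =
      {y | (frobP1 F)^[j] y = (moebius γ)^[i] y} \
        ((K.filter fun y => (frobP1 F)^[j] y = y : Finset P1) : Set P1) := by
    ext y
    simp only [Set.mem_ofPred_eq, Set.mem_sdiff, Finset.mem_coe, Finset.mem_filter, not_and]
    constructor
    · rintro ⟨h3, h4⟩; exact ⟨h4, fun h => absurd h h3⟩
    · rintro ⟨h3, h4⟩
      exact ⟨fun h => h4 h (by rw [h3, hKi y h]), h3⟩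
  rw [hset]
  refine ⟨h1.subset Set.sdiff_subset, ?_⟩
  rw [Set.ncard_sdiff, h2, Set.ncard_coe_finset]
  · intro y hy
    rw [Finset.mem_coe, Finset.mem_filter] at hy
    rw [Set.mem_ofPred_eq, hy.2, hKi y hy.1]

lemma isNewton_stableSets {γ : Matrix (Fin 2) (Fin 2) F} (hγ : γ.det ≠ 0) {K : Finset P1}
    (hK : ∀ y ∈ K, moebius γ y = y) {m : ℕ}
    (h : FreePair (frobP1 F) (moebius γ) {y | y ∉ K} m) :
    IsNewton (fun N => ((stableSets (frobP1 F) (moebius γ) {y | y ∉ K} (m * N)).ncard : ℚ))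
      (fun j => ((Fintype.card F ^ j + 1 -
        (K.filter fun y => (frobP1 F)^[j] y = y).card : ℕ) : ℚ)) := by
  refine ⟨?_, fun N => ?_⟩
  · simp [ncard_stableSets_zero]
  · have hrec := h.stableSets_recursion _ (fun j hj i _ => (card_twisted hγ hK hj i).1)
      (fun j hj i _ => (card_twisted hγ hK hj i).2) N
    simpa only [Nat.cast_ite, Nat.cast_zero] using hrec

lemma ncard_stableSets_of_not_dvd {γ : Matrix (Fin 2) (Fin 2) F} {K : Finset P1} {m n : ℕ}
    (h : FreePair (frobP1 F) (moebius γ) {y | y ∉ K} m) (hmn : ¬ m ∣ n) :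
    (stableSets (frobP1 F) (moebius γ) {y | y ∉ K} n).ncard = 0 := by
  rw [← Set.ncard_empty (Finset P1)]
  congr 1
  rw [Set.eq_empty_iff_forall_notMem]
  exact fun S hS => hmn (h.dvd_card hS)

lemma finite_stableSets_of_freePair {γ : Matrix (Fin 2) (Fin 2) F} (hγ : γ.det ≠ 0)
    {K : Finset P1} (hK : ∀ y ∈ K, moebius γ y = y) {m : ℕ}
    (h : FreePair (frobP1 F) (moebius γ) {y | y ∉ K} m) (n : ℕ) :
    (stableSets (frobP1 F) (moebius γ) {y | y ∉ K} n).Finite :=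
  h.finite_stableSets (fun _ hj i _ => (card_twisted hγ hK hj i).1) n

lemma ncard_stableSets_scalar {a : F} (ha : a ≠ 0) (n : ℕ) :
    ((stableSets (frobP1 F) (moebius (a • (1 : Matrix (Fin 2) (Fin 2) F)))
      {y | y ∉ (∅ : Finset P1)} (n + 3)).ncard : ℚ) =
      (Fintype.card F : ℚ) ^ n * ((Fintype.card F : ℚ) ^ 3 - Fintype.card F) := by
  have h := (isNewton_stableSets (by simpa using ha) (by simp) (freePair_scalar ha)).projectiveLine
    (q := Fintype.card F) (fun j hj => by simp) n
  simpa using h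

lemma ncard_stableSets_split {γ : Matrix (Fin 2) (Fin 2) F} (hγ : γ.det ≠ 0)
    {s t : P1} (hs : moebius γ s = s) (ht : moebius γ t = t) (hst : s ≠ t)
    (hsσ : frobP1 F s = s) (htσ : frobP1 F t = t) {m : ℕ}
    (h : FreePair (frobP1 F) (moebius γ) {y | y ∉ ({s, t} : Finset P1)} m) {n : ℕ} (hn : 0 < n) :
    ((stableSets (frobP1 F) (moebius γ) {y | y ∉ ({s, t} : Finset P1)} n).ncard : ℚ) =
      if m ∣ n then ((Fintype.card F : ℚ) - 1) * A2 (Fintype.card F) (n / m) else 0 := by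
  split_ifs with hmn
  · obtain ⟨N, rfl⟩ := hmn
    rw [Nat.mul_div_cancel_left _ h.pos]
    refine (isNewton_stableSets hγ (by simp [hs, ht]) h).punctured (fun j hj => ?_)
      (Nat.pos_of_mul_pos_left hn)
    have : ({s, t} : Finset P1).filter (fun y => (frobP1 F)^[j] y = y) = {s, t} := by
      rw [Finset.filter_true_of_mem]
      intro y hy
      rcases Finset.mem_insert.mp hy with rfl | hy
      · exact Function.iterate_fixed hsσ j
      · rw [Finset.mem_singleton.mp hy]; exact Function.iterate_fixed htσ j
    rw [this, Finset.card_pair hst]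
    have := Nat.one_le_pow j (Fintype.card F) Fintype.card_pos
    rw [Nat.cast_sub (show 2 ≤ Fintype.card F ^ j + 1 by omega)]
    push_cast
    ring
  · exact_mod_cast ncard_stableSets_of_not_dvd h hmn

lemma ncard_stableSets_unipotent {γ : Matrix (Fin 2) (Fin 2) F} (hγ : γ.det ≠ 0)
    {s : P1} (hs : moebius γ s = s) (hsσ : frobP1 F s = s) {m : ℕ}
    (h : FreePair (frobP1 F) (moebius γ) {y | y ∉ ({s} : Finset P1)} m) {n : ℕ} (hn : 0 < n) :
    ((stableSets (frobP1 F) (moebius γ) {y | y ∉ ({s} : Finset P1)} n).ncard : ℚ) =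
      if m ∣ n then (Fintype.card F : ℚ) * A1 (Fintype.card F) (n / m) else 0 := by
  split_ifs with hmn
  · obtain ⟨N, rfl⟩ := hmn
    rw [Nat.mul_div_cancel_left _ h.pos]
    refine (isNewton_stableSets hγ (by simp [hs]) h).affineLine (fun j hj => ?_)
      (Nat.pos_of_mul_pos_left hn)
    have : ({s} : Finset P1).filter (fun y => (frobP1 F)^[j] y = y) = {s} := by
      rw [Finset.filter_true_of_mem]
      intro y hy
      rw [Finset.mem_singleton.mp hy]; exact Function.iterate_fixed hsσ j
    rw [this, Finset.card_singleton]
    simp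
  · exact_mod_cast ncard_stableSets_of_not_dvd h hmn

lemma iterate_of_swap {α : Type*} {f : α → α} {s t : α} (hs : f s = t) (ht : f t = s)
    (hst : s ≠ t) (j : ℕ) : f^[j] s = s ↔ Even j := by
  induction j using Nat.twoStepInduction with
  | zero => simp
  | one => simp [hs, hst.symm]
  | more j ih _ =>
    rw [Function.iterate_add_apply f j 2, show f^[2] s = s by simp [hs, ht], ih]
    simp [Nat.even_add]

lemma ncard_stableSets_nonsplit {γ : Matrix (Fin 2) (Fin 2) F} (hγ : γ.det ≠ 0)
    {s t : P1} (hs : moebius γ s = s) (ht : moebius γ t = t) (hst : s ≠ t)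
    (hsσ : frobP1 F s = t) (htσ : frobP1 F t = s) {m : ℕ}
    (h : FreePair (frobP1 F) (moebius γ) {y | y ∉ ({s, t} : Finset P1)} m) {n : ℕ} (hn : 0 < n) :
    ((stableSets (frobP1 F) (moebius γ) {y | y ∉ ({s, t} : Finset P1)} n).ncard : ℚ) =
      if m ∣ n then ((Fintype.card F : ℚ) + 1) * A0 (Fintype.card F) (n / m) else 0 := by
  split_ifs with hmn
  · obtain ⟨N, rfl⟩ := hmn
    rw [Nat.mul_div_cancel_left _ h.pos]
    refine (isNewton_stableSets hγ (by simp [hs, ht]) h).anisotropic (fun j hj => ?_)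
      (Nat.pos_of_mul_pos_left hn)
    have : ({s, t} : Finset P1).filter (fun y => (frobP1 F)^[j] y = y) =
        if Even j then {s, t} else ∅ := by
      split_ifs with hj
      · rw [Finset.filter_true_of_mem]
        intro y hy
        rcases Finset.mem_insert.mp hy with rfl | hy
        · rwa [iterate_of_swap hsσ htσ hst]
        · rwa [Finset.mem_singleton.mp hy, iterate_of_swap htσ hsσ hst.symm]
      · rw [Finset.filter_false_of_mem]
        intro y hy
        rcases Finset.mem_insert.mp hy with rfl | hy
        · rwa [iterate_of_swap hsσ htσ hst]
        · rwa [Finset.mem_singleton.mp hy, iterate_of_swap htσ hsσ hst.symm]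
    rw [this]
    have := Nat.one_le_pow j (Fintype.card F) Fintype.card_pos
    split_ifs with hj
    · rw [Finset.card_pair hst]
      rw [Nat.cast_sub (show 2 ≤ Fintype.card F ^ j + 1 by omega)]
      push_cast
      ring
    · simp
  · exact_mod_cast ncard_stableSets_of_not_dvd h hmn

end Counts

section GoodSets

variable {F : Type} [Field F]

/-- `x` is the square of a nonzero element of `F`. -/
def IsSq (x : AlgebraicClosure F) : Prop := ∃ v : F, v ≠ 0 ∧ x = em F (v * v)

lemma isSq_em_pow {a : F} (ha : a ≠ 0) {n : ℕ} (hn : Even n) : IsSq (em F a ^ n) := by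
  obtain ⟨k, rfl⟩ := hn
  exact ⟨a ^ k, pow_ne_zero k ha, by rw [← pow_add, map_pow]⟩

variable [Fintype F]

lemma isSq_iff (hq : Odd (Fintype.card F)) (x : AlgebraicClosure F) :
    IsSq x ↔ x ^ (Fintype.card F / 2) = 1 := by
  have hchar : ringChar F ≠ 2 := fun h => by
    have := FiniteField.even_card_of_char_two h
    rw [Nat.odd_iff] at hq
    omega
  obtain ⟨k, hk⟩ := hq
  have hk2 : Fintype.card F / 2 = k := by omega
  constructor
  · rintro ⟨v, hv, rfl⟩
    rw [← map_pow, (FiniteField.isSquare_iff hchar (mul_ne_zero hv hv)).mp ⟨v, rfl⟩, map_one]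
  · intro h
    have hxF : x ^ Fintype.card F = x := by
      rw [hk, pow_succ, mul_comm 2, pow_mul, ← hk2, h, one_pow, one_mul]
    obtain ⟨a, rfl⟩ := mem_range_em hxF
    have ha : a ^ (Fintype.card F / 2) = 1 := (em F).injective (by rw [map_pow, h, map_one])
    have ha0 : a ≠ 0 := by
      rintro rfl
      rw [zero_pow] at ha
      · exact zero_ne_one ha
      · have := Fintype.one_lt_card (α := F); omega
    obtain ⟨v, rfl⟩ := (FiniteField.isSquare_iff hchar ha0).mpr ha
    exact ⟨v, fun h => by simp [h] at ha0, rfl⟩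

local notation "P1" => Option (AlgebraicClosure F)

/-- The rational `n`-sets `S` with `γ S = S` and `J(γ,S)` a square. -/
def goodSets (γ : Matrix (Fin 2) (Fin 2) F) (n : ℕ) : Set (Finset P1) :=
  {S | S.card = n ∧ S.image (frobP1 F) = S ∧ S.image (moebius γ) = S ∧ IsSq (Jmult γ S)}

variable (F) in
lemma finite_ratSets (n : ℕ) :
    {S : Finset P1 | S.card = n ∧ S.image (frobP1 F) = S}.Finite := by
  have h := finite_stableSets_of_freePair (by simp) (by simp)
    (freePair_scalar (one_ne_zero (α := F))) n
  refine h.subset fun S hS => ⟨by simp, hS.2, ?_, hS.1⟩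
  rw [Finset.image_congr (g := id) fun y _ => (moebius_smul_one (one_ne_zero (α := F)) y).1,
    Finset.image_id]

lemma Jmult_stable {γ : Matrix (Fin 2) (Fin 2) F} (hγ : γ.det ≠ 0) {K : Finset P1} {m : ℕ}
    (h : FreePair (frobP1 F) (moebius γ) {y | y ∉ K} m) {α : AlgebraicClosure F}
    (hα : ∀ y, locMult (γ ^ m) y = α ^ m) {n : ℕ} {S : Finset P1}
    (hS : S ∈ stableSets (frobP1 F) (moebius γ) {y | y ∉ K} n) : Jmult γ S = α ^ n := by
  obtain ⟨k, rfl, hk⟩ := h.exists_prod_eq_pow hS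
  rw [Jmult, hk (locMult γ) (α ^ m) (fun y _ => by rw [prod_locMult_iterate hγ, hα]), pow_mul]

lemma ncard_goodSets {γ : Matrix (Fin 2) (Fin 2) F} (hγ : γ.det ≠ 0) {K : Finset P1}
    (hK : ∀ y ∈ K, moebius γ y = y) (hσK : ∀ y, frobP1 F y ∈ K ↔ y ∈ K) {m : ℕ}
    (h : FreePair (frobP1 F) (moebius γ) {y | y ∉ K} m) {α : AlgebraicClosure F}
    (hα : ∀ y, locMult (γ ^ m) y = α ^ m) (n : ℕ) :
    (goodSets γ n).ncard = ∑ T ∈ K.powerset,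
      if T.card ≤ n ∧ T.image (frobP1 F) = T ∧ IsSq (α ^ (n - T.card) * ∏ t ∈ T, locMult γ t)
      then (stableSets (frobP1 F) (moebius γ) {y | y ∉ K} (n - T.card)).ncard else 0 := by
  have hfin : (goodSets γ n).Finite :=
    (finite_ratSets F n).subset fun S hS => ⟨hS.1, hS.2.1⟩
  rw [Set.ncard_eq_toFinset_card _ hfin,
    Finset.card_eq_sum_card_fiberwise (f := fun S => S ∩ K) (t := K.powerset)
      (fun S _ => Finset.mem_coe.mpr (Finset.mem_powerset.mpr Finset.inter_subset_right))]
  refine Finset.sum_congr rfl fun T hT => ?_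
  rw [Finset.mem_powerset] at hT
  rw [← ncard_stable_inter_eq frobP1_injective hK (moebius_injective hγ) hσK hT n
    (fun S => IsSq (Jmult γ S)), ← Set.ncard_coe_finset]
  · congr 1
    ext S
    simp [goodSets]
  · intro S' hS'
    rw [Jmult, Finset.prod_union
      (Finset.disjoint_left.mpr fun y hy hyT => hS'.1 y hy (hT hyT)),
      show ∏ t ∈ S', locMult γ t = α ^ (n - T.card) from Jmult_stable hγ h hα hS']

lemma ncard_goodSets_scalar {a : F} (ha : a ≠ 0) {n : ℕ} (hn : Even (n + 3)) :
    ((goodSets (a • (1 : Matrix (Fin 2) (Fin 2) F)) (n + 3)).ncard : ℚ) =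
      (Fintype.card F : ℚ) ^ n * ((Fintype.card F : ℚ) ^ 3 - Fintype.card F) := by
  have hγ : (a • (1 : Matrix (Fin 2) (Fin 2) F)).det ≠ 0 := by simpa using ha
  rw [ncard_goodSets hγ (K := ∅) (by simp) (by simp) (freePair_scalar ha) (α := em F a)
    (fun y => by rw [pow_one, pow_one, (moebius_smul_one ha y).2]),
    ← ncard_stableSets_scalar ha]
  simp [isSq_em_pow ha hn]

lemma sum_powerset_pair {β : Type*} [DecidableEq β] {M : Type*} [AddCommMonoid M] {s t : β}
    (hst : s ≠ t) (f : Finset β → M) :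
    ∑ T ∈ ({s, t} : Finset β).powerset, f T = f ∅ + f {t} + (f {s} + f {s, t}) := by
  rw [Finset.sum_powerset_insert (by simpa using hst)]
  have h : ({t} : Finset β).powerset = {∅, {t}} := by
    ext T; simp [Finset.subset_singleton_iff]
  rw [h, Finset.sum_pair (Finset.singleton_ne_empty t).symm,
    Finset.sum_pair (Finset.singleton_ne_empty t).symm, insert_empty_eq]

lemma dvd_half_iff {m k : ℕ} (hm : 0 < m) (hk : Even k) (hmk : m ∣ k) :
    m ∣ k / 2 ↔ Even (k / m) := by
  obtain ⟨l, rfl⟩ := hmk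
  rw [Nat.mul_div_cancel_left _ hm]
  constructor
  · rintro ⟨i, hi⟩
    have h2 : m * l = m * (2 * i) := by
      rw [mul_left_comm, ← hi, Nat.mul_div_cancel' hk.two_dvd]
    exact ⟨i, by rw [Nat.eq_of_mul_eq_mul_left hm h2]; ring⟩
  · rintro ⟨i, rfl⟩
    exact ⟨i, by rw [← mul_two, ← mul_assoc, Nat.mul_div_cancel _ two_pos]⟩

lemma ncard_goodSets_split (hq : Odd (Fintype.card F)) {γ : Matrix (Fin 2) (Fin 2) F}
    (hγ : γ.det ≠ 0) {a b : F} (hab : a ≠ b) (hsum : a + b = γ.trace) (hprod : a * b = γ.det)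
    {n : ℕ} (hn : Even n) (hn2 : 2 < n) :
    ((goodSets γ n).ncard : ℚ) = ((Fintype.card F : ℚ) - 1) *
      ((if orderOf (a / b) ∣ n then A2 (Fintype.card F) (n / orderOf (a / b)) else 0) +
        2 * (if orderOf (a / b) ∣ n - 1
          then A2 (Fintype.card F) ((n - 1) / orderOf (a / b)) else 0) +
        if orderOf (a / b) ∣ n - 2 ∧ Even ((Fintype.card F - 1) / orderOf (a / b))
          then A2 (Fintype.card F) ((n - 2) / orderOf (a / b)) else 0) := by
  set m := orderOf (a / b) with hm
  have ha : a ≠ 0 := fun h => hγ (by rw [← hprod, h, zero_mul])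
  have hb : b ≠ 0 := fun h => hγ (by rw [← hprod, h, mul_zero])
  have hmq : m ∣ Fintype.card F - 1 :=
    orderOf_dvd_of_pow_eq_one (FiniteField.pow_card_sub_one_eq_one _ (div_ne_zero ha hb))
  have hm0 : 0 < m := Nat.pos_of_dvd_of_pos hmq (by have := Fintype.one_lt_card (α := F); omega)
  have hns : ¬ ∃ c : F, γ = c • (1 : Matrix (Fin 2) (Fin 2) F) := by
    rintro ⟨c, rfl⟩
    simp only [Matrix.trace_smul, Matrix.trace_one, Fintype.card_fin, Nat.cast_ofNat, smul_eq_mul,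
      Matrix.det_smul, Matrix.det_one, mul_one] at hsum hprod
    have : (a - b) * (a - b) = 0 := by linear_combination (a + b + c * 2) * hsum - 4 * hprod
    exact hab (sub_eq_zero.mp (mul_self_eq_zero.mp this))
  obtain ⟨s, t, hfix, hs, ht⟩ := exists_fixedPoints hγ hns (α := em F a) (β := em F b)
    (by rw [← map_add, hsum]) (by rw [← map_mul, hprod])
  have hst : s ≠ t := by
    rintro rfl
    exact hab ((em F).injective (hs.symm.trans ht))
  have hsf := (hfix s).mpr (Or.inl rfl)
  have htf := (hfix t).mpr (Or.inr rfl)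
  have hmi : ∀ i, m ∣ i ↔ locMult γ s ^ i = locMult γ t ^ i := by
    intro i
    rw [hm, orderOf_dvd_iff_pow_eq_one, hs, ht, ← map_pow, ← map_pow, (em F).injective.eq_iff,
      div_pow, div_eq_one_iff_eq (pow_ne_zero i hb)]
  have hfp := freePair_semisimple hγ hfix hst hm0 hmi
  have hfrob : ∀ y, y = s ∨ y = t → frobP1 F y = y := by
    intro y hy
    have hy' := (hfix y).mpr hy
    have h1 : moebius γ (frobP1 F y) = frobP1 F y := by rw [(moebius_frobP1 hγ y).1, hy']
    by_contra hne
    refine hns (scalar_of_locMult_eq hγ h1 hy' hne ?_)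
    rw [(moebius_frobP1 hγ y).2]
    rcases hy with rfl | rfl
    · rw [hs, em_pow_card]
    · rw [ht, em_pow_card]
  have hsσ := hfrob s (Or.inl rfl)
  have htσ := hfrob t (Or.inr rfl)
  have hK : ∀ y ∈ ({s, t} : Finset P1), moebius γ y = y := by simp [hsf, htf]
  have hσK : ∀ y, frobP1 F y ∈ ({s, t} : Finset P1) ↔ y ∈ ({s, t} : Finset P1) := by
    intro y
    simp only [Finset.mem_insert, Finset.mem_singleton]
    constructor
    · intro h
      rcases h with h | h
      · left; exact frobP1_injective (h.trans hsσ.symm)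
      · right; exact frobP1_injective (h.trans htσ.symm)
    · intro h; rw [hfrob y h]; exact h
  have hα : ∀ y, locMult (γ ^ m) y = em F a ^ m := by
    obtain ⟨c, hc⟩ := (pow_scalar_iff hγ hsf htf hst m).mpr ((hmi m).mp dvd_rfl)
    have hc0 : c ≠ 0 := smul_one_det_ne_zero (by rw [← hc]; exact det_pow_ne_zero hγ m)
    intro y
    rw [← hs, ← (locMult_pow_of_fixed hγ hsf m).2, hc, (moebius_smul_one hc0 y).2,
      (moebius_smul_one hc0 s).2]
  have hcount := fun k hk => ncard_stableSets_split hγ hsf htf hst hsσ htσ hfp (n := k) hk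
  have hsqb : IsSq (em F a ^ (n - 2) * (em F a * em F b)) ↔
      Even ((Fintype.card F - 1) / m) := by
    have hn2' : Even (n - 2) := (Nat.even_sub hn2.le).mpr ⟨fun _ => even_two, fun _ => hn⟩
    have h1 := (isSq_iff hq _).mp (isSq_em_pow ha hn2')
    have h2 := (isSq_iff hq _).mp (isSq_em_pow hb even_two)
    have h3 : em F a * em F b = em F (a / b) * em F b ^ 2 := by
      rw [← map_pow, ← map_mul, ← map_mul]; congr 1; field_simp
    rw [isSq_iff hq, mul_pow, h1, one_mul, h3, mul_pow, h2, mul_one, ← map_pow,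
      map_eq_one_iff _ (em F).injective, ← orderOf_dvd_iff_pow_eq_one, ← hm,
      ← dvd_half_iff hm0 _ hmq, show Fintype.card F / 2 = (Fintype.card F - 1) / 2 by
        obtain ⟨k, hk⟩ := hq; omega]
    obtain ⟨k, hk⟩ := hq
    exact ⟨k, by omega⟩
  rw [ncard_goodSets hγ hK hσK hfp hα, sum_powerset_pair hst]
  simp only [Finset.card_empty, Finset.image_empty, Finset.prod_empty, Finset.card_singleton,
    Finset.image_singleton, Finset.prod_singleton, Finset.card_pair hst, Finset.image_insert,
    Finset.prod_pair hst, hsσ, htσ, hs, ht, Nat.zero_le, true_and, hn2.le, mul_one, Nat.sub_zero,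
    isSq_em_pow ha hn, if_true, (show 1 ≤ n by omega), hsqb]
  have hs1 : IsSq (em F a ^ (n - 1) * em F a) := by
    rw [← pow_succ, Nat.sub_add_cancel (by omega)]; exact isSq_em_pow ha hn
  rw [if_pos hs1]
  have ht1 : ((if IsSq (em F a ^ (n - 1) * em F b) then
      (stableSets (frobP1 F) (moebius γ) {y | y ∉ ({s, t} : Finset P1)} (n - 1)).ncard else 0 : ℕ) : ℚ)
      = if m ∣ n - 1 then ((Fintype.card F : ℚ) - 1) * A2 (Fintype.card F) ((n - 1) / m) else 0 := by
    rw [← hcount (n - 1) (by omega)]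
    by_cases hmn : m ∣ n - 1
    · rw [if_pos]
      have h1 := (hmi (n - 1)).mp hmn
      rw [hs, ht] at h1
      rw [h1, ← pow_succ, Nat.sub_add_cancel (by omega)]; exact isSq_em_pow hb hn
    · rw [ncard_stableSets_of_not_dvd hfp hmn, ite_self]
  rw [Nat.cast_add, Nat.cast_add, Nat.cast_add, ht1, Nat.cast_ite, hcount n (by omega),
    hcount (n - 1) (by omega), hcount (n - 2) (by omega)]
  by_cases h1 : m ∣ n <;> by_cases h2 : m ∣ n - 1 <;> by_cases h3 : m ∣ n - 2 <;>
    by_cases h4 : Even ((Fintype.card F - 1) / m) <;> simp only [h1, h2, h3, h4, if_true, if_false, and_true,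
      and_false, Nat.cast_zero] <;> ring

lemma ncard_goodSets_unipotent {γ : Matrix (Fin 2) (Fin 2) F}
    (hγ : γ.det ≠ 0) (hns : ¬ ∃ c : F, γ = c • (1 : Matrix (Fin 2) (Fin 2) F)) {a : F}
    (hsum : γ.trace = a + a) (hprod : γ.det = a * a) {p : ℕ} [Fact p.Prime] [CharP F p]
    {n : ℕ} (hn : Even n) (hn2 : 2 < n) :
    ((goodSets γ n).ncard : ℚ) = (Fintype.card F : ℚ) *
      ((if p ∣ n then A1 (Fintype.card F) (n / p) else 0) +
        if p ∣ n - 1 then A1 (Fintype.card F) ((n - 1) / p) else 0) := by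
  have ha : a ≠ 0 := fun h => hγ (by rw [hprod, h, zero_mul])
  obtain ⟨s, t, hfix, hs, ht⟩ := exists_fixedPoints hγ hns (α := em F a) (β := em F a)
    (by rw [hsum, map_add]) (by rw [hprod, map_mul])
  have hsf := (hfix s).mpr (Or.inl rfl)
  have htf := (hfix t).mpr (Or.inr rfl)
  obtain rfl : s = t := by
    by_contra hst
    exact hns (scalar_of_locMult_eq hγ hsf htf hst (hs.trans ht.symm))
  simp only [or_self] at hfix
  have hfp := freePair_unipotent (p := p) hγ hfix hsum hprod
  have hsσ : frobP1 F s = s := by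
    rw [← hfix, (moebius_frobP1 hγ s).1, hsf]
  have hα : ∀ y, locMult (γ ^ p) y = em F a ^ p := by
    have hc := pow_eq_scalar_of_nilpotent (p := p) hsum hprod
    intro y
    rw [hc, (moebius_smul_one (pow_ne_zero p ha) y).2, map_pow]
  have hcount := fun k hk => ncard_stableSets_unipotent hγ hsf hsσ hfp (n := k) hk
  have h1 : ({s} : Finset P1).powerset = {∅, {s}} := by
    ext T; simp [Finset.subset_singleton_iff]
  have hs1 : IsSq (em F a ^ (n - 1) * em F a) := by
    rw [← pow_succ, Nat.sub_add_cancel (by omega)]; exact isSq_em_pow ha hn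
  rw [ncard_goodSets hγ (by simp [hsf]) (fun y => by
      simp only [Finset.mem_singleton]
      exact ⟨fun h => frobP1_injective (h.trans hsσ.symm), fun h => by rw [h, hsσ]⟩) hfp hα, h1,
    Finset.sum_pair (Finset.singleton_ne_empty s).symm]
  simp only [Finset.card_empty, Finset.image_empty, Finset.prod_empty, Finset.card_singleton,
    Finset.image_singleton, Finset.prod_singleton, hsσ, hs, Nat.zero_le, true_and, mul_one,
    Nat.sub_zero, isSq_em_pow ha hn, if_true, (show 1 ≤ n by omega), hs1, Nat.cast_add,
    hcount n (by omega), hcount (n - 1) (by omega)]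
  split_ifs <;> ring

lemma ncard_goodSets_nonsplit (hq : Odd (Fintype.card F)) {γ : Matrix (Fin 2) (Fin 2) F}
    (hγ : γ.det ≠ 0) {α : AlgebraicClosure F} (hαF : α ^ Fintype.card F ≠ α)
    (hsum : α + α ^ Fintype.card F = em F γ.trace) (hprod : α * α ^ Fintype.card F = em F γ.det)
    {n : ℕ} (hn : Even n) (hn2 : 2 < n) :
    ((goodSets γ n).ncard : ℚ) = ((Fintype.card F : ℚ) + 1) *
      ((if orderOf (α ^ (Fintype.card F - 1)) ∣ n ∧ Even (n / orderOf (α ^ (Fintype.card F - 1)))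
          then A0 (Fintype.card F) (n / orderOf (α ^ (Fintype.card F - 1))) else 0) +
        if orderOf (α ^ (Fintype.card F - 1)) ∣ n - 2 ∧
            ((n - 2) / orderOf (α ^ (Fintype.card F - 1))) % 2 =
              ((Fintype.card F + 1) / orderOf (α ^ (Fintype.card F - 1))) % 2
          then A0 (Fintype.card F) ((n - 2) / orderOf (α ^ (Fintype.card F - 1))) else 0) := by
  have hq1 : 1 < Fintype.card F := Fintype.one_lt_card
  set q := Fintype.card F with hqdef
  set m := orderOf (α ^ (q - 1)) with hm
  have hα0 : α ≠ 0 := by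
    rintro rfl
    exact hαF (zero_pow (by omega))
  have hpq : α * α ^ (q - 1) = α ^ q := by
    rw [← pow_succ', Nat.sub_add_cancel hq1.le]
  have hαq2 : (α ^ q) ^ q = α := by
    have h1 : (α * α ^ q) ^ q = α * α ^ q := by rw [hprod, em_pow_card]
    rw [mul_pow, mul_comm α] at h1
    exact mul_left_cancel₀ (pow_ne_zero q hα0) h1
  have hmq : m ∣ q + 1 := by
    apply orderOf_dvd_of_pow_eq_one
    have h2 : (α ^ (q - 1)) ^ (q + 1) * α = α := by
      rw [← pow_mul, ← pow_succ, show (q - 1) * (q + 1) + 1 = q * q by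
        obtain ⟨r, hr⟩ := Nat.exists_eq_add_of_lt hq1
        rw [hr, show 0 + 1 + r + 1 - 1 = r + 1 by omega] <;> ring, pow_mul, hαq2]
    exact mul_right_cancel₀ hα0 (by rw [h2, one_mul])
  have hm0 : 0 < m := Nat.pos_of_dvd_of_pos hmq (by omega)
  have hns : ¬ ∃ c : F, γ = c • (1 : Matrix (Fin 2) (Fin 2) F) := by
    rintro ⟨c, rfl⟩
    simp only [Matrix.trace_smul, Matrix.trace_one, Fintype.card_fin, Nat.cast_ofNat, smul_eq_mul,
      Matrix.det_smul, Matrix.det_one, mul_one, map_mul, map_pow, map_ofNat] at hsum hprod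
    have : (α - α ^ q) * (α - α ^ q) = 0 := by
      linear_combination (α + α ^ q + em F c * 2) * hsum - 4 * hprod
    exact hαF (sub_eq_zero.mp (mul_self_eq_zero.mp this)).symm
  obtain ⟨s, t, hfix, hs, ht⟩ := exists_fixedPoints hγ hns hsum hprod
  have hst : s ≠ t := by
    rintro rfl
    exact hαF (ht.symm.trans hs)
  have hsf := (hfix s).mpr (Or.inl rfl)
  have htf := (hfix t).mpr (Or.inr rfl)
  have hmi : ∀ i, m ∣ i ↔ locMult γ s ^ i = locMult γ t ^ i := by
    intro i
    rw [hm, orderOf_dvd_iff_pow_eq_one, hs, ht, ← hpq, mul_pow]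
    exact ⟨fun h => by rw [h, mul_one], fun h => (mul_eq_left₀ (pow_ne_zero i hα0)).mp h.symm⟩
  have hfp := freePair_semisimple hγ hfix hst hm0 hmi
  have hfrob : ∀ y z, moebius γ y = y → moebius γ z = z → locMult γ y ^ q = locMult γ z →
      frobP1 F y = z := by
    intro y z hy hz hyz
    have h1 : moebius γ (frobP1 F y) = frobP1 F y := by rw [(moebius_frobP1 hγ y).1, hy]
    by_contra hne
    refine hns (scalar_of_locMult_eq hγ h1 hz hne ?_)
    rw [(moebius_frobP1 hγ y).2, ← hqdef, hyz]
  have hsσ := hfrob s t hsf htf (by rw [hs, ht])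
  have htσ := hfrob t s htf hsf (by rw [hs, ht, hαq2])
  have hK : ∀ y ∈ ({s, t} : Finset P1), moebius γ y = y := by simp [hsf, htf]
  have hσK : ∀ y, frobP1 F y ∈ ({s, t} : Finset P1) ↔ y ∈ ({s, t} : Finset P1) := by
    intro y
    simp only [Finset.mem_insert, Finset.mem_singleton]
    constructor
    · rintro (h | h)
      · right; exact frobP1_injective (h.trans htσ.symm)
      · left; exact frobP1_injective (h.trans hsσ.symm)
    · rintro (rfl | rfl)
      · right; exact hsσ
      · left; exact htσ
  have hα : ∀ y, locMult (γ ^ m) y = α ^ m := by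
    obtain ⟨c, hc⟩ := (pow_scalar_iff hγ hsf htf hst m).mpr ((hmi m).mp dvd_rfl)
    have hc0 : c ≠ 0 := smul_one_det_ne_zero (by rw [← hc]; exact det_pow_ne_zero hγ m)
    intro y
    rw [← hs, ← (locMult_pow_of_fixed hγ hsf m).2, hc, (moebius_smul_one hc0 y).2,
      (moebius_smul_one hc0 s).2]
  have hcount := fun k hk => ncard_stableSets_nonsplit hγ hsf htf hst hsσ htσ hfp (n := k) hk
  have hsq : ∀ k, Even k → (IsSq (α ^ k) ↔ m ∣ k / 2) := by
    rintro k ⟨l, rfl⟩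
    rw [isSq_iff hq, hm, orderOf_dvd_iff_pow_eq_one, ← pow_mul, ← pow_mul, ← two_mul,
      Nat.mul_div_cancel_left _ two_pos, ← hqdef]
    have : 2 * l * (q / 2) = (q - 1) * l := by
      obtain ⟨r, hr⟩ := hq
      rw [hr, show (2 * r + 1) / 2 = r by omega, Nat.add_sub_cancel]
      ring
    rw [this]
  have hone : ({t} : Finset P1) ≠ {s} := fun h => hst (Finset.singleton_injective h).symm
  rw [ncard_goodSets hγ hK hσK hfp hα, sum_powerset_pair hst]
  simp only [Finset.card_empty, Finset.image_empty, Finset.prod_empty, Finset.card_singleton,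
    Finset.image_singleton, Finset.prod_singleton, Finset.card_pair hst, Finset.image_insert,
    Finset.prod_pair hst, hsσ, htσ, hs, ht, Nat.zero_le, true_and, hn2.le, mul_one, Nat.sub_zero,
    hone, hone.symm, false_and, and_false, if_false, add_zero, zero_add, Finset.pair_comm t s,
    hsq n hn]
  have hn' : Even (n - 2 + (q + 1)) := by
    obtain ⟨r, hr⟩ := hq
    obtain ⟨l, hl⟩ := hn
    exact ⟨l + r, by omega⟩
  rw [show α ^ (n - 2) * (α * α ^ q) = α ^ (n - 2 + (q + 1)) by ring, hsq _ hn', Nat.cast_add,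
    Nat.cast_ite, Nat.cast_ite, hcount n (by omega), hcount (n - 2) (by omega)]
  have h1 : m ∣ n → (m ∣ n / 2 ↔ Even (n / m)) := dvd_half_iff hm0 hn
  have h2 : m ∣ n - 2 → (m ∣ (n - 2 + (q + 1)) / 2 ↔ ((n - 2) / m) % 2 = ((q + 1) / m) % 2) := by
    intro h
    rw [dvd_half_iff hm0 hn' (dvd_add h hmq), Nat.add_div_of_dvd_right h, Nat.even_iff]
    omega
  rw [← hqdef]
  by_cases h3 : m ∣ n <;> by_cases h4 : m ∣ n - 2 <;>
    simp only [h1, h2, h3, h4, if_true, if_false, true_and, false_and, Nat.cast_zero, mul_add,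
      mul_ite, mul_zero, ite_self]

end GoodSets

section MatrixCount

variable {F : Type} [Field F] [Fintype F]

lemma card_mul_eq (c : F) : (Finset.univ.filter fun y : F × F => y.1 * y.2 = c).card =
    if c = 0 then 2 * Fintype.card F - 1 else Fintype.card F - 1 := by
  have h1 : 1 < Fintype.card F := Fintype.one_lt_card
  rw [Finset.card_eq_sum_card_fiberwise (f := Prod.fst) (t := Finset.univ) (fun _ _ => by simp)]
  have h : ∀ y : F, ((Finset.univ.filter fun z : F × F => z.1 * z.2 = c).filter
      fun z => z.1 = y).card =
      if y = 0 then (if c = 0 then Fintype.card F else 0) else 1 := by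
    intro y
    have : ((Finset.univ.filter fun z : F × F => z.1 * z.2 = c).filter fun z => z.1 = y) =
        (Finset.univ.filter fun z : F => y * z = c).map ⟨Prod.mk y, Prod.mk_right_injective y⟩ := by
      ext ⟨u, v⟩
      simp only [Finset.mem_filter, Finset.mem_univ, true_and, Finset.mem_map,
        Function.Embedding.coeFn_mk, Prod.mk.injEq]
      exact ⟨fun h => ⟨v, by rw [← h.2, h.1], h.2.symm, rfl⟩, by rintro ⟨w, h, rfl, rfl⟩; exact ⟨h, rfl⟩⟩
    rw [this, Finset.card_map]
    split_ifs with hy hc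
    · simp [hy, hc]
    · simp [hy, Ne.symm hc]
    · rw [Finset.card_eq_one]
      refine ⟨y⁻¹ * c, ?_⟩
      ext z
      simp only [Finset.mem_filter, Finset.mem_univ, true_and, Finset.mem_singleton]
      constructor
      · rintro rfl; field_simp
      · rintro rfl; field_simp
  rw [Finset.sum_congr rfl fun y _ => h y, ← Finset.add_sum_erase _ _ (Finset.mem_univ (0 : F)),
    if_pos rfl, Finset.sum_congr rfl fun y hy => if_neg (Finset.ne_of_mem_erase hy)]
  simp only [Finset.sum_const, Finset.card_erase_of_mem (Finset.mem_univ (0 : F)),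
    Finset.card_univ, smul_eq_mul, mul_one]
  split_ifs <;> omega

variable (F) in
/-- The `2 × 2` matrices over `F` with trace `a` and determinant `b`. -/
def trDet (a b : F) : Finset (Matrix (Fin 2) (Fin 2) F) :=
  Finset.univ.filter fun γ => γ.trace = a ∧ γ.det = b

lemma card_trDet (a b : F) : (trDet F a b).card = Fintype.card F * (Fintype.card F - 1) +
    Fintype.card F * (Finset.univ.filter fun x : F => x * (a - x) = b).card := by
  have h1 : 1 < Fintype.card F := Fintype.one_lt_card
  have hf : ∀ x : F, ((trDet F a b).filter fun γ => γ 0 0 = x).card =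
      (Fintype.card F - 1) + if x * (a - x) = b then Fintype.card F else 0 := by
    intro x
    have : ((trDet F a b).filter fun γ => γ 0 0 = x).card =
        (Finset.univ.filter fun y : F × F => y.1 * y.2 = x * (a - x) - b).card := by
      refine Finset.card_bij' (fun γ _ => (γ 0 1, γ 1 0))
        (fun y _ => !![x, y.1; y.2, a - x]) ?_ ?_ ?_ ?_
      · intro γ hγ
        simp only [trDet, Finset.mem_filter, Finset.mem_univ, true_and, Matrix.trace_fin_two,
          Matrix.det_fin_two] at hγ ⊢
        obtain ⟨⟨h2, h3⟩, rfl⟩ := hγ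
        rw [← h2, ← h3]
        ring
      · intro y hy
        simp only [trDet, Finset.mem_filter, Finset.mem_univ, true_and] at hy ⊢
        refine ⟨⟨by simp [Matrix.trace_fin_two], ?_⟩, by simp⟩
        rw [Matrix.det_fin_two_of, hy]
        ring
      · intro γ hγ
        simp only [trDet, Finset.mem_filter, Finset.mem_univ, true_and, Matrix.trace_fin_two]
          at hγ
        obtain ⟨⟨h2, -⟩, rfl⟩ := hγ
        ext i j
        fin_cases i <;> fin_cases j <;> simp [← h2]
      · intro y _
        simp
    rw [this, card_mul_eq]
    simp only [sub_eq_zero]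
    split_ifs <;> omega
  rw [Finset.card_eq_sum_card_fiberwise (f := fun γ => γ 0 0) (t := Finset.univ)
    (fun _ _ => by simp), Finset.sum_congr rfl fun x _ => hf x, Finset.sum_add_distrib,
    ← Finset.sum_filter]
  simp [mul_comm]

lemma card_trDet_split {a b : F} (hab : a ≠ b) :
    ((trDet F (a + b) (a * b)).card : ℚ) = (Fintype.card F : ℚ) ^ 2 + Fintype.card F := by
  have h1 : 1 ≤ Fintype.card F := Fintype.card_pos
  have : (Finset.univ.filter fun x : F => x * (a + b - x) = a * b) = {a, b} := by
    ext x
    simp only [Finset.mem_filter, Finset.mem_univ, true_and, Finset.mem_insert,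
      Finset.mem_singleton]
    rw [← sub_eq_zero, show x * (a + b - x) - a * b = -((x - a) * (x - b)) by ring, neg_eq_zero,
      mul_eq_zero, sub_eq_zero, sub_eq_zero]
  rw [card_trDet, this, Finset.card_pair hab]
  push_cast [Nat.cast_sub h1]
  ring

lemma card_trDet_double (a : F) :
    ((trDet F (a + a) (a * a)).card : ℚ) = (Fintype.card F : ℚ) ^ 2 := by
  have h1 : 1 ≤ Fintype.card F := Fintype.card_pos
  have : (Finset.univ.filter fun x : F => x * (a + a - x) = a * a) = {a} := by
    ext x
    simp only [Finset.mem_filter, Finset.mem_univ, true_and, Finset.mem_singleton]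
    rw [← sub_eq_zero, show x * (a + a - x) - a * a = -((x - a) * (x - a)) by ring, neg_eq_zero,
      mul_eq_zero, sub_eq_zero, or_self]
  rw [card_trDet, this, Finset.card_singleton]
  push_cast [Nat.cast_sub h1]
  ring

lemma card_trDet_nonsplit {a b : F} {α : AlgebraicClosure F} (hα : α ^ Fintype.card F ≠ α)
    (ha : α + α ^ Fintype.card F = em F a) (hb : α * α ^ Fintype.card F = em F b) :
    ((trDet F a b).card : ℚ) = (Fintype.card F : ℚ) ^ 2 - Fintype.card F := by
  have h1 : 1 ≤ Fintype.card F := Fintype.card_pos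
  have : (Finset.univ.filter fun x : F => x * (a - x) = b) = ∅ := by
    rw [Finset.filter_eq_empty_iff]
    intro x _ hx
    have h := congrArg (em F) hx
    rw [map_mul, map_sub, ← ha, ← hb, ← sub_eq_zero] at h
    have h2 : (em F x - α) * (em F x - α ^ Fintype.card F) = 0 := by
      rw [← neg_eq_zero, ← h]; ring
    rcases mul_eq_zero.mp h2 with h2 | h2
    · rw [sub_eq_zero] at h2
      exact hα (by rw [← h2, em_pow_card])
    · rw [sub_eq_zero] at h2
      apply hα
      have : (α ^ Fintype.card F) ^ Fintype.card F = α ^ Fintype.card F := by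
        rw [← h2, em_pow_card]
      exact pow_card_injective this
  rw [card_trDet, this, Finset.card_empty]
  push_cast [Nat.cast_sub h1]
  ring

end MatrixCount

section RootSums

lemma sum_orderOf {K : Type*} [Field K] {ζ : K} {N : ℕ} (hN : 0 < N) (hζ : IsPrimitiveRoot ζ N)
    (f : ℕ → ℚ) :
    ∑ ω ∈ (nthRootsFinset N (1 : K)).filter (fun ω => ω ≠ 1), f (orderOf ω) =
      ∑ m ∈ N.divisors.filter (fun m => 1 < m), (Nat.totient m : ℚ) * f m := by
  have hmaps : ∀ ω ∈ (nthRootsFinset N (1 : K)).filter (fun ω => ω ≠ 1),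
      orderOf ω ∈ N.divisors.filter (fun m => 1 < m) := by
    intro ω hω
    rw [Finset.mem_filter, mem_nthRootsFinset hN] at hω
    have h := orderOf_dvd_of_pow_eq_one hω.1
    have h0 := Nat.pos_of_dvd_of_pos h hN
    have h1 : orderOf ω ≠ 1 := fun h => hω.2 (orderOf_eq_one_iff.mp h)
    rw [Finset.mem_filter, Nat.mem_divisors]
    exact ⟨⟨h, hN.ne'⟩, by omega⟩
  rw [← Finset.sum_fiberwise_of_maps_to hmaps]
  refine Finset.sum_congr rfl fun m hm => ?_
  rw [Finset.mem_filter, Nat.mem_divisors] at hm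
  obtain ⟨⟨hmN, -⟩, hm1⟩ := hm
  have : ((nthRootsFinset N (1 : K)).filter (fun ω => ω ≠ 1)).filter (fun ω => orderOf ω = m) =
      primitiveRoots m K := by
    ext ω
    rw [Finset.mem_filter, Finset.mem_filter, mem_nthRootsFinset hN,
      mem_primitiveRoots (by omega), IsPrimitiveRoot.iff_orderOf]
    refine ⟨fun h => h.2, fun h => ⟨⟨?_, ?_⟩, h⟩⟩
    · rw [← orderOf_dvd_iff_pow_eq_one, h]; exact hmN
    · rintro rfl; rw [orderOf_one] at h; omega
  have hprim : IsPrimitiveRoot (ζ ^ (N / m)) m := by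
    refine hζ.pow hN ?_
    rw [Nat.div_mul_cancel hmN]
  rw [Finset.sum_congr rfl fun ω hω => by rw [(Finset.mem_filter.mp hω).2], this,
    Finset.sum_const, hprim.card_primitiveRoots, nsmul_eq_mul]

variable (F : Type) [Field F] [Fintype F]

/-- The ordered pairs of distinct nonzero elements of `F`. -/
def splitPairs : Finset (F × F) :=
  Finset.univ.filter fun x => x.1 ≠ 0 ∧ x.2 ≠ 0 ∧ x.1 ≠ x.2

/-- The elements of `𝔽_{q²}` outside `F`. -/
def quadElems : Finset (AlgebraicClosure F) :=
  (nthRootsFinset ((Fintype.card F - 1) * (Fintype.card F + 1))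
    (1 : AlgebraicClosure F)).filter fun x => x ^ (Fintype.card F - 1) ≠ 1

lemma mem_quadElems {x : AlgebraicClosure F} : x ∈ quadElems F ↔
    (x ^ Fintype.card F) ^ Fintype.card F = x ∧ x ^ Fintype.card F ≠ x := by
  have h1 : 1 < Fintype.card F := Fintype.one_lt_card
  obtain ⟨r, hr⟩ := Nat.exists_eq_add_of_lt h1
  have hr' : Fintype.card F = r + 2 := by omega
  rw [quadElems, Finset.mem_filter, mem_nthRootsFinset (Nat.mul_pos (by omega) (by omega)), hr',
    show r + 2 - 1 = r + 1 by omega]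
  by_cases hx : x = 0
  · subst hx; simp
  have e1 : x ^ (r + 2) = x * x ^ (r + 1) := by ring
  have e2 : (x ^ (r + 2)) ^ (r + 2) = x * x ^ ((r + 1) * (r + 2 + 1)) := by ring
  rw [e2, e1]
  simp [hx]

lemma sum_splitPairs (f : ℕ → ℚ) :
    ∑ x ∈ splitPairs F, f (orderOf (x.1 / x.2)) = ((Fintype.card F : ℚ) - 1) *
      ∑ m ∈ (Fintype.card F - 1).divisors.filter (fun m => 1 < m), (Nat.totient m : ℚ) * f m := by
  have h1 : 1 < Fintype.card F := Fintype.one_lt_card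
  have hN : 0 < Fintype.card F - 1 := by omega
  obtain ⟨u, hu⟩ := IsCyclic.exists_ofOrder_eq_natCard (α := Fˣ)
  rw [Nat.card_eq_fintype_card, Fintype.card_units] at hu
  have hζ : IsPrimitiveRoot (u : F) (Fintype.card F - 1) := by
    rw [IsPrimitiveRoot.coe_units_iff, IsPrimitiveRoot.iff_orderOf, hu]
  rw [← sum_orderOf hN hζ f]
  have hmaps : ∀ x ∈ splitPairs F, x.1 / x.2 ∈
      (nthRootsFinset (Fintype.card F - 1) (1 : F)).filter (fun ω => ω ≠ 1) := by
    intro x hx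
    rw [splitPairs, Finset.mem_filter] at hx
    obtain ⟨-, h1, h2, h3⟩ := hx
    rw [Finset.mem_filter, mem_nthRootsFinset hN]
    refine ⟨FiniteField.pow_card_sub_one_eq_one _ (div_ne_zero h1 h2), ?_⟩
    rwa [Ne, div_eq_one_iff_eq h2]
  rw [← Finset.sum_fiberwise_of_maps_to hmaps, Finset.mul_sum]
  refine Finset.sum_congr rfl fun ω hω => ?_
  rw [Finset.mem_filter, mem_nthRootsFinset hN] at hω
  have hω0 : ω ≠ 0 := by
    rintro rfl
    rw [zero_pow hN.ne'] at hω
    exact zero_ne_one hω.1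
  rw [Finset.sum_congr rfl fun x hx => by rw [(Finset.mem_filter.mp hx).2], Finset.sum_const,
    nsmul_eq_mul]
  congr 1
  have : (splitPairs F).filter (fun x => x.1 / x.2 = ω) =
      (Finset.univ.erase (0 : F)).image fun y => (ω * y, y) := by
    ext ⟨x, y⟩
    simp only [splitPairs, Finset.mem_filter, Finset.mem_univ, true_and, Finset.mem_image,
      Finset.mem_erase, and_true, Prod.mk.injEq]
    constructor
    · rintro ⟨⟨hx, hy, -⟩, rfl⟩
      exact ⟨y, hy, by field_simp, rfl⟩
    · rintro ⟨y, hy, rfl, rfl⟩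
      refine ⟨⟨mul_ne_zero hω0 hy, hy, fun h => hω.2 ?_⟩, by field_simp⟩
      exact mul_right_cancel₀ hy (by rw [h, one_mul])
  rw [this, Finset.card_image_of_injective _ fun a b h => (Prod.mk.inj h).2,
    Finset.card_erase_of_mem (Finset.mem_univ _), Finset.card_univ]
  push_cast [Nat.cast_sub h1.le]
  ring

lemma sum_quadElems (f : ℕ → ℚ) :
    ∑ x ∈ quadElems F, f (orderOf (x ^ (Fintype.card F - 1))) = ((Fintype.card F : ℚ) - 1) *
      ∑ m ∈ (Fintype.card F + 1).divisors.filter (fun m => 1 < m), (Nat.totient m : ℚ) * f m := by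
  have h1 : 1 < Fintype.card F := Fintype.one_lt_card
  have hN : 0 < Fintype.card F - 1 := by omega
  have hc : ((Fintype.card F : ℕ) : AlgebraicClosure F) = 0 := by
    have := congrArg (em F) (FiniteField.cast_card_eq_zero F)
    rwa [map_natCast, map_zero] at this
  have : NeZero ((Fintype.card F + 1 : ℕ) : AlgebraicClosure F) :=
    ⟨by rw [Nat.cast_add, hc]; simp⟩
  obtain ⟨ζ, hζ⟩ := HasEnoughRootsOfUnity.exists_primitiveRoot (AlgebraicClosure F)
    (Fintype.card F + 1)
  rw [← sum_orderOf (Nat.succ_pos _) hζ f]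
  have hmaps : ∀ x ∈ quadElems F, x ^ (Fintype.card F - 1) ∈ (nthRootsFinset (Fintype.card F + 1)
      (1 : AlgebraicClosure F)).filter (fun ω => ω ≠ 1) := by
    intro x hx
    rw [quadElems, Finset.mem_filter, mem_nthRootsFinset (Nat.mul_pos hN (Nat.succ_pos _))] at hx
    rw [Finset.mem_filter, mem_nthRootsFinset (Nat.succ_pos _), ← pow_mul]
    exact hx
  rw [← Finset.sum_fiberwise_of_maps_to hmaps, Finset.mul_sum]
  refine Finset.sum_congr rfl fun ω hω => ?_
  rw [Finset.mem_filter, mem_nthRootsFinset (Nat.succ_pos _)] at hω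
  have hω0 : ω ≠ 0 := by
    rintro rfl
    rw [zero_pow (Nat.succ_ne_zero _)] at hω
    exact zero_ne_one hω.1
  rw [Finset.sum_congr rfl fun x hx => by rw [(Finset.mem_filter.mp hx).2], Finset.sum_const,
    nsmul_eq_mul]
  congr 1
  have hdeg : (X ^ (Fintype.card F - 1) - C ω : (AlgebraicClosure F)[X]).natDegree =
      Fintype.card F - 1 := natDegree_X_pow_sub_C
  have h0 : (X ^ (Fintype.card F - 1) - C ω : (AlgebraicClosure F)[X]) ≠ 0 :=
    X_pow_sub_C_ne_zero hN ω
  have : (quadElems F).filter (fun x => x ^ (Fintype.card F - 1) = ω) =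
      (X ^ (Fintype.card F - 1) - C ω : (AlgebraicClosure F)[X]).roots.toFinset := by
    ext x
    rw [Multiset.mem_toFinset, mem_roots h0, quadElems, Finset.mem_filter, Finset.mem_filter,
      mem_nthRootsFinset (Nat.mul_pos hN (Nat.succ_pos _)), IsRoot.def, eval_sub, eval_pow, eval_X,
      eval_C, sub_eq_zero]
    refine ⟨fun h => h.2, fun h => ⟨⟨?_, ?_⟩, h⟩⟩
    · rw [pow_mul, h, hω.1]
    · rw [h]; exact hω.2
  rw [this, card_roots_toFinset_of_derivative, hdeg, Nat.cast_sub h1.le, Nat.cast_one]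
  intro x hx
  simp only [eval_sub, eval_pow, eval_X, eval_C, sub_eq_zero] at hx
  have hx0 : x ≠ 0 := by
    rintro rfl
    rw [zero_pow hN.ne'] at hx
    exact hω0 hx.symm
  rw [derivative_sub, derivative_X_pow, derivative_C, sub_zero, eval_mul, eval_C, eval_pow,
    eval_X, Nat.cast_sub h1.le, hc]
  simp [hx0]

end RootSums

section GroupSum

variable {F : Type} [Field F] [Fintype F]

lemma eq_or_eq_of_add_mul {K : Type*} [Field K] {a b x y : K} (hs : x + y = a + b)
    (hp : x * y = a * b) : x = a ∧ y = b ∨ x = b ∧ y = a := by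
  have : (x - a) * (x - b) = 0 := by
    have hy : y = a + b - x := by rw [← hs]; ring
    rw [hy] at hp
    linear_combination -hp
  rcases mul_eq_zero.mp this with h | h
  · rw [sub_eq_zero] at h
    subst h
    exact Or.inl ⟨rfl, add_left_cancel hs⟩
  · rw [sub_eq_zero] at h
    subst h
    exact Or.inr ⟨rfl, add_left_cancel (hs.trans (add_comm _ _))⟩

lemma card_eigenvalues (γ : Matrix (Fin 2) (Fin 2) F) :
    ((splitPairs F).filter fun x => γ.trace = x.1 + x.2 ∧ γ.det = x.1 * x.2).card +
      2 * ((Finset.univ.erase (0 : F)).filter fun a => γ.trace = a + a ∧ γ.det = a * a).card +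
      ((quadElems F).filter fun x => x + x ^ Fintype.card F = em F γ.trace ∧
        x * x ^ Fintype.card F = em F γ.det).card = if γ.det ≠ 0 then 2 else 0 := by
  split_ifs with hγ
  swap
  · rw [not_not] at hγ
    simp only [hγ, map_zero]
    have e1 : ((splitPairs F).filter fun x => γ.trace = x.1 + x.2 ∧ 0 = x.1 * x.2) = ∅ := by
      rw [Finset.filter_eq_empty_iff]
      intro x hx h
      rw [splitPairs, Finset.mem_filter] at hx
      exact mul_ne_zero hx.2.1 hx.2.2.1 h.2.symm
    have e2 : ((Finset.univ.erase (0 : F)).filter fun a => γ.trace = a + a ∧ 0 = a * a) = ∅ := by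
      rw [Finset.filter_eq_empty_iff]
      intro a ha h
      rw [Finset.mem_erase] at ha
      exact mul_ne_zero ha.1 ha.1 h.2.symm
    have e3 : ((quadElems F).filter fun x => x + x ^ Fintype.card F = em F γ.trace ∧
        x * x ^ Fintype.card F = 0) = ∅ := by
      rw [Finset.filter_eq_empty_iff]
      intro x hx h
      have h0 : x = 0 := by
        have := h.2
        rw [← pow_succ'] at this
        exact eq_zero_of_pow_eq_zero this
      rw [mem_quadElems] at hx
      exact hx.2 (by rw [h0, zero_pow Fintype.card_ne_zero])
    rw [e1, e2, e3]
    simp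
  obtain ⟨α, β, hsum, hprod⟩ := exists_eigenvalues γ
  have hFr : α ^ Fintype.card F + β ^ Fintype.card F = α + β := by
    rw [← pow_card_add, hsum, em_pow_card]
  have hFp : α ^ Fintype.card F * β ^ Fintype.card F = α * β := by
    rw [← mul_pow, hprod, em_pow_card]
  by_cases hα : α ^ Fintype.card F = α
  · have hβ : β ^ Fintype.card F = β := by
      rw [hα] at hFr
      exact add_left_cancel hFr
    obtain ⟨a, rfl⟩ := mem_range_em hα
    obtain ⟨b, rfl⟩ := mem_range_em hβ
    have ht : γ.trace = a + b := (em F).injective (by rw [map_add, hsum])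
    have hd : γ.det = a * b := (em F).injective (by rw [map_mul, hprod])
    have ha : a ≠ 0 := fun h => hγ (by rw [hd, h, zero_mul])
    have hb : b ≠ 0 := fun h => hγ (by rw [hd, h, mul_zero])
    have e3 : ((quadElems F).filter fun x => x + x ^ Fintype.card F = em F γ.trace ∧
        x * x ^ Fintype.card F = em F γ.det) = ∅ := by
      rw [Finset.filter_eq_empty_iff]
      intro x hx h
      rw [mem_quadElems] at hx
      rw [← hsum, ← hprod] at h
      rcases eq_or_eq_of_add_mul h.1 h.2 with h | h
      · exact hx.2 (by rw [h.1, hα])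
      · exact hx.2 (by rw [h.1, hβ])
    rw [e3, ht, hd]
    by_cases hab : a = b
    · subst hab
      have e1 : ((splitPairs F).filter fun x => a + a = x.1 + x.2 ∧ a * a = x.1 * x.2) = ∅ := by
        rw [Finset.filter_eq_empty_iff]
        intro x hx h
        rw [splitPairs, Finset.mem_filter] at hx
        rcases eq_or_eq_of_add_mul h.1.symm h.2.symm with h | h <;>
          exact hx.2.2.2 (h.1.trans h.2.symm)
      have e2 : ((Finset.univ.erase (0 : F)).filter fun c => a + a = c + c ∧ a * a = c * c) =
          {a} := by
        ext c
        simp only [Finset.mem_filter, Finset.mem_erase, Finset.mem_univ, and_true,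
          Finset.mem_singleton]
        refine ⟨fun h => ?_, by rintro rfl; exact ⟨ha, rfl, rfl⟩⟩
        rcases eq_or_eq_of_add_mul h.2.1.symm h.2.2.symm with h | h <;> exact h.1
      rw [e1, e2]
      simp
    · have e1 : ((splitPairs F).filter fun x => a + b = x.1 + x.2 ∧ a * b = x.1 * x.2) =
          {(a, b), (b, a)} := by
        ext ⟨x, y⟩
        simp only [splitPairs, Finset.mem_filter, Finset.mem_univ, true_and, Finset.mem_insert,
          Finset.mem_singleton, Prod.mk.injEq]
        refine ⟨fun h => eq_or_eq_of_add_mul h.2.1.symm h.2.2.symm, ?_⟩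
        rintro (⟨rfl, rfl⟩ | ⟨rfl, rfl⟩)
        · exact ⟨⟨ha, hb, hab⟩, rfl, rfl⟩
        · exact ⟨⟨hb, ha, Ne.symm hab⟩, add_comm _ _, mul_comm _ _⟩
      have e2 : ((Finset.univ.erase (0 : F)).filter fun c => a + b = c + c ∧ a * b = c * c) =
          ∅ := by
        rw [Finset.filter_eq_empty_iff]
        intro c hc h
        rcases eq_or_eq_of_add_mul h.1.symm h.2.symm with h | h
        · exact hab (h.1.symm.trans h.2)
        · exact hab (h.2.symm.trans h.1)
      rw [e1, e2, Finset.card_pair (by simp [hab])]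
      simp
  · obtain ⟨h1, h2⟩ : α ^ Fintype.card F = β ∧ β ^ Fintype.card F = α := by
      rcases eq_or_eq_of_add_mul hFr hFp with h | h
      · exact absurd h.1 hα
      · exact h
    have key : ∀ x y : F, γ.trace = x + y → γ.det = x * y → False := by
      intro x y hx hy
      rw [hx, map_add] at hsum
      rw [hy, map_mul] at hprod
      rcases eq_or_eq_of_add_mul hsum hprod with h | h <;>
        exact hα (by rw [h.1, em_pow_card])
    have e1 : ((splitPairs F).filter fun x => γ.trace = x.1 + x.2 ∧ γ.det = x.1 * x.2) = ∅ := by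
      rw [Finset.filter_eq_empty_iff]
      exact fun x _ h => key _ _ h.1 h.2
    have e2 : ((Finset.univ.erase (0 : F)).filter fun a => γ.trace = a + a ∧ γ.det = a * a) =
        ∅ := by
      rw [Finset.filter_eq_empty_iff]
      exact fun x _ h => key _ _ h.1 h.2
    have hαβ : α ≠ β := fun h => hα (h1.trans h.symm)
    have e3 : ((quadElems F).filter fun x => x + x ^ Fintype.card F = em F γ.trace ∧
        x * x ^ Fintype.card F = em F γ.det) = {α, β} := by
      ext x
      simp only [Finset.mem_filter, mem_quadElems, Finset.mem_insert, Finset.mem_singleton]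
      rw [← hsum, ← hprod]
      constructor
      · rintro ⟨-, h⟩
        rcases eq_or_eq_of_add_mul h.1 h.2 with h | h
        · exact Or.inl h.1
        · exact Or.inr h.1
      · rintro (rfl | rfl)
        · rw [h1, h2]
          exact ⟨⟨rfl, hαβ.symm⟩, rfl, rfl⟩
        · rw [h2, h1]
          exact ⟨⟨rfl, hαβ⟩, add_comm _ _, mul_comm _ _⟩
    rw [e1, e2, e3, Finset.card_pair hαβ]
    simp

lemma sum_sum_filter {ι κ : Type*} (s : Finset ι) (t : Finset κ) (r : ι → κ → Prop)
    [∀ x y, Decidable (r x y)] (f : κ → ℚ) :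
    ∑ x ∈ s, ∑ y ∈ t.filter (r x), f y = ∑ y ∈ t, ((s.filter fun x => r x y).card : ℚ) * f y := by
  simp only [Finset.sum_filter, Finset.card_filter, Nat.cast_sum, Finset.sum_mul]
  rw [Finset.sum_comm]
  refine Finset.sum_congr rfl fun y _ => Finset.sum_congr rfl fun x _ => ?_
  split_ifs <;> simp

lemma two_mul_sum_det_ne_zero (f : Matrix (Fin 2) (Fin 2) F → ℚ) :
    2 * ∑ γ ∈ Finset.univ.filter (fun γ => γ.det ≠ 0), f γ =
      ∑ x ∈ splitPairs F, ∑ γ ∈ trDet F (x.1 + x.2) (x.1 * x.2), f γ +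
      2 * ∑ a ∈ Finset.univ.erase (0 : F), ∑ γ ∈ trDet F (a + a) (a * a), f γ +
      ∑ x ∈ quadElems F, ∑ γ ∈ Finset.univ.filter (fun γ =>
        x + x ^ Fintype.card F = em F γ.trace ∧ x * x ^ Fintype.card F = em F γ.det), f γ := by
  simp only [trDet]
  rw [sum_sum_filter, sum_sum_filter, sum_sum_filter, Finset.sum_filter, Finset.mul_sum,
    Finset.mul_sum, ← Finset.sum_add_distrib, ← Finset.sum_add_distrib]
  refine Finset.sum_congr rfl fun γ _ => ?_
  have h := congrArg (Nat.cast (R := ℚ)) (card_eigenvalues γ)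
  push_cast at h
  rw [← mul_assoc, ← add_mul, ← add_mul, h]
  split_ifs <;> ring

lemma sum_ncard_goodSets (hq : Odd (Fintype.card F)) {p : ℕ} [Fact p.Prime] [CharP F p]
    {n : ℕ} (hn : Even (n + 3)) :
    2 * ∑ γ ∈ Finset.univ.filter (fun γ : Matrix (Fin 2) (Fin 2) F => γ.det ≠ 0),
        ((goodSets γ (n + 3)).ncard : ℚ) =
      ((Fintype.card F : ℚ) ^ 2 - 1) * ((Fintype.card F : ℚ) ^ 2 - Fintype.card F) *
      (2 * (Fintype.card F : ℚ) ^ n +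
        (∑ m ∈ (Fintype.card F - 1).divisors.filter (fun m => 1 < m), (Nat.totient m : ℚ) *
          ((if m ∣ n + 3 then A2 (Fintype.card F) ((n + 3) / m) else 0) +
            2 * (if m ∣ n + 2 then A2 (Fintype.card F) ((n + 2) / m) else 0) +
            if m ∣ n + 1 ∧ Even ((Fintype.card F - 1) / m)
              then A2 (Fintype.card F) ((n + 1) / m) else 0)) +
        (∑ m ∈ (Fintype.card F + 1).divisors.filter (fun m => 1 < m), (Nat.totient m : ℚ) *
          ((if m ∣ n + 3 ∧ Even ((n + 3) / m) then A0 (Fintype.card F) ((n + 3) / m) else 0) +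
            if m ∣ n + 1 ∧ ((n + 1) / m) % 2 = ((Fintype.card F + 1) / m) % 2
              then A0 (Fintype.card F) ((n + 1) / m) else 0)) +
        2 * ((if p ∣ n + 3 then A1 (Fintype.card F) ((n + 3) / p) else 0) +
          if p ∣ n + 2 then A1 (Fintype.card F) ((n + 2) / p) else 0)) := by
  have hn2 : 2 < n + 3 := by omega
  have h1 : 1 < Fintype.card F := Fintype.one_lt_card
  have scalar_trDet : ∀ a c : F, c • (1 : Matrix (Fin 2) (Fin 2) F) ∈ trDet F (a + a) (a * a) ↔
      c = a := by
    intro a c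
    simp only [trDet, Finset.mem_filter, Finset.mem_univ, true_and, Matrix.trace_fin_two,
      Matrix.det_fin_two, Matrix.smul_apply, Matrix.one_apply_eq, smul_eq_mul, mul_one]
    constructor
    · rintro ⟨h, h'⟩
      rcases eq_or_eq_of_add_mul h (by simpa using h') with h | h <;> exact h.1
    · rintro rfl; simp
  rw [two_mul_sum_det_ne_zero]
  obtain ⟨C₁, hC₁⟩ : ∃ C : ℕ → ℚ, C = fun m =>
      ((if m ∣ n + 3 then A2 (Fintype.card F) ((n + 3) / m) else 0) +
        2 * (if m ∣ n + 2 then A2 (Fintype.card F) ((n + 2) / m) else 0) +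
        if m ∣ n + 1 ∧ Even ((Fintype.card F - 1) / m)
          then A2 (Fintype.card F) ((n + 1) / m) else 0) := ⟨_, rfl⟩
  obtain ⟨C₀, hC₀⟩ : ∃ C : ℕ → ℚ, C = fun m =>
      ((if m ∣ n + 3 ∧ Even ((n + 3) / m) then A0 (Fintype.card F) ((n + 3) / m) else 0) +
        if m ∣ n + 1 ∧ ((n + 1) / m) % 2 = ((Fintype.card F + 1) / m) % 2
          then A0 (Fintype.card F) ((n + 1) / m) else 0) := ⟨_, rfl⟩
  have hsplit : ∀ x ∈ splitPairs F, ∑ γ ∈ trDet F (x.1 + x.2) (x.1 * x.2),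
      ((goodSets γ (n + 3)).ncard : ℚ) = ((Fintype.card F : ℚ) ^ 2 + Fintype.card F) *
        (((Fintype.card F : ℚ) - 1) * C₁ (orderOf (x.1 / x.2))) := by
    intro x hx
    rw [splitPairs, Finset.mem_filter] at hx
    rw [← card_trDet_split hx.2.2.2, ← nsmul_eq_mul]
    refine Finset.sum_eq_card_nsmul fun γ hγ => ?_
    rw [trDet, Finset.mem_filter] at hγ
    rw [hC₁]
    exact ncard_goodSets_split hq (by rw [hγ.2.2]; exact mul_ne_zero hx.2.1 hx.2.2.1) hx.2.2.2
      hγ.2.1.symm hγ.2.2.symm hn hn2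
  have hdouble : ∀ a ∈ Finset.univ.erase (0 : F), ∑ γ ∈ trDet F (a + a) (a * a),
      ((goodSets γ (n + 3)).ncard : ℚ) =
        (Fintype.card F : ℚ) ^ n * ((Fintype.card F : ℚ) ^ 3 - Fintype.card F) +
        ((Fintype.card F : ℚ) ^ 2 - 1) * ((Fintype.card F : ℚ) *
        ((if p ∣ n + 3 then A1 (Fintype.card F) ((n + 3) / p) else 0) +
          if p ∣ n + 2 then A1 (Fintype.card F) ((n + 2) / p) else 0)) := by
    intro a ha
    have ha := Finset.ne_of_mem_erase ha
    have hmem := (scalar_trDet a a).mpr rfl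
    rw [← Finset.add_sum_erase _ _ hmem, ncard_goodSets_scalar ha hn]
    congr 1
    have hc : (((trDet F (a + a) (a * a)).erase (a • 1)).card : ℚ) =
        (Fintype.card F : ℚ) ^ 2 - 1 := by
      rw [Finset.card_erase_of_mem hmem, Nat.cast_sub (Finset.card_pos.mpr ⟨_, hmem⟩),
        card_trDet_double, Nat.cast_one]
    rw [← hc, ← nsmul_eq_mul]
    refine Finset.sum_eq_card_nsmul fun γ hγ => ?_
    rw [Finset.mem_erase] at hγ
    obtain ⟨hne, hγ⟩ := hγ
    have hγ' := hγ
    rw [trDet, Finset.mem_filter] at hγ'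
    refine ncard_goodSets_unipotent (by rw [hγ'.2.2]; exact mul_ne_zero ha ha) ?_ hγ'.2.1 hγ'.2.2
      hn hn2
    rintro ⟨c, rfl⟩
    exact hne (by rw [(scalar_trDet a c).mp hγ])
  have hnonsplit : ∀ x ∈ quadElems F, ∑ γ ∈ Finset.univ.filter (fun γ =>
        x + x ^ Fintype.card F = em F γ.trace ∧ x * x ^ Fintype.card F = em F γ.det),
      ((goodSets γ (n + 3)).ncard : ℚ) = ((Fintype.card F : ℚ) ^ 2 - Fintype.card F) *
        (((Fintype.card F : ℚ) + 1) * C₀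
          (orderOf (x ^ (Fintype.card F - 1)))) := by
    intro x hx
    obtain ⟨hx1, hx2⟩ := (mem_quadElems F).mp hx
    have hx0 : x ≠ 0 := by
      rintro rfl
      exact hx2 (zero_pow Fintype.card_ne_zero)
    obtain ⟨a, ha⟩ := mem_range_em (F := F) (x := x + x ^ Fintype.card F) (by
      rw [pow_card_add, hx1, add_comm])
    obtain ⟨b, hb⟩ := mem_range_em (F := F) (x := x * x ^ Fintype.card F) (by
      rw [mul_pow, hx1, mul_comm])
    have : (Finset.univ.filter fun γ : Matrix (Fin 2) (Fin 2) F =>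
        x + x ^ Fintype.card F = em F γ.trace ∧ x * x ^ Fintype.card F = em F γ.det) =
        trDet F a b := by
      ext γ
      rw [trDet, Finset.mem_filter, Finset.mem_filter, ← ha, ← hb, (em F).injective.eq_iff,
        (em F).injective.eq_iff, eq_comm (a := a), eq_comm (a := b)]
    rw [this, ← card_trDet_nonsplit hx2 ha.symm hb.symm, ← nsmul_eq_mul]
    refine Finset.sum_eq_card_nsmul fun γ hγ => ?_
    rw [trDet, Finset.mem_filter] at hγ
    obtain ⟨-, rfl, rfl⟩ := hγ
    rw [hC₀]
    refine ncard_goodSets_nonsplit hq ?_ hx2 ha.symm hb.symm hn hn2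
    intro h
    rw [h, map_zero] at hb
    exact mul_ne_zero hx0 (pow_ne_zero _ hx0) hb.symm
  rw [Finset.sum_congr rfl hsplit, Finset.sum_congr rfl hdouble, Finset.sum_congr rfl hnonsplit,
    ← Finset.mul_sum, ← Finset.mul_sum, ← Finset.mul_sum, ← Finset.mul_sum, sum_splitPairs,
    sum_quadElems, Finset.sum_const, Finset.card_erase_of_mem (Finset.mem_univ _),
    Finset.card_univ, nsmul_eq_mul, Nat.cast_sub h1.le, Nat.cast_one]
  simp only [hC₁, hC₀]
  ring

end GroupSum

section Orbits

variable {F : Type} [Field F]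

lemma det_val_ne_zero (γ : GL (Fin 2) F) : γ.val.det ≠ 0 :=
  (γ.isUnit.map Matrix.detMonoidHom).ne_zero

lemma Jmult_mul {γ δ : Matrix (Fin 2) (Fin 2) F} (hγ : γ.det ≠ 0) (hδ : δ.det ≠ 0)
    (S : Finset (Option (AlgebraicClosure F))) :
    Jmult (γ * δ) S = Jmult γ (S.image (moebius δ)) * Jmult δ S := by
  rw [Jmult, Jmult, Jmult, Finset.prod_image fun _ _ _ _ h => moebius_injective hδ h,
    ← Finset.prod_mul_distrib]
  exact Finset.prod_congr rfl fun t _ => (moebius_mul hγ hδ t).2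

lemma image_moebius_mul {γ δ : Matrix (Fin 2) (Fin 2) F} (hγ : γ.det ≠ 0) (hδ : δ.det ≠ 0)
    (S : Finset (Option (AlgebraicClosure F))) :
    S.image (moebius (γ * δ)) = (S.image (moebius δ)).image (moebius γ) := by
  rw [Finset.image_image]
  exact Finset.image_congr fun t _ => (moebius_mul hγ hδ t).1

variable [Fintype F]

lemma frobP1_image_moebius {γ : Matrix (Fin 2) (Fin 2) F} (hγ : γ.det ≠ 0)
    {S : Finset (Option (AlgebraicClosure F))} (hS : S.image (frobP1 F) = S) :
    (S.image (moebius γ)).image (frobP1 F) = S.image (moebius γ) := by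
  conv_rhs => rw [← hS]
  rw [Finset.image_image, Finset.image_image]
  exact Finset.image_congr fun t _ => ((moebius_frobP1 hγ t).1).symm

lemma exists_em_eq_Jmult {γ : Matrix (Fin 2) (Fin 2) F} (hγ : γ.det ≠ 0)
    {S : Finset (Option (AlgebraicClosure F))} (hS : S.image (frobP1 F) = S) :
    ∃ u : Fˣ, em F u = Jmult γ S := by
  have h0 : Jmult γ S ≠ 0 := Finset.prod_ne_zero_iff.mpr fun t _ => locMult_ne_zero hγ t
  have hF : Jmult γ S ^ Fintype.card F = Jmult γ S := by
    conv_rhs => rw [Jmult, ← hS, Finset.prod_image fun _ _ _ _ h => frobP1_injective h]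
    rw [Jmult, ← Finset.prod_pow]
    exact Finset.prod_congr rfl fun t _ => ((moebius_frobP1 hγ t).2).symm
  obtain ⟨a, ha⟩ := mem_range_em hF
  exact ⟨Units.mk0 a (by rintro rfl; exact h0 (by rw [← ha, map_zero])), ha⟩

variable (F) in
/-- The rational `n`-sets, as a type. -/
def RatSets (n : ℕ) : Type :=
  {S : Finset (Option (AlgebraicClosure F)) // S.card = n ∧ S.image (frobP1 F) = S}

instance (n : ℕ) : Finite (RatSets F n) := finite_ratSets F n

variable (F) in
/-- Pairs of a scalar and a rational `n`-set. -/
@[ext] structure ScaledSets (n : ℕ) where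
  /-- The scalar. -/
  scalar : Fˣ
  /-- The rational set. -/
  pts : RatSets F n

instance (n : ℕ) : Finite (ScaledSets F n) :=
  Finite.of_injective (fun y : ScaledSets F n => (y.scalar, y.pts)) fun _ _ h =>
    ScaledSets.ext (Prod.mk.inj h).1 (Prod.mk.inj h).2

/-- The multiplier `J(γ,S)` as an element of `Fˣ`. -/
def unitJ (γ : GL (Fin 2) F) {n : ℕ} (S : RatSets F n) : Fˣ :=
  (exists_em_eq_Jmult (det_val_ne_zero γ) S.2.2).choose

lemma em_unitJ (γ : GL (Fin 2) F) {n : ℕ} (S : RatSets F n) :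
    em F (unitJ γ S) = Jmult γ.val S.1 :=
  (exists_em_eq_Jmult (det_val_ne_zero γ) S.2.2).choose_spec

instance (n : ℕ) : MulAction (GL (Fin 2) F) (RatSets F n) where
  smul γ S := ⟨S.1.image (moebius γ.val), by
    rw [Finset.card_image_of_injective _ (moebius_injective (det_val_ne_zero γ)), S.2.1],
    frobP1_image_moebius (det_val_ne_zero γ) S.2.2⟩
  one_smul S := Subtype.ext (by
    change S.1.image (moebius 1) = S.1
    rw [Finset.image_congr (g := id) fun t _ => (moebius_one t).1, Finset.image_id])
  mul_smul γ δ S := Subtype.ext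
    (image_moebius_mul (det_val_ne_zero γ) (det_val_ne_zero δ) S.1)

lemma unitJ_mul (γ δ : GL (Fin 2) F) {n : ℕ} (S : RatSets F n) :
    unitJ (γ * δ) S = unitJ γ (δ • S) * unitJ δ S := by
  apply Units.ext
  apply (em F).injective
  rw [Units.val_mul, map_mul, em_unitJ, em_unitJ, em_unitJ]
  exact Jmult_mul (det_val_ne_zero γ) (det_val_ne_zero δ) S.1

lemma unitJ_one {n : ℕ} (S : RatSets F n) : unitJ 1 S = 1 := by
  have h := unitJ_mul 1 1 S
  rw [one_smul, mul_one] at h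
  exact left_eq_mul.mp h

instance (n : ℕ) : MulAction (GL (Fin 2) F × Fˣ) (ScaledSets F n) where
  smul x y := ⟨y.1 * unitJ x.1 y.2 * (x.2 * x.2)⁻¹, x.1 • y.2⟩
  one_smul y := by
    change ScaledSets.mk (y.1 * unitJ 1 y.2 * (1 * 1)⁻¹) ((1 : GL (Fin 2) F) • y.2) = y
    rw [unitJ_one, one_smul]
    simp
  mul_smul x x' y := by
    change ScaledSets.mk (y.1 * unitJ (x.1 * x'.1) y.2 * (x.2 * x'.2 * (x.2 * x'.2))⁻¹)
        ((x.1 * x'.1) • y.2) =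
      ScaledSets.mk (y.1 * unitJ x'.1 y.2 * (x'.2 * x'.2)⁻¹ * unitJ x.1 (x'.1 • y.2) *
        (x.2 * x.2)⁻¹) (x.1 • x'.1 • y.2)
    rw [unitJ_mul, mul_smul]
    congr 1
    simp only [mul_inv]
    ac_rfl

lemma smul_def {n : ℕ} (x : GL (Fin 2) F × Fˣ) (y : ScaledSets F n) :
    x • y = ⟨y.1 * unitJ x.1 y.2 * (x.2 * x.2)⁻¹, x.1 • y.2⟩ := rfl

/-- A scaled rational set as an element of `F × Finset P¹(k̄)`. -/
def ScaledSets.toProd {n : ℕ} (y : ScaledSets F n) : F × Finset (Option (AlgebraicClosure F)) :=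
  (y.1, y.2.1)

lemma ScaledSets.toProd_injective {n : ℕ} :
    Function.Injective (ScaledSets.toProd : ScaledSets F n → _) := by
  intro y z h
  obtain ⟨h1, h2⟩ := Prod.mk.inj h
  exact ScaledSets.ext (Units.ext h1) (Subtype.ext h2)

lemma orbitPair_eq {n : ℕ} (y : ScaledSets F n) :
    orbitPair (y.1 : F) y.2.1 = ScaledSets.toProd '' MulAction.orbit (GL (Fin 2) F × Fˣ) y := by
  ext ⟨b, T⟩
  simp only [orbitPair, Set.mem_ofPred_eq, Set.mem_image, MulAction.mem_orbit_iff]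
  constructor
  · rintro ⟨γ, u, hu, rfl, h⟩
    refine ⟨_, ⟨(γ, Units.mk0 u hu), rfl⟩, ?_⟩
    rw [smul_def]
    refine Prod.ext ?_ rfl
    have h' : b * (u * u) = y.1 * unitJ γ y.2 := by
      apply (em F).injective
      rw [map_mul, map_mul (em F) y.1.val, em_unitJ, h]
    simp only [ScaledSets.toProd, Units.val_mul, Units.val_inv_eq_inv_val, Units.val_mk0]
    rw [← h', mul_assoc, mul_inv_cancel₀ (mul_ne_zero hu hu), mul_one]
  · rintro ⟨_, ⟨x, rfl⟩, h⟩
    obtain ⟨rfl, rfl⟩ := Prod.mk.inj h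
    refine ⟨x.1, x.2, x.2.ne_zero, rfl, ?_⟩
    rw [smul_def, ← em_unitJ, ← map_mul, ← map_mul, ← Units.val_mul, ← Units.val_mul,
      ← Units.val_mul, inv_mul_cancel_right]

lemma ncard_orbitPair (n : ℕ) :
    Set.ncard {A : Set (F × Finset (Option (AlgebraicClosure F))) |
        ∃ lam : F, ∃ S : Finset (Option (AlgebraicClosure F)),
          lam ≠ 0 ∧ S.card = n ∧ S.image (frobP1 F) = S ∧ A = orbitPair lam S} =
      Nat.card (MulAction.orbitRel.Quotient (GL (Fin 2) F × Fˣ) (ScaledSets F n)) := by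
  have : {A : Set (F × Finset (Option (AlgebraicClosure F))) |
        ∃ lam : F, ∃ S : Finset (Option (AlgebraicClosure F)),
          lam ≠ 0 ∧ S.card = n ∧ S.image (frobP1 F) = S ∧ A = orbitPair lam S} =
      Set.range fun ω : MulAction.orbitRel.Quotient (GL (Fin 2) F × Fˣ) (ScaledSets F n) =>
        ScaledSets.toProd '' ω.orbit := by
    ext A
    simp only [Set.mem_ofPred_eq, Set.mem_range]
    constructor
    · rintro ⟨lam, S, hlam, h1, h2, rfl⟩
      exact ⟨Quotient.mk'' ⟨Units.mk0 lam hlam, ⟨S, h1, h2⟩⟩,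
        (orbitPair_eq (n := n) ⟨Units.mk0 lam hlam, ⟨S, h1, h2⟩⟩).symm⟩
    · rintro ⟨ω, rfl⟩
      induction ω using Quotient.inductionOn' with
      | h y => exact ⟨y.1, y.2.1, y.1.ne_zero, y.2.2.1, y.2.2.2, (orbitPair_eq y).symm⟩
  rw [this, Set.ncard_def, Set.encard, ← Set.image_univ, ← Set.encard, ← Set.ncard_def,
    Set.ncard_image_of_injective _ fun a b h => MulAction.orbitRel.Quotient.orbit_injective
      (ScaledSets.toProd_injective.image_injective h), Set.ncard_univ]

lemma card_sq_eq (hq : Odd (Fintype.card F)) (x : AlgebraicClosure F) :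
    (Finset.univ.filter fun u : Fˣ => x = em F (u * u)).card = if IsSq x then 2 else 0 := by
  have h2 : (2 : F) ≠ 0 := by
    refine Ring.two_ne_zero fun h => ?_
    have := FiniteField.even_card_of_char_two h
    rw [Nat.odd_iff] at hq
    omega
  split_ifs with h
  · obtain ⟨v, hv, rfl⟩ := h
    have : (Finset.univ.filter fun u : Fˣ => em F (v * v) = em F (u * u)) =
        {Units.mk0 v hv, -Units.mk0 v hv} := by
      ext u
      simp only [Finset.mem_filter, Finset.mem_univ, true_and, Finset.mem_insert,
        Finset.mem_singleton, (em F).injective.eq_iff, mul_self_eq_mul_self_iff, Units.ext_iff,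
        Units.val_neg, Units.val_mk0]
      constructor
      · rintro (h | h)
        · exact Or.inl h.symm
        · exact Or.inr (by rw [h, neg_neg])
      · rintro (h | h)
        · exact Or.inl h.symm
        · exact Or.inr (by rw [h, neg_neg])
    rw [this, Finset.card_pair]
    intro h
    have h := congrArg Units.val h
    rw [Units.val_neg, Units.val_mk0, eq_neg_iff_add_eq_zero, ← two_mul] at h
    exact mul_ne_zero h2 hv h
  · rw [Finset.card_eq_zero, Finset.filter_eq_empty_iff]
    exact fun u _ hu => h ⟨u, u.ne_zero, hu⟩

lemma card_fixedBy {n : ℕ} (γ : GL (Fin 2) F) (u : Fˣ) :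
    Nat.card (MulAction.fixedBy (ScaledSets F n) (γ, u)) = (Fintype.card F - 1) *
      ((finite_ratSets F n).toFinset.filter fun S =>
        S.image (moebius γ.val) = S ∧ Jmult γ.val S = em F (u * u)).card := by
  have e : MulAction.fixedBy (ScaledSets F n) (γ, u) ≃
      Fˣ × {S // S ∈ (finite_ratSets F n).toFinset.filter fun S =>
        S.image (moebius γ.val) = S ∧ Jmult γ.val S = em F (u * u)} := by
    have key : ∀ y : ScaledSets F n, (γ, u) • y = y ↔
        y.2.1.image (moebius γ.val) = y.2.1 ∧ Jmult γ.val y.2.1 = em F (u * u) := by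
      intro y
      rw [smul_def, ScaledSets.ext_iff, and_comm, ← em_unitJ, (em F).injective.eq_iff, ← Units.val_mul,
        ← Units.ext_iff, mul_assoc, mul_eq_left, mul_inv_eq_one]
      exact and_congr_left fun _ => Subtype.ext_iff
    refine
      { toFun := fun y => (y.1.1, ⟨y.1.2.1, ?_⟩)
        invFun := fun z => ⟨⟨z.1, ⟨z.2.1, ?_⟩⟩, ?_⟩
        left_inv := fun y => rfl
        right_inv := fun z => rfl }
    · rw [Finset.mem_filter, Set.Finite.mem_toFinset]
      exact ⟨y.1.2.2, (key y.1).mp y.2⟩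
    · exact (Set.Finite.mem_toFinset (finite_ratSets F n)).mp (Finset.mem_filter.mp z.2.2).1
    · exact (key _).mpr (Finset.mem_filter.mp z.2.2).2
  rw [Nat.card_congr e, Nat.card_prod, Nat.card_eq_fintype_card, Fintype.card_units,
    Nat.card_eq_fintype_card, Fintype.card_coe]

lemma sum_card_fixedBy (hq : Odd (Fintype.card F)) {n : ℕ} (γ : GL (Fin 2) F) :
    ∑ u : Fˣ, Nat.card (MulAction.fixedBy (ScaledSets F n) (γ, u)) =
      (Fintype.card F - 1) * (2 * (goodSets γ.val n).ncard) := by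
  simp only [card_fixedBy]
  rw [← Finset.mul_sum]
  congr 1
  simp only [Finset.card_filter]
  rw [Finset.sum_comm]
  have h : ∀ S : Finset (Option (AlgebraicClosure F)), (∑ u : Fˣ,
      if S.image (moebius γ.val) = S ∧ Jmult γ.val S = em F (u * u) then 1 else 0) =
      2 * if S.image (moebius γ.val) = S ∧ IsSq (Jmult γ.val S) then 1 else 0 := by
    intro S
    by_cases hS : S.image (moebius γ.val) = S
    · simp only [hS, true_and]
      rw [← Finset.card_filter, card_sq_eq hq]
      split_ifs <;> rfl
    · simp [hS]
  rw [Finset.sum_congr rfl fun S _ => h S, ← Finset.mul_sum, ← Finset.card_filter,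
    ← Set.ncard_coe_finset]
  congr 2
  ext S
  simp [goodSets, and_assoc]

lemma card_orbits_mul (hq : Odd (Fintype.card F)) (n : ℕ) :
    (Nat.card (MulAction.orbitRel.Quotient (GL (Fin 2) F × Fˣ) (ScaledSets F n)) : ℚ) *
      (((Fintype.card F : ℚ) ^ 2 - 1) * ((Fintype.card F : ℚ) ^ 2 - Fintype.card F)) =
    2 * ∑ γ ∈ Finset.univ.filter (fun γ : Matrix (Fin 2) (Fin 2) F => γ.det ≠ 0),
        ((goodSets γ n).ncard : ℚ) := by
  have h1 : 1 < Fintype.card F := Fintype.one_lt_card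
  have := Fintype.ofFinite (ScaledSets F n)
  have := Fintype.ofFinite (MulAction.orbitRel.Quotient (GL (Fin 2) F × Fˣ) (ScaledSets F n))
  have hB := MulAction.sum_card_fixedBy_eq_card_orbits_mul_card_group (GL (Fin 2) F × Fˣ)
    (ScaledSets F n)
  simp only [← Nat.card_eq_fintype_card] at hB
  rw [Fintype.sum_prod_type, Finset.sum_congr rfl fun γ _ => sum_card_fixedBy hq γ,
    ← Finset.mul_sum, ← Finset.mul_sum, Nat.card_prod, Nat.card_eq_fintype_card (α := Fˣ),
    Fintype.card_units, Matrix.card_GL_field, Fin.prod_univ_two] at hB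
  have hsum : ∑ γ ∈ Finset.univ.filter (fun γ : Matrix (Fin 2) (Fin 2) F => γ.det ≠ 0),
      (goodSets γ n).ncard = ∑ γ : GL (Fin 2) F, (goodSets γ.val n).ncard := by
    refine (Finset.sum_bij (fun γ _ => γ.val) ?_ ?_ ?_ ?_).symm
    · exact fun γ _ => Finset.mem_filter.mpr ⟨Finset.mem_univ _, det_val_ne_zero γ⟩
    · exact fun γ _ δ _ h => Units.ext h
    · intro γ hγ
      exact ⟨Matrix.GeneralLinearGroup.mkOfDetNeZero γ (Finset.mem_filter.mp hγ).2,
        Finset.mem_univ _, rfl⟩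
    · exact fun _ _ => rfl
  rw [← hsum] at hB
  have hB' : 2 * ∑ γ ∈ Finset.univ.filter (fun γ : Matrix (Fin 2) (Fin 2) F => γ.det ≠ 0),
      (goodSets γ n).ncard =
      Nat.card (MulAction.orbitRel.Quotient (GL (Fin 2) F × Fˣ) (ScaledSets F n)) *
        ((Fintype.card F ^ 2 - 1) * (Fintype.card F ^ 2 - Fintype.card F)) := by
    refine Nat.eq_of_mul_eq_mul_left (Nat.sub_pos_of_lt h1) (hB.trans ?_)
    simp only [Fin.val_zero, Fin.val_one, pow_zero, pow_one]
    ring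
  have hB'' := congrArg (Nat.cast (R := ℚ)) hB'
  push_cast [Nat.cast_sub (show 1 ≤ Fintype.card F ^ 2 from Nat.one_le_pow _ _ (by omega)),
    Nat.cast_sub (show Fintype.card F ≤ Fintype.card F ^ 2 from Nat.le_self_pow two_ne_zero _)]
    at hB''
  exact hB''.symm

end Orbits

section DivisorSums

lemma sum_divisors_swap {M N : ℕ} (hM : M ≠ 0) (hN : N ≠ 0) (c : ℕ → ℚ) :
    ∑ m ∈ M.divisors.filter (fun m => 1 < m), (if m ∣ N then c m else 0) =
      ∑ m ∈ N.divisors.filter (fun m => 1 < m), (if m ∣ M then c m else 0) := by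
  rw [← Finset.sum_filter, ← Finset.sum_filter]
  refine Finset.sum_congr ?_ fun _ _ => rfl
  ext m
  simp only [Finset.mem_filter, Nat.mem_divisors]
  tauto

lemma sum_divisors_eq {N p : ℕ} (hN : N ≠ 0) (hp : 1 < p) (c : ℕ → ℚ) :
    ∑ m ∈ N.divisors.filter (fun m => 1 < m), (if m = p then c m else 0) =
      if p ∣ N then c p else 0 := by
  rw [Finset.sum_ite_eq' _ p]
  simp [hN, hp]

end DivisorSums

theorem stmt17 {F : Type} [Field F] [Fintype F] (q : ℕ) (hqcard : q = Fintype.card F)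
    (hq : Odd q) (p : ℕ) (hp : p = ringChar F) (g : ℕ) (hg : 2 ≤ g) :
    (Set.ncard {A : Set (F × Finset (Option (AlgebraicClosure F))) |
        ∃ lam : F, ∃ S : Finset (Option (AlgebraicClosure F)),
          lam ≠ 0 ∧ S.card = 2 * g + 2 ∧ S.image (frobP1 F) = S ∧
          A = orbitPair lam S} : ℚ)
    = 2 * (q : ℚ) ^ (2 * g - 1)
      + ∑ m ∈ (2 * g + 2).divisors.filter (fun m => 1 < m),
          ((Nat.totient m : ℚ) *
              (if m ∣ q + 1 ∧ Even ((2 * g + 2) / m) then A0 q ((2 * g + 2) / m) else 0)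
            + (Nat.totient m : ℚ) *
              (if m ∣ q - 1 then A2 q ((2 * g + 2) / m) else 0)
            + 2 * (if m = p then A1 q ((2 * g + 2) / m) else 0))
      + ∑ m ∈ (2 * g + 1).divisors.filter (fun m => 1 < m),
          (2 * (Nat.totient m : ℚ) *
              (if m ∣ q - 1 then A2 q ((2 * g + 1) / m) else 0)
            + 2 * (if m = p then A1 q ((2 * g + 1) / m) else 0))
      + ∑ m ∈ (2 * g).divisors.filter (fun m => 1 < m),
          (Nat.totient m : ℚ) *
            ((if m ∣ q + 1 ∧ (2 * g / m) % 2 = ((q + 1) / m) % 2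
                then A0 q (2 * g / m) else 0)
              + (if m ∣ q - 1 ∧ Even ((q - 1) / m) then A2 q (2 * g / m) else 0)) := by
  subst hqcard
  have hp1 := CharP.char_is_prime F (ringChar F)
  rw [← hp] at hp1
  have : Fact p.Prime := ⟨hp1⟩
  have : CharP F p := hp ▸ ringChar.charP F
  have h1 : 1 < Fintype.card F := Fintype.one_lt_card
  have hM : Fintype.card F - 1 ≠ 0 := by omega
  have hM' : Fintype.card F + 1 ≠ 0 := by omega
  obtain ⟨n, hn⟩ : ∃ n, 2 * g = n + 1 := ⟨2 * g - 1, by omega⟩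
  have hev : Even (n + 3) := ⟨g + 1, by omega⟩
  have hne : ((Fintype.card F : ℚ) ^ 2 - 1) * ((Fintype.card F : ℚ) ^ 2 - Fintype.card F) ≠ 0 := by
    have h : (1 : ℚ) < Fintype.card F := by exact_mod_cast h1
    refine mul_ne_zero ?_ ?_ <;> nlinarith
  have key := (card_orbits_mul hq (n + 3)).trans (sum_ncard_goodSets hq (p := p) hev)
  rw [mul_comm, mul_right_inj' hne] at key
  rw [show 2 * g + 2 = n + 3 by omega, show 2 * g + 1 = n + 2 by omega,
    show 2 * g - 1 = n by omega, show 2 * g = n + 1 by omega, ncard_orbitPair, key]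
  have s1 := sum_divisors_swap hM (N := n + 3) (by omega) fun m =>
    (Nat.totient m : ℚ) * A2 (Fintype.card F) ((n + 3) / m)
  have s2 := sum_divisors_swap hM (N := n + 2) (by omega) fun m =>
    2 * (Nat.totient m : ℚ) * A2 (Fintype.card F) ((n + 2) / m)
  have s3 := sum_divisors_swap hM (N := n + 1) (by omega) fun m =>
    if Even ((Fintype.card F - 1) / m)
      then (Nat.totient m : ℚ) * A2 (Fintype.card F) ((n + 1) / m) else 0
  have s4 := sum_divisors_swap hM' (N := n + 3) (by omega) fun m =>
    if Even ((n + 3) / m) then (Nat.totient m : ℚ) * A0 (Fintype.card F) ((n + 3) / m) else 0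
  have s5 := sum_divisors_swap hM' (N := n + 1) (by omega) fun m =>
    if ((n + 1) / m) % 2 = ((Fintype.card F + 1) / m) % 2
      then (Nat.totient m : ℚ) * A0 (Fintype.card F) ((n + 1) / m) else 0
  have s6 := sum_divisors_eq (N := n + 3) (by omega) hp1.one_lt fun m =>
    2 * A1 (Fintype.card F) ((n + 3) / m)
  have s7 := sum_divisors_eq (N := n + 2) (by omega) hp1.one_lt fun m =>
    2 * A1 (Fintype.card F) ((n + 2) / m)
  simp only [mul_add, Finset.sum_add_distrib, mul_ite, mul_zero, ite_and, ← mul_assoc,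
    mul_comm _ (2 : ℚ)] at s1 s2 s3 s4 s5 s6 s7 ⊢
  rw [s1, s2, s3, s4, s5, s6, s7]
  ring

end Hyp
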